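/- Let (Π_n)_{n≥1} be a sequence of partitions of [0,T] with mesh |Π_n| → 0 such that the upper value functions U^{Π_n} converge uniformly on compact subsets of [0,T] × ℝ^d to a bounded continuous function U. Then U is a viscosity solution (both subsolution and supersolution) of the Hamilton–Jacobi–Isaacs equation ∂_t W(t,x) + sup_{μ ∈ ΔU} inf_{ν ∈ ΔV} f̃(t,x,μ,ν)·∇W(t,x) = 0 with terminal condition W(T,·) = g. -/

import Mathlib

open MeasureTheory Set Filter Topology
open scoped unitInterval RealInnerProductSpace ENNReal NNReal

noncomputable section

namespace DGameFormal

/-! ### The canonical sample space `Ω = ([0,1]²)^ℕ` -/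

/-- The sample space `Ω = ([0,1]²)^ℕ`.  The `j`-th coordinate mapping `ζ_{j+1}` of the paper is
`ω ↦ ω j` (we use `0`-based indexing, so the paper's `ζ_j`, `j ≥ 1`, is `ω ↦ ω (j-1)`). -/
abbrev Omega : Type := ℕ → (I × I)

/-- `𝓕_j`: the σ-field generated by the first `j` coordinate mappings `ζ_1, …, ζ_j`. -/
def Fsig (j : ℕ) : MeasurableSpace Omega :=
  MeasurableSpace.comap (fun ω (i : Fin j) => ω (i : ℕ)) inferInstance

/-- `𝓖_{j+1}`: the σ-field generated by the first component of the coordinate `ζ_{j+1}`. -/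
def Gsig (j : ℕ) : MeasurableSpace Omega :=
  MeasurableSpace.comap (fun ω => (ω j).1) inferInstance

/-- `𝓗_{j+1}`: the σ-field generated by the second component of the coordinate `ζ_{j+1}`. -/
def Hsig (j : ℕ) : MeasurableSpace Omega :=
  MeasurableSpace.comap (fun ω => (ω j).2) inferInstance

/-- `P` is the countable product `λ₂^{⊗ℕ}` of the two-dimensional Lebesgue (Borel) measure on the
unit square: it has the prescribed finite-dimensional distributions. -/
def IsProductMeasure (P : Measure Omega) : Prop :=
  ∀ m : ℕ, P.map (fun ω (i : Fin m) => ω (i : ℕ))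
      = Measure.pi (fun _ : Fin m => (volume : Measure (I × I)))

/-! ### Partitions of `[0,T]` -/

/-- A partition `0 = t_0 < t_1 < ⋯ < t_n = T` of the interval `[0,T]`. -/
structure Partition (T : ℝ) where
  n : ℕ
  npos : 0 < n
  t : ℕ → ℝ
  map_zero : t 0 = 0
  map_last : t n = T
  mono : ∀ i < n, t i < t (i + 1)

/-- The mesh `|Π|`: the maximal distance between two neighbouring points of the partition. -/
def Partition.mesh {T : ℝ} (π : Partition T) : ℝ :=
  (Finset.range π.n).sup' (Finset.nonempty_range_iff.2 π.npos.ne') fun i => π.t (i + 1) - π.t i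

open scoped Classical in
/-- For `t ∈ [t_i, t_{i+1})` the index `i` (and `n - 1` for `t ≥ t_{n-1}`). -/
def Partition.idx {T : ℝ} (π : Partition T) (s : ℝ) : ℕ :=
  Nat.findGreatest (fun i => π.t i ≤ s) (π.n - 1)

/-! ### Admissible controls along a partition -/

variable (U V : Type) [MeasurableSpace U] [MeasurableSpace V]

/-- Admissible controls for Player 1 along the partition `π`: measurable processes `u` such that on
each interval `[t_{j-1}, t_j)` of the partition, `u` is a countable sum `Σ_k 1_{Γ_{j,k}} u^{j,k}`
where `(Γ_{j,k})_k ⊆ 𝓕_{j-1}` is a partition of `Ω` and each `u^{j,k}` is `𝓖_j`-measurable. -/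
def AdmControl1 {T : ℝ} (π : Partition T) : Set (ℝ → Omega → U) :=
  {u | Measurable (Function.uncurry u) ∧
    ∀ j < π.n, ∃ (Γ : ℕ → Set Omega) (w : ℕ → ℝ → Omega → U),
      (∀ k, MeasurableSet[Fsig j] (Γ k)) ∧
      Pairwise (Function.onFun Disjoint Γ) ∧
      (⋃ k, Γ k) = univ ∧
      (∀ k s, Measurable[Gsig j] (w k s)) ∧
      (∀ k, ∀ ω ∈ Γ k, ∀ s ∈ Ico (π.t j) (π.t (j + 1)), u s ω = w k s ω)}

/-- Admissible controls for Player 2 along the partition `π` (with `𝓗_j` in place of `𝓖_j`). -/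
def AdmControl2 {T : ℝ} (π : Partition T) : Set (ℝ → Omega → V) :=
  {v | Measurable (Function.uncurry v) ∧
    ∀ j < π.n, ∃ (Γ : ℕ → Set Omega) (w : ℕ → ℝ → Omega → V),
      (∀ k, MeasurableSet[Fsig j] (Γ k)) ∧
      Pairwise (Function.onFun Disjoint Γ) ∧
      (⋃ k, Γ k) = univ ∧
      (∀ k s, Measurable[Hsig j] (w k s)) ∧
      (∀ k, ∀ ω ∈ Γ k, ∀ s ∈ Ico (π.t j) (π.t (j + 1)), v s ω = w k s ω)}

/-! ### Nonanticipative strategies with delay (NAD strategies) -/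

/-- A stopping time `τ : Ω → {0, 1, …, n-1}` of the discrete filtration `(𝓕_j)_j`. -/
def IsStoppingIdx {T : ℝ} (π : Partition T) (τ : Omega → ℕ) : Prop :=
  (∀ ω, τ ω < π.n) ∧ ∀ j, MeasurableSet[Fsig j] {ω | τ ω = j}

variable {U V}

/-- `u = u'`, `ds⊗dP`-a.e. on the stochastic interval `[[t, b]] = {(s,ω) | t ≤ s ≤ b ω}`. -/
def aeStEq {α : Type*} (P : Measure Omega) (t : ℝ) (b : Omega → ℝ)
    (u u' : ℝ → Omega → α) : Prop :=
  ∀ᵐ p ∂((volume : Measure ℝ).prod P), t ≤ p.1 → p.1 ≤ b p.2 → u p.1 p.2 = u' p.1 p.2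

/-- `u = u'`, `ds⊗dP`-a.e. on `[a,b] × Ω`. -/
def aeEqIcc {α : Type*} (P : Measure Omega) (a b : ℝ) (u u' : ℝ → Omega → α) : Prop :=
  ∀ᵐ p ∂((volume : Measure ℝ).prod P), p.1 ∈ Icc a b → u p.1 p.2 = u' p.1 p.2

variable (U V)

/-- NAD strategies for Player 1 on `[t,T]` along `π`: maps from admissible controls of Player 2 to
admissible controls of Player 1 such that controls agreeing `ds⊗dP`-a.e. on `[[t, t_τ]]`, for a
stopping time `τ`, are mapped to controls agreeing `ds⊗dP`-a.e. on `[[t, t_{τ+1}]]`. -/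
def IsNAD1 {T : ℝ} (P : Measure Omega) (π : Partition T) (t : ℝ)
    (α : (ℝ → Omega → V) → (ℝ → Omega → U)) : Prop :=
  (∀ v ∈ AdmControl2 V π, α v ∈ AdmControl1 U π) ∧
  ∀ τ : Omega → ℕ, IsStoppingIdx π τ →
    ∀ v v', v ∈ AdmControl2 V π → v' ∈ AdmControl2 V π →
      aeStEq P t (fun ω => π.t (τ ω)) v v' →
      aeStEq P t (fun ω => π.t (τ ω + 1)) (α v) (α v')

/-- NAD strategies for Player 2 on `[t,T]` along `π`. -/
def IsNAD2 {T : ℝ} (P : Measure Omega) (π : Partition T) (t : ℝ)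
    (β : (ℝ → Omega → U) → (ℝ → Omega → V)) : Prop :=
  (∀ u ∈ AdmControl1 U π, β u ∈ AdmControl2 V π) ∧
  ∀ τ : Omega → ℕ, IsStoppingIdx π τ →
    ∀ u u', u ∈ AdmControl1 U π → u' ∈ AdmControl1 U π →
      aeStEq P t (fun ω => π.t (τ ω)) u u' →
      aeStEq P t (fun ω => π.t (τ ω + 1)) (β u) (β u')

/-! ### The controlled dynamics -/

variable {U V}
variable {d : ℕ}

/-- `X` is the (continuous) solution on `[t,T]` of `X_s = x + ∫_t^s f(r, X_r, u_r, v_r) dr`. -/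
def IsSol (f : ℝ → EuclideanSpace ℝ (Fin d) → U → V → EuclideanSpace ℝ (Fin d)) (T t : ℝ)
    (x : EuclideanSpace ℝ (Fin d)) (u : ℝ → U) (v : ℝ → V)
    (X : ℝ → EuclideanSpace ℝ (Fin d)) : Prop :=
  ContinuousOn X (Icc t T) ∧ ∀ s ∈ Icc t T, X s = x + ∫ r in t..s, f r (X r) (u r) (v r)

/-- The solution `X^{t,x,u,v}` (chosen via the axiom of choice; under the standing assumptions it
is the unique continuous solution). -/
def sol (f : ℝ → EuclideanSpace ℝ (Fin d) → U → V → EuclideanSpace ℝ (Fin d)) (T t : ℝ)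
    (x : EuclideanSpace ℝ (Fin d)) (u : ℝ → U) (v : ℝ → V) : ℝ → EuclideanSpace ℝ (Fin d) :=
  Classical.epsilon (IsSol f T t x u v)

/-- `(u,v)` is the couple of admissible controls associated with the couple of NAD strategies
`(α,β)` on `[t, tl]`:  `α(v) = u` and `β(u) = v`, `ds⊗dP`-a.e. on `[t,tl] × Ω`. -/
def IsFixPair {T : ℝ} (P : Measure Omega) (π : Partition T) (t tl : ℝ)
    (α : (ℝ → Omega → V) → (ℝ → Omega → U)) (β : (ℝ → Omega → U) → (ℝ → Omega → V))
    (u : ℝ → Omega → U) (v : ℝ → Omega → V) : Prop :=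
  u ∈ AdmControl1 U π ∧ v ∈ AdmControl2 V π ∧ aeEqIcc P t tl (α v) u ∧ aeEqIcc P t tl (β u) v

variable [Nonempty U] [Nonempty V]

/-- The couple of admissible controls associated with a couple of NAD strategies on `[t,tl]`
(chosen via the axiom of choice; by Lemma 2.1 it exists and is `ds⊗dP`-a.e. unique). -/
def fixPair {T : ℝ} (P : Measure Omega) (π : Partition T) (t tl : ℝ)
    (α : (ℝ → Omega → V) → (ℝ → Omega → U)) (β : (ℝ → Omega → U) → (ℝ → Omega → V)) :
    (ℝ → Omega → U) × (ℝ → Omega → V) :=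
  Classical.epsilon fun p => IsFixPair P π t tl α β p.1 p.2

/-- The state process `X^{t,x,α,β}` associated with a couple of NAD strategies on `[t,tl]`. -/
def solStrat (f : ℝ → EuclideanSpace ℝ (Fin d) → U → V → EuclideanSpace ℝ (Fin d)) {T : ℝ}
    (P : Measure Omega) (π : Partition T) (t tl : ℝ) (x : EuclideanSpace ℝ (Fin d))
    (α : (ℝ → Omega → V) → (ℝ → Omega → U)) (β : (ℝ → Omega → U) → (ℝ → Omega → V))
    (s : ℝ) (ω : Omega) : EuclideanSpace ℝ (Fin d) :=
  sol f T t x (fun r => (fixPair P π t tl α β).1 r ω) (fun r => (fixPair P π t tl α β).2 r ω) s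

/-- The terminal pay-off `g(X_T^{t,x,α,β})`. -/
def payoff (f : ℝ → EuclideanSpace ℝ (Fin d) → U → V → EuclideanSpace ℝ (Fin d))
    (g : EuclideanSpace ℝ (Fin d) → ℝ) {T : ℝ} (P : Measure Omega) (π : Partition T)
    (t : ℝ) (x : EuclideanSpace ℝ (Fin d))
    (α : (ℝ → Omega → V) → (ℝ → Omega → U)) (β : (ℝ → Omega → U) → (ℝ → Omega → V)) :
    Omega → ℝ :=
  fun ω => g (solStrat f P π t T x α β T ω)

/-! ### Essential suprema/infima of families of random variables -/

/-- `S` is the `P`-a.s. least upper bound of the family `(ξ_i)_{i}` of random variables. -/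
def IsEssSupFam {ι : Sort*} (P : Measure Omega) (ξ : ι → Omega → ℝ) (S : Omega → ℝ) : Prop :=
  (∀ i, ξ i ≤ᵐ[P] S) ∧ ∀ W : Omega → ℝ, (∀ i, ξ i ≤ᵐ[P] W) → S ≤ᵐ[P] W

/-- `S` is the `P`-a.s. greatest lower bound of the family `(ξ_i)_{i}` of random variables. -/
def IsEssInfFam {ι : Sort*} (P : Measure Omega) (ξ : ι → Omega → ℝ) (S : Omega → ℝ) : Prop :=
  (∀ i, S ≤ᵐ[P] ξ i) ∧ ∀ W : Omega → ℝ, (∀ i, W ≤ᵐ[P] ξ i) → W ≤ᵐ[P] S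

/-! ### Value functions along a partition -/

variable (U V)

/-- The defining property of the lower value function along `π`:
`S = esssup_{α} essinf_{β} E[g(X_T^{t,x,α,β}) | 𝓕_i]` for `t_i ≤ t < t_{i+1}`. -/
def IsLowerVal (f : ℝ → EuclideanSpace ℝ (Fin d) → U → V → EuclideanSpace ℝ (Fin d))
    (g : EuclideanSpace ℝ (Fin d) → ℝ) {T : ℝ} (P : Measure Omega) (π : Partition T)
    (t : ℝ) (x : EuclideanSpace ℝ (Fin d)) (S : Omega → ℝ) : Prop :=
  ∃ J : {α // IsNAD1 U V P π t α} → Omega → ℝ,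
    (∀ α, IsEssInfFam P
      (fun β : {β // IsNAD2 U V P π t β} => P[payoff f g P π t x α.1 β.1 | Fsig (π.idx t)])
      (J α)) ∧
    IsEssSupFam P J S

/-- The defining property of the upper value function along `π`. -/
def IsUpperVal (f : ℝ → EuclideanSpace ℝ (Fin d) → U → V → EuclideanSpace ℝ (Fin d))
    (g : EuclideanSpace ℝ (Fin d) → ℝ) {T : ℝ} (P : Measure Omega) (π : Partition T)
    (t : ℝ) (x : EuclideanSpace ℝ (Fin d)) (S : Omega → ℝ) : Prop :=
  ∃ J : {β // IsNAD2 U V P π t β} → Omega → ℝ,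
    (∀ β, IsEssSupFam P
      (fun α : {α // IsNAD1 U V P π t α} => P[payoff f g P π t x α.1 β.1 | Fsig (π.idx t)])
      (J β)) ∧
    IsEssInfFam P J S

/-- The lower value function along `π` seen as a random variable. -/
def lowerVal (f : ℝ → EuclideanSpace ℝ (Fin d) → U → V → EuclideanSpace ℝ (Fin d))
    (g : EuclideanSpace ℝ (Fin d) → ℝ) {T : ℝ} (P : Measure Omega) (π : Partition T)
    (t : ℝ) (x : EuclideanSpace ℝ (Fin d)) : Omega → ℝ :=
  Classical.epsilon (IsLowerVal U V f g P π t x)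

/-- The upper value function along `π` seen as a random variable. -/
def upperVal (f : ℝ → EuclideanSpace ℝ (Fin d) → U → V → EuclideanSpace ℝ (Fin d))
    (g : EuclideanSpace ℝ (Fin d) → ℝ) {T : ℝ} (P : Measure Omega) (π : Partition T)
    (t : ℝ) (x : EuclideanSpace ℝ (Fin d)) : Omega → ℝ :=
  Classical.epsilon (IsUpperVal U V f g P π t x)

/-- The (deterministic) lower value function along `π`: the expectation of `lowerVal`. -/
def lowerValD (f : ℝ → EuclideanSpace ℝ (Fin d) → U → V → EuclideanSpace ℝ (Fin d))
    (g : EuclideanSpace ℝ (Fin d) → ℝ) {T : ℝ} (P : Measure Omega) (π : Partition T)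
    (t : ℝ) (x : EuclideanSpace ℝ (Fin d)) : ℝ :=
  ∫ ω, lowerVal U V f g P π t x ω ∂P

/-- The (deterministic) upper value function along `π`: the expectation of `upperVal`. -/
def upperValD (f : ℝ → EuclideanSpace ℝ (Fin d) → U → V → EuclideanSpace ℝ (Fin d))
    (g : EuclideanSpace ℝ (Fin d) → ℝ) {T : ℝ} (P : Measure Omega) (π : Partition T)
    (t : ℝ) (x : EuclideanSpace ℝ (Fin d)) : ℝ :=
  ∫ ω, upperVal U V f g P π t x ω ∂P

/-! ### The Hamiltonian and viscosity solutions -/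

section Hamiltonian

variable (U V : Type) [MetricSpace U] [MetricSpace V] [MeasurableSpace U] [MeasurableSpace V]

/-- `f̃(t,x,μ,ν) = ∫_U ∫_V f(t,x,u,v) μ(du) ν(dv)` for mixed actions `μ ∈ Δ(U)`, `ν ∈ Δ(V)`. -/
def ftilde (f : ℝ → EuclideanSpace ℝ (Fin d) → U → V → EuclideanSpace ℝ (Fin d))
    (t : ℝ) (x : EuclideanSpace ℝ (Fin d)) (μ : ProbabilityMeasure U) (ν : ProbabilityMeasure V) :
    EuclideanSpace ℝ (Fin d) :=
  ∫ u, ∫ v, f t x u v ∂(ν : Measure V) ∂(μ : Measure U)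

/-- The Hamiltonian `sup_{μ ∈ ΔU} inf_{ν ∈ ΔV} f̃(t,x,μ,ν)·p`. -/
def ham (f : ℝ → EuclideanSpace ℝ (Fin d) → U → V → EuclideanSpace ℝ (Fin d))
    (t : ℝ) (x p : EuclideanSpace ℝ (Fin d)) : ℝ :=
  ⨆ μ : ProbabilityMeasure U, ⨅ ν : ProbabilityMeasure V, ⟪ftilde U V f t x μ ν, p⟫

/-- Viscosity subsolution of `∂_t W + sup_μ inf_ν f̃(t,x,μ,ν)·∇W = 0`, `W(T,·) = g`, on
`[0,T] × ℝ^d`. -/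
def IsViscSubsol (f : ℝ → EuclideanSpace ℝ (Fin d) → U → V → EuclideanSpace ℝ (Fin d))
    (g : EuclideanSpace ℝ (Fin d) → ℝ) (T : ℝ) (W : ℝ → EuclideanSpace ℝ (Fin d) → ℝ) : Prop :=
  (∀ x, W T x ≤ g x) ∧
  ∀ φ : ℝ → EuclideanSpace ℝ (Fin d) → ℝ,
    ContDiff ℝ 1 (fun q : ℝ × EuclideanSpace ℝ (Fin d) => φ q.1 q.2) →
    ∀ t x, t ∈ Ico (0 : ℝ) T →
      IsLocalMaxOn (fun q : ℝ × EuclideanSpace ℝ (Fin d) => W q.1 q.2 - φ q.1 q.2)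
        (Icc (0 : ℝ) T ×ˢ univ) (t, x) →
      0 ≤ deriv (fun s => φ s x) t + ham U V f t x (gradient (fun y => φ t y) x)

/-- Viscosity supersolution of `∂_t W + sup_μ inf_ν f̃(t,x,μ,ν)·∇W = 0`, `W(T,·) = g`, on
`[0,T] × ℝ^d`. -/
def IsViscSupersol (f : ℝ → EuclideanSpace ℝ (Fin d) → U → V → EuclideanSpace ℝ (Fin d))
    (g : EuclideanSpace ℝ (Fin d) → ℝ) (T : ℝ) (W : ℝ → EuclideanSpace ℝ (Fin d) → ℝ) : Prop :=
  (∀ x, g x ≤ W T x) ∧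
  ∀ φ : ℝ → EuclideanSpace ℝ (Fin d) → ℝ,
    ContDiff ℝ 1 (fun q : ℝ × EuclideanSpace ℝ (Fin d) => φ q.1 q.2) →
    ∀ t x, t ∈ Ico (0 : ℝ) T →
      IsLocalMinOn (fun q : ℝ × EuclideanSpace ℝ (Fin d) => W q.1 q.2 - φ q.1 q.2)
        (Icc (0 : ℝ) T ×ˢ univ) (t, x) →
      deriv (fun s => φ s x) t + ham U V f t x (gradient (fun y => φ t y) x) ≤ 0

end Hamiltonian

/-! ### Carathéodory differential equations -/

section Caratheodory

set_option linter.unusedSectionVars false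

variable {E : Type*} [NormedAddCommGroup E] [NormedSpace ℝ E] [MeasurableSpace E]

/-- A time-measurable vector field which is bounded and Lipschitz continuous in space. -/
structure IsCaraField (F : ℝ → E → E) (C : ℝ) (K : ℝ≥0) : Prop where
  meas : Measurable (Function.uncurry F)
  bdd : ∀ r y, ‖F r y‖ ≤ C
  lip : ∀ r, LipschitzWith K (F r)

/-- `X` is a continuous solution on `[a,b]` of `X_s = x + ∫_a^s F(r, X_r) dr`. -/
def IsCaraSol (F : ℝ → E → E) (a b : ℝ) (x : E) (X : ℝ → E) : Prop :=
  ContinuousOn X (Icc a b) ∧ ∀ s ∈ Icc a b, X s = x + ∫ r in a..s, F r (X r)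

/-- The Picard iterates of the integral equation `X_s = x + ∫_a^s F(r, X_r) dr`. -/
def picardIter (F : ℝ → E → E) (a : ℝ) (x : E) : ℕ → ℝ → E
  | 0 => fun _ => x
  | m + 1 => fun s => x + ∫ r in a..s, F r (picardIter F a x m r)

/-- The solution of `X_s = x + ∫_a^s F(r, X_r) dr`, `s ≥ a`, as the limit of Picard iterates. -/
def caraFlow (F : ℝ → E → E) (a : ℝ) (x : E) (s : ℝ) : E :=
  limUnder atTop fun m => picardIter F a x m s

variable [BorelSpace E] [SecondCountableTopology E] {F : ℝ → E → E} {C : ℝ} {K : ℝ≥0}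

lemma IsCaraField.nonneg (hF : IsCaraField F C K) : 0 ≤ C := (norm_nonneg _).trans (hF.bdd 0 0)

lemma IsCaraField.intervalIntegrable (hF : IsCaraField F C K) {X : ℝ → E} (hX : Measurable X)
    (a b : ℝ) : IntervalIntegrable (fun r => F r (X r)) volume a b := by
  refine (intervalIntegrable_const (c := C)).mono_fun' ?_ (ae_of_all _ fun r => hF.bdd _ _)
  exact (hF.meas.comp (measurable_id.prodMk hX)).aestronglyMeasurable

lemma IsCaraField.norm_integral_le (hF : IsCaraField F C K) (X : ℝ → E) (a b : ℝ) :
    ‖∫ r in a..b, F r (X r)‖ ≤ C * |b - a| :=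
  intervalIntegral.norm_integral_le_of_norm_le_const fun _ _ => hF.bdd _ _

lemma integral_congr_extend {X : ℝ → E} {a b s : ℝ} (hab : a ≤ b) (hs : s ∈ Icc a b)
    (F : ℝ → E → E) :
    ∫ r in a..s, F r (X r) = ∫ r in a..s, F r (IccExtend hab (fun r : Icc a b => X r) r) := by
  refine intervalIntegral.integral_congr fun r hr => ?_
  rw [uIcc_of_le hs.1] at hr
  rw [IccExtend_of_mem hab _ (⟨hr.1, hr.2.trans hs.2⟩ : r ∈ Icc a b)]

lemma continuous_extend {X : ℝ → E} {a b : ℝ} (hab : a ≤ b) (hX : ContinuousOn X (Icc a b)) :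
    Continuous (IccExtend hab fun r : Icc a b => X r) :=
  (continuousOn_iff_continuous_domRestrict.1 hX).Icc_extend'

lemma IsCaraField.intervalIntegrable_of_continuousOn (hF : IsCaraField F C K) {X : ℝ → E}
    {a b s : ℝ} (hX : ContinuousOn X (Icc a b)) (hs : s ∈ Icc a b) :
    IntervalIntegrable (fun r => F r (X r)) volume a s := by
  have hab : a ≤ b := hs.1.trans hs.2
  refine (hF.intervalIntegrable (continuous_extend hab hX).measurable a s).congr
    fun r hr => ?_
  rw [uIoc_of_le hs.1] at hr
  rw [IccExtend_of_mem hab _ (⟨hr.1.le, hr.2.trans hs.2⟩ : r ∈ Icc a b)]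

/-- Stability of solutions with respect to the initial value. -/
lemma IsCaraSol.norm_sub_le (hF : IsCaraField F C K) {a b : ℝ} {x y : E} {X Y : ℝ → E}
    (hX : IsCaraSol F a b x X) (hY : IsCaraSol F a b y Y) {s : ℝ} (hs : s ∈ Icc a b) :
    ‖X s - Y s‖ ≤ ‖x - y‖ * Real.exp (K * (s - a)) := by
  have hab : a ≤ b := hs.1.trans hs.2
  set X' := IccExtend hab fun r : Icc a b => X r
  set Y' := IccExtend hab fun r : Icc a b => Y r
  have hX' : Continuous X' := continuous_extend hab hX.1
  have hY' : Continuous Y' := continuous_extend hab hY.1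
  have hc : Continuous fun r => ‖X' r - Y' r‖ := (hX'.sub hY').norm
  have eX : ∀ r ∈ Icc a b, X r = X' r := fun r hr => (IccExtend_of_mem hab (fun r => X r) hr).symm
  have eY : ∀ r ∈ Icc a b, Y r = Y' r := fun r hr => (IccExtend_of_mem hab (fun r => Y r) hr).symm
  have key : ∀ r ∈ Icc a b, ‖X' r - Y' r‖ ≤ K * (∫ q in a..r, ‖X' q - Y' q‖) + ‖x - y‖ := by
    intro r hr
    rw [← eX r hr, ← eY r hr, hX.2 r hr, hY.2 r hr, integral_congr_extend hab hr,
      integral_congr_extend (X := Y) hab hr, add_sub_add_comm,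
      ← intervalIntegral.integral_sub (hF.intervalIntegrable hX'.measurable _ _)
        (hF.intervalIntegrable hY'.measurable _ _), add_comm]
    refine (norm_add_le _ _).trans (add_le_add_left ?_ _)
    rw [← intervalIntegral.integral_const_mul]
    refine intervalIntegral.norm_integral_le_of_norm_le hr.1 (ae_of_all _ fun q _ => ?_)
      ((hc.const_mul _).intervalIntegrable _ _)
    rw [← dist_eq_norm, ← dist_eq_norm]
    exact (hF.lip q).dist_le_mul _ _
  have hd : ∀ r, HasDerivAt (fun r => ∫ q in a..r, ‖X' q - Y' q‖) ‖X' r - Y' r‖ r := fun r =>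
    intervalIntegral.integral_hasDerivAt_right (hc.intervalIntegrable _ _)
      (hc.stronglyMeasurableAtFilter _ _) hc.continuousAt
  have hnn : ∀ r ∈ Icc a b, 0 ≤ ∫ q in a..r, ‖X' q - Y' q‖ := fun r hr =>
    intervalIntegral.integral_nonneg hr.1 fun q _ => norm_nonneg _
  have hg := norm_le_gronwallBound_of_norm_deriv_right_le (f := fun r => ∫ q in a..r, ‖X' q - Y' q‖)
    (f' := fun r => ‖X' r - Y' r‖) (δ := 0) (K := K) (ε := ‖x - y‖) (a := a) (b := b)
    (fun r _ => (hd r).continuousAt.continuousWithinAt) (fun r _ => (hd r).hasDerivWithinAt)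
    (by simp) (fun r hr => by
      have hr' : r ∈ Icc a b := ⟨hr.1, hr.2.le⟩
      rw [norm_norm, Real.norm_of_nonneg (hnn r hr')]
      exact key r hr') s hs
  rw [Real.norm_of_nonneg (hnn s hs)] at hg
  rw [eX s hs, eY s hs]
  refine (key s hs).trans ?_
  by_cases hK : (K : ℝ) = 0
  · simp [hK]
  · rw [gronwallBound_of_K_ne_0 hK] at hg
    have := mul_le_mul_of_nonneg_left hg K.coe_nonneg
    calc _ ≤ K * (0 * Real.exp (K * (s - a)) + ‖x - y‖ / K * (Real.exp (K * (s - a)) - 1))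
          + ‖x - y‖ := by gcongr
      _ = _ := by field_simp; ring

lemma IsCaraSol.eqOn (hF : IsCaraField F C K) {a b : ℝ} {x : E} {X Y : ℝ → E}
    (hX : IsCaraSol F a b x X) (hY : IsCaraSol F a b x Y) : EqOn X Y (Icc a b) := by
  intro s hs
  have := hX.norm_sub_le hF hY hs
  rw [sub_self, norm_zero, zero_mul] at this
  exact sub_eq_zero.1 (norm_le_zero_iff.1 this)

lemma IsCaraSol.norm_sub_init_le (hF : IsCaraField F C K) {a b : ℝ} {x : E} {X : ℝ → E}
    (hX : IsCaraSol F a b x X) {s : ℝ} (hs : s ∈ Icc a b) : ‖X s - x‖ ≤ C * (s - a) := by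
  rw [hX.2 s hs, add_sub_cancel_left]
  exact (hF.norm_integral_le X a s).trans_eq (by rw [abs_of_nonneg (sub_nonneg.2 hs.1)])

lemma IsCaraSol.restart (hF : IsCaraField F C K) {a b c : ℝ} {x : E} {X : ℝ → E}
    (hX : IsCaraSol F a b x X) (hc : c ∈ Icc a b) : IsCaraSol F c b (X c) X := by
  refine ⟨hX.1.mono (Icc_subset_Icc_left hc.1), fun s hs => ?_⟩
  have hs' : s ∈ Icc a b := ⟨hc.1.trans hs.1, hs.2⟩
  rw [hX.2 s hs', hX.2 c hc, add_assoc, intervalIntegral.integral_add_adjacent_intervals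
    (hF.intervalIntegrable_of_continuousOn hX.1 hc)]
  exact (hF.intervalIntegrable_of_continuousOn hX.1 hc).symm.trans
    (hF.intervalIntegrable_of_continuousOn hX.1 hs')

lemma IsCaraField.continuous_picardIter (hF : IsCaraField F C K) (a : ℝ) (x : E) (m : ℕ) :
    Continuous (picardIter F a x m) := by
  induction m with
  | zero => exact continuous_const
  | succ m ih =>
    exact continuous_const.add (intervalIntegral.continuous_primitive
      (fun _ _ => hF.intervalIntegrable ih.measurable _ _) _)

lemma IsCaraField.norm_picardIter_sub_le (hF : IsCaraField F C K) (a : ℝ) (x : E) (m : ℕ) {s : ℝ}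
    (hs : a ≤ s) :
    ‖picardIter F a x (m + 1) s - picardIter F a x m s‖
      ≤ C * (K ^ m * (s - a) ^ (m + 1) / (m + 1).factorial) := by
  induction m generalizing s with
  | zero =>
    simp only [picardIter, add_sub_cancel_left]
    refine (hF.norm_integral_le (fun _ => x) a s).trans_eq ?_
    rw [abs_of_nonneg (sub_nonneg.2 hs)]
    simp
  | succ m ih =>
    have h1 := hF.intervalIntegrable (hF.continuous_picardIter a x (m + 1)).measurable a s
    have h2 := hF.intervalIntegrable (hF.continuous_picardIter a x m).measurable a s
    have e : picardIter F a x (m + 1 + 1) s - picardIter F a x (m + 1) s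
        = ∫ r in a..s, (F r (picardIter F a x (m + 1) r) - F r (picardIter F a x m r)) := by
      rw [intervalIntegral.integral_sub h1 h2]
      simp [picardIter]
    rw [e]
    have hi : ∫ r in a..s, K * (C * (K ^ m * (r - a) ^ (m + 1) / (m + 1).factorial))
        = C * (K ^ (m + 1) * (s - a) ^ (m + 1 + 1) / (m + 1 + 1).factorial) := by
      have : ∀ r : ℝ, K * (C * (K ^ m * (r - a) ^ (m + 1) / (m + 1).factorial))
          = (C * K ^ (m + 1) / (m + 1).factorial) * (r - a) ^ (m + 1) := fun r => by ring
      simp_rw [this]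
      rw [intervalIntegral.integral_const_mul,
        intervalIntegral.integral_comp_sub_right (fun r => r ^ (m + 1)) a, integral_pow, sub_self,
        Nat.factorial_succ (m + 1)]
      push_cast
      field_simp
      ring
    rw [← hi]
    refine intervalIntegral.norm_integral_le_of_norm_le hs (ae_of_all _ fun r hr => ?_)
      (Continuous.intervalIntegrable (by fun_prop) _ _)
    refine le_trans ?_ (mul_le_mul_of_nonneg_left (ih hr.1.le) K.coe_nonneg)
    rw [← dist_eq_norm, ← dist_eq_norm]
    exact (hF.lip r).dist_le_mul _ _

variable [CompleteSpace E]

lemma IsCaraField.tendsto_picardIter (hF : IsCaraField F C K) (a : ℝ) (x : E) {s : ℝ}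
    (hs : a ≤ s) :
    Tendsto (fun m => picardIter F a x m s) atTop (𝓝 (caraFlow F a x s)) := by
  refine CauchySeq.tendsto_limUnder ?_
  refine cauchySeq_of_summable_dist (Summable.of_nonneg_of_le (fun _ => dist_nonneg)
    (fun m => ?_) (f := fun m : ℕ => C * (s - a) * ((K * (s - a)) ^ m / m.factorial)) ?_)
  · rw [dist_comm, dist_eq_norm]
    refine (hF.norm_picardIter_sub_le a x m hs).trans ?_
    have h0 : 0 ≤ s - a := sub_nonneg.2 hs
    calc C * (K ^ m * (s - a) ^ (m + 1) / (m + 1).factorial)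
        ≤ C * (K ^ m * (s - a) ^ (m + 1) / m.factorial) := by
          have := hF.nonneg
          gcongr
          omega
      _ = _ := by rw [mul_pow]; ring
  · exact (Real.summable_pow_div_factorial _).mul_left _

lemma IsCaraField.isCaraSol_caraFlow (hF : IsCaraField F C K) (a b : ℝ) (x : E) :
    IsCaraSol F a b x (caraFlow F a x) := by
  have hlip : ∀ m s r, ‖picardIter F a x m s - picardIter F a x m r‖ ≤ C * ‖s - r‖ := by
    intro m s r
    cases m with
    | zero => simpa [picardIter] using mul_nonneg hF.nonneg (abs_nonneg _)
    | succ m =>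
      have hc := (hF.continuous_picardIter a x m).measurable
      simp only [picardIter, add_sub_add_left_eq_sub]
      rw [intervalIntegral.integral_interval_sub_left (hF.intervalIntegrable hc _ _)
        (hF.intervalIntegrable hc _ _)]
      exact hF.norm_integral_le _ _ _
  have hcont : ContinuousOn (caraFlow F a x) (Icc a b) := by
    refine (LipschitzOnWith.of_dist_le_mul (K := C.toNNReal) fun s hs r hr => ?_).continuousOn
    rw [Real.coe_toNNReal _ hF.nonneg, dist_eq_norm, dist_eq_norm]
    exact le_of_tendsto ((hF.tendsto_picardIter a x hs.1).sub
      (hF.tendsto_picardIter a x hr.1)).norm (Eventually.of_forall fun m => hlip m s r)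
  refine ⟨hcont, fun s hs => ?_⟩
  refine tendsto_nhds_unique ((tendsto_add_atTop_iff_nat 1).2 (hF.tendsto_picardIter a x hs.1)) ?_
  refine tendsto_const_nhds.add ?_
  refine intervalIntegral.tendsto_integral_filter_of_dominated_convergence (fun _ => C)
    (Eventually.of_forall fun m => ?_) (Eventually.of_forall fun m => ae_of_all _ fun r _ =>
      hF.bdd _ _) intervalIntegrable_const (ae_of_all _ fun r hr => ?_)
  · exact (hF.meas.comp (measurable_id.prodMk
      (hF.continuous_picardIter a x m).measurable)).aestronglyMeasurable
  · rw [uIoc_of_le hs.1] at hr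
    exact ((hF.lip r).continuous.tendsto _).comp (hF.tendsto_picardIter a x hr.1.le)

lemma measurable_intervalIntegral_param {Θ : Type*} [MeasurableSpace Θ] {G : Θ → ℝ → E}
    (hG : Measurable (Function.uncurry G)) (a s : ℝ) : Measurable fun θ => ∫ r in a..s, G θ r := by
  unfold intervalIntegral
  exact ((hG.stronglyMeasurable.integral_prod_right (ν := volume.restrict (Ioc a s))).sub
    (hG.stronglyMeasurable.integral_prod_right (ν := volume.restrict (Ioc s a)))).measurable

/-- The solution depends measurably on parameters. -/
lemma measurable_caraFlow {Θ : Type*} [MeasurableSpace Θ] {F : Θ → ℝ → E → E}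
    (hF : ∀ θ, IsCaraField (F θ) C K)
    (hm : Measurable fun q : Θ × ℝ × E => F q.1 q.2.1 q.2.2) (a : ℝ) {y : Θ → E}
    (hy : Measurable y) {s : ℝ} (hs : a ≤ s) : Measurable fun θ => caraFlow (F θ) a (y θ) s := by
  have hp : ∀ m s, Measurable fun θ => picardIter (F θ) a (y θ) m s := by
    intro m
    induction m with
    | zero => exact fun _ => hy
    | succ m ih =>
      intro s
      have hj : Measurable (Function.uncurry fun r θ => picardIter (F θ) a (y θ) m r) :=
        measurable_uncurry_of_continuous_of_measurable
          (fun θ => (hF θ).continuous_picardIter a (y θ) m) ih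
      have hj' : Measurable fun q : Θ × ℝ => picardIter (F q.1) a (y q.1) m q.2 :=
        hj.comp measurable_swap
      refine hy.add (measurable_intervalIntegral_param
        (G := fun θ r => F θ r (picardIter (F θ) a (y θ) m r)) ?_ a s)
      exact hm.comp (measurable_fst.prodMk (measurable_snd.prodMk hj'))
  exact measurable_of_tendsto_metrizable (fun m => hp m s)
    (tendsto_pi_nhds.2 fun θ => (hF θ).tendsto_picardIter a (y θ) hs)

end Caratheodory

/-! ### Controlled dynamics on one interval -/

section OneStep

set_option linter.unusedSectionVars false

variable {d : ℕ} {U V : Type} [MetricSpace U] [CompactSpace U] [MetricSpace V] [CompactSpace V]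
  [MeasurableSpace U] [BorelSpace U] [MeasurableSpace V] [BorelSpace V]

/-- Dynamics that are jointly continuous, bounded, and Lipschitz continuous in space. -/
structure IsDynamics (f : ℝ → EuclideanSpace ℝ (Fin d) → U → V → EuclideanSpace ℝ (Fin d))
    (C : ℝ) (K : ℝ≥0) : Prop where
  cont : Continuous fun q : ℝ × EuclideanSpace ℝ (Fin d) × U × V => f q.1 q.2.1 q.2.2.1 q.2.2.2
  bdd : ∀ t x u v, ‖f t x u v‖ ≤ C
  lip : ∀ t u v, LipschitzWith K fun x => f t x u v

/-- The state at time `b` of the trajectory started in `x` at time `a`. -/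
def stepFlow (f : ℝ → EuclideanSpace ℝ (Fin d) → U → V → EuclideanSpace ℝ (Fin d)) (a b : ℝ)
    (x : EuclideanSpace ℝ (Fin d)) (u : ℝ → U) (v : ℝ → V) : EuclideanSpace ℝ (Fin d) :=
  caraFlow (fun r y => f r y (u r) (v r)) a x b

variable {f : ℝ → EuclideanSpace ℝ (Fin d) → U → V → EuclideanSpace ℝ (Fin d)} {C : ℝ} {K : ℝ≥0}

lemma IsDynamics.isCaraField (hf : IsDynamics f C K) {u : ℝ → U} {v : ℝ → V} (hu : Measurable u)
    (hv : Measurable v) : IsCaraField (fun r y => f r y (u r) (v r)) C K where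
  meas := hf.cont.measurable.comp (measurable_fst.prodMk (measurable_snd.prodMk
    ((hu.comp measurable_fst).prodMk (hv.comp measurable_fst))))
  bdd _ _ := hf.bdd _ _ _ _
  lip _ := hf.lip _ _ _

lemma IsDynamics.isCaraSol (hf : IsDynamics f C K) {u : ℝ → U} {v : ℝ → V} (hu : Measurable u)
    (hv : Measurable v) (a b : ℝ) (x : EuclideanSpace ℝ (Fin d)) :
    IsCaraSol (fun r y => f r y (u r) (v r)) a b x fun s => stepFlow f a s x u v :=
  (hf.isCaraField hu hv).isCaraSol_caraFlow a b x

lemma IsDynamics.stepFlow_self (hf : IsDynamics f C K) {u : ℝ → U} {v : ℝ → V} (hu : Measurable u)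
    (hv : Measurable v) (a : ℝ) (x : EuclideanSpace ℝ (Fin d)) : stepFlow f a a x u v = x := by
  simpa using (hf.isCaraSol hu hv a a x).2 a ⟨le_rfl, le_rfl⟩

lemma IsDynamics.sol_eq (hf : IsDynamics f C K) {u : ℝ → U} {v : ℝ → V} (hu : Measurable u)
    (hv : Measurable v) {T t s : ℝ} (hs : s ∈ Icc t T) (x : EuclideanSpace ℝ (Fin d)) :
    sol f T t x u v s = stepFlow f t s x u v := by
  have h1 : IsSol f T t x u v (sol f T t x u v) :=
    Classical.epsilon_spec (p := IsSol f T t x u v) ⟨_, hf.isCaraSol hu hv t T x⟩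
  exact IsCaraSol.eqOn (hf.isCaraField hu hv) h1 (hf.isCaraSol hu hv t T x) hs

lemma IsDynamics.stepFlow_trans (hf : IsDynamics f C K) {u : ℝ → U} {v : ℝ → V} (hu : Measurable u)
    (hv : Measurable v) {a b c : ℝ} (hab : a ≤ b) (hbc : b ≤ c) (x : EuclideanSpace ℝ (Fin d)) :
    stepFlow f b c (stepFlow f a b x u v) u v = stepFlow f a c x u v :=
  (hf.isCaraSol hu hv b c _).eqOn (hf.isCaraField hu hv)
    ((hf.isCaraSol hu hv a c x).restart (hf.isCaraField hu hv) ⟨hab, hbc⟩) ⟨hbc, le_rfl⟩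

lemma IsDynamics.stepFlow_congr (hf : IsDynamics f C K) {u u' : ℝ → U} {v v' : ℝ → V}
    (hu : Measurable u) (hv : Measurable v) (hu' : Measurable u') (hv' : Measurable v') {a b : ℝ}
    (hab : a ≤ b) (hue : ∀ᵐ r, r ∈ Ioo a b → u r = u' r) (hve : ∀ᵐ r, r ∈ Ioo a b → v r = v' r)
    (x : EuclideanSpace ℝ (Fin d)) : stepFlow f a b x u v = stepFlow f a b x u' v' := by
  refine IsCaraSol.eqOn (hf.isCaraField hu' hv') (a := a) (b := b) ?_ (hf.isCaraSol hu' hv' a b x)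
    ⟨hab, le_rfl⟩
  obtain ⟨h1, h2⟩ := hf.isCaraSol hu hv a b x
  refine ⟨h1, fun s hs => (h2 s hs).trans ?_⟩
  congr 1
  refine intervalIntegral.integral_congr_ae ?_
  have hb : ∀ᵐ r : ℝ, r ≠ b := by simp [ae_iff]
  filter_upwards [hue, hve, hb] with r hr1 hr2 hrb hr
  rw [uIoc_of_le hs.1] at hr
  have hr' : r ∈ Ioo a b := ⟨hr.1, lt_of_le_of_ne (hr.2.trans hs.2) hrb⟩
  rw [hr1 hr', hr2 hr']
  rfl

lemma IsDynamics.norm_stepFlow_sub_le (hf : IsDynamics f C K) {u : ℝ → U} {v : ℝ → V}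
    (hu : Measurable u) (hv : Measurable v) {a b : ℝ} (hab : a ≤ b)
    (x y : EuclideanSpace ℝ (Fin d)) :
    ‖stepFlow f a b x u v - stepFlow f a b y u v‖ ≤ ‖x - y‖ * Real.exp (K * (b - a)) :=
  (hf.isCaraSol hu hv a b x).norm_sub_le (hf.isCaraField hu hv) (hf.isCaraSol hu hv a b y)
    ⟨hab, le_rfl⟩

lemma IsDynamics.norm_stepFlow_sub_init_le (hf : IsDynamics f C K) {u : ℝ → U} {v : ℝ → V}
    (hu : Measurable u) (hv : Measurable v) {a b : ℝ} (hab : a ≤ b)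
    (x : EuclideanSpace ℝ (Fin d)) : ‖stepFlow f a b x u v - x‖ ≤ C * (b - a) :=
  (hf.isCaraSol hu hv a b x).norm_sub_init_le (hf.isCaraField hu hv) ⟨hab, le_rfl⟩

lemma IsDynamics.measurable_stepFlow (hf : IsDynamics f C K) {Θ : Type*} [MeasurableSpace Θ]
    {u : ℝ → Θ → U} {v : ℝ → Θ → V} (hu : Measurable (Function.uncurry u))
    (hv : Measurable (Function.uncurry v)) {a b : ℝ} (hab : a ≤ b)
    {y : Θ → EuclideanSpace ℝ (Fin d)} (hy : Measurable y) :
    Measurable fun θ => stepFlow f a b (y θ) (fun r => u r θ) (fun r => v r θ) := by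
  refine measurable_caraFlow (F := fun θ r z => f r z (u r θ) (v r θ)) (C := C) (K := K)
    (fun θ => hf.isCaraField (hu.comp measurable_prodMk_right) (hv.comp measurable_prodMk_right))
    ?_ a hy hab
  have hm : Measurable fun q : Θ × ℝ × EuclideanSpace ℝ (Fin d) => (q.2.1, q.1) := by fun_prop
  exact hf.cont.measurable.comp ((measurable_fst.comp measurable_snd).prodMk
    ((measurable_snd.comp measurable_snd).prodMk ((hu.comp hm).prodMk (hv.comp hm))))

/-! ### The one-step game -/

/-- Randomised open-loop controls: measurable functions of time and of a uniform random seed. -/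
abbrev RandCtrl (A : Type) [MeasurableSpace A] : Type :=
  {u : ℝ → I → A // Measurable (Function.uncurry u)}

instance {A : Type} [MeasurableSpace A] [Nonempty A] : Nonempty (RandCtrl A) :=
  ⟨⟨fun _ _ => Classical.arbitrary A, measurable_const⟩⟩

/-- The expected pay-off on `[a,b]` for two randomised controls using independent seeds. -/
def stepPay (f : ℝ → EuclideanSpace ℝ (Fin d) → U → V → EuclideanSpace ℝ (Fin d)) (a b : ℝ)
    (φ : EuclideanSpace ℝ (Fin d) → ℝ) (x : EuclideanSpace ℝ (Fin d)) (u : RandCtrl U)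
    (v : RandCtrl V) : ℝ :=
  ∫ ζ : I × I, φ (stepFlow f a b x (fun r => u.1 r ζ.1) (fun r => v.1 r ζ.2))

/-- The upper value on `[a,b]` for two randomised controls. -/
def stepVal (f : ℝ → EuclideanSpace ℝ (Fin d) → U → V → EuclideanSpace ℝ (Fin d)) (a b : ℝ)
    (φ : EuclideanSpace ℝ (Fin d) → ℝ) (x : EuclideanSpace ℝ (Fin d)) : ℝ :=
  ⨅ v : RandCtrl V, ⨆ u : RandCtrl U, stepPay f a b φ x u v

lemma IsDynamics.measurable_stepFlow_seed (hf : IsDynamics f C K) (u : RandCtrl U)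
    (v : RandCtrl V) {a b : ℝ} (hab : a ≤ b) (x : EuclideanSpace ℝ (Fin d)) :
    Measurable fun ζ : I × I => stepFlow f a b x (fun r => u.1 r ζ.1) (fun r => v.1 r ζ.2) := by
  have h1 : Measurable fun q : ℝ × I × I => (q.1, q.2.1) := by fun_prop
  have h2 : Measurable fun q : ℝ × I × I => (q.1, q.2.2) := by fun_prop
  exact hf.measurable_stepFlow (u := fun r (ζ : I × I) => u.1 r ζ.1) (v := fun r ζ => v.1 r ζ.2)
    (u.2.comp h1) (v.2.comp h2) hab measurable_const

lemma RandCtrl.measurable_path {A : Type} [MeasurableSpace A] (u : RandCtrl A) (h : I) :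
    Measurable fun r => u.1 r h := u.2.comp measurable_prodMk_right

/-- A bounded Lipschitz function. -/
structure IsBddLip (φ : EuclideanSpace ℝ (Fin d) → ℝ) (M : ℝ) (L : ℝ≥0) : Prop where
  bdd : ∀ x, |φ x| ≤ M
  lip : LipschitzWith L φ

variable {φ : EuclideanSpace ℝ (Fin d) → ℝ} {M : ℝ} {L : ℝ≥0} {a b : ℝ}

lemma IsBddLip.abs_sub_le (hφ : IsBddLip φ M L) (x y : EuclideanSpace ℝ (Fin d)) :
    |φ x - φ y| ≤ L * ‖x - y‖ := by
  rw [← dist_eq_norm, ← Real.dist_eq]; exact hφ.lip.dist_le_mul x y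

lemma IsBddLip.integrable_comp (hφ : IsBddLip φ M L) {Ω : Type*} [MeasurableSpace Ω]
    {μ : Measure Ω} [IsFiniteMeasure μ] {X : Ω → EuclideanSpace ℝ (Fin d)} (hX : Measurable X) :
    Integrable (fun ω => φ (X ω)) μ :=
  Integrable.of_bound (hφ.lip.continuous.measurable.comp hX).aestronglyMeasurable M
    (ae_of_all _ fun ω => by simpa using hφ.bdd (X ω))

lemma IsDynamics.integrable_pay (hf : IsDynamics f C K) (hφ : IsBddLip φ M L) (u : RandCtrl U)
    (v : RandCtrl V) (hab : a ≤ b) (x : EuclideanSpace ℝ (Fin d)) :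
    Integrable fun ζ : I × I => φ (stepFlow f a b x (fun r => u.1 r ζ.1) (fun r => v.1 r ζ.2)) :=
  hφ.integrable_comp (hf.measurable_stepFlow_seed u v hab x)

lemma abs_stepPay_le (hφ : ∀ x, |φ x| ≤ M) (u : RandCtrl U) (v : RandCtrl V)
    (x : EuclideanSpace ℝ (Fin d)) : |stepPay f a b φ x u v| ≤ M := by
  have := norm_integral_le_of_norm_le_const (μ := (volume : Measure (I × I))) (C := M)
    (f := fun ζ : I × I => φ (stepFlow f a b x (fun r => u.1 r ζ.1) (fun r => v.1 r ζ.2)))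
    (ae_of_all _ fun ζ => by simpa using hφ _)
  simpa [stepPay] using this

lemma bddAbove_stepPay (hφ : ∀ x, |φ x| ≤ M) (v : RandCtrl V) (x : EuclideanSpace ℝ (Fin d)) :
    BddAbove (range fun u : RandCtrl U => stepPay f a b φ x u v) :=
  ⟨M, by rintro _ ⟨u, rfl⟩; exact (abs_le.1 (abs_stepPay_le hφ u v x)).2⟩

lemma bddBelow_iSup_stepPay [Nonempty U] (hφ : ∀ x, |φ x| ≤ M) (x : EuclideanSpace ℝ (Fin d)) :
    BddBelow (range fun v : RandCtrl V => ⨆ u : RandCtrl U, stepPay f a b φ x u v) :=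
  ⟨-M, by
    rintro _ ⟨v, rfl⟩
    exact (abs_le.1 (abs_stepPay_le hφ (Classical.arbitrary _) v x)).1.trans
      (le_ciSup (bddAbove_stepPay hφ v x) _)⟩

variable [Nonempty U] [Nonempty V]

lemma stepVal_le (hφ : ∀ x, |φ x| ≤ M) {x : EuclideanSpace ℝ (Fin d)} {c : ℝ} (v : RandCtrl V)
    (h : ∀ u : RandCtrl U, stepPay f a b φ x u v ≤ c) : stepVal f a b φ x ≤ c :=
  (ciInf_le (bddBelow_iSup_stepPay hφ x) v).trans (ciSup_le h)

lemma le_stepVal (hφ : ∀ x, |φ x| ≤ M) {x : EuclideanSpace ℝ (Fin d)} {c : ℝ}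
    (h : ∀ v : RandCtrl V, ∃ u : RandCtrl U, c ≤ stepPay f a b φ x u v) :
    c ≤ stepVal f a b φ x :=
  le_ciInf fun v => let ⟨u, hu⟩ := h v
    hu.trans (le_ciSup (bddAbove_stepPay hφ v x) u)

lemma exists_forall_stepPay_le (hφ : ∀ x, |φ x| ≤ M) (x : EuclideanSpace ℝ (Fin d)) {ε : ℝ}
    (hε : 0 < ε) : ∃ v : RandCtrl V, ∀ u : RandCtrl U,
      stepPay f a b φ x u v ≤ stepVal f a b φ x + ε := by
  obtain ⟨v, hv⟩ := exists_lt_of_ciInf_lt (lt_add_of_pos_right (stepVal f a b φ x) hε)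
  exact ⟨v, fun u => (le_ciSup (bddAbove_stepPay hφ v x) u).trans hv.le⟩

lemma exists_le_stepPay (hφ : ∀ x, |φ x| ≤ M) (x : EuclideanSpace ℝ (Fin d)) (v : RandCtrl V)
    {ε : ℝ} (hε : 0 < ε) : ∃ u : RandCtrl U, stepVal f a b φ x - ε ≤ stepPay f a b φ x u v := by
  have h : stepVal f a b φ x - ε < ⨆ u : RandCtrl U, stepPay f a b φ x u v :=
    (sub_lt_self _ hε).trans_le (ciInf_le (bddBelow_iSup_stepPay hφ x) v)
  obtain ⟨u, hu⟩ := exists_lt_of_lt_ciSup h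
  exact ⟨u, hu.le⟩

lemma abs_stepVal_le (hφ : ∀ x, |φ x| ≤ M) (x : EuclideanSpace ℝ (Fin d)) :
    |stepVal f a b φ x| ≤ M :=
  abs_le.2 ⟨le_stepVal hφ fun v => ⟨Classical.arbitrary _, (abs_le.1 (abs_stepPay_le hφ _ v x)).1⟩,
    stepVal_le hφ (Classical.arbitrary _) fun u => (abs_le.1 (abs_stepPay_le hφ u _ x)).2⟩

/-- A pay-off inequality which is uniform in the controls passes to the value. -/
lemma stepVal_le_stepVal_add (hφ : ∀ x, |φ x| ≤ M) {x y : EuclideanSpace ℝ (Fin d)} {c : ℝ}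
    (h : ∀ (u : RandCtrl U) (v : RandCtrl V),
      stepPay f a b φ x u v ≤ stepPay f a b φ y u v + c) :
    stepVal f a b φ x ≤ stepVal f a b φ y + c := by
  refine le_of_forall_pos_le_add fun ε hε => ?_
  obtain ⟨v, hv⟩ := exists_forall_stepPay_le (f := f) (a := a) (b := b) hφ y hε
  refine stepVal_le hφ v fun u => (h u v).trans ?_
  linarith [hv u]

lemma IsDynamics.stepPay_le_stepPay_add (hf : IsDynamics f C K) (hφ : IsBddLip φ M L) (hab : a ≤ b)
    (u : RandCtrl U) (v : RandCtrl V) (x y : EuclideanSpace ℝ (Fin d)) :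
    stepPay f a b φ x u v ≤ stepPay f a b φ y u v
      + ↑(L * (Real.exp (K * (b - a))).toNNReal) * dist x y := by
  have h : ∀ ζ : I × I, φ (stepFlow f a b x (fun r => u.1 r ζ.1) (fun r => v.1 r ζ.2))
      ≤ φ (stepFlow f a b y (fun r => u.1 r ζ.1) (fun r => v.1 r ζ.2))
        + ↑(L * (Real.exp (K * (b - a))).toNNReal) * dist x y := by
    intro ζ
    have h1 := (abs_le.1 (hφ.abs_sub_le (stepFlow f a b x (fun r => u.1 r ζ.1) (fun r => v.1 r ζ.2))
      (stepFlow f a b y (fun r => u.1 r ζ.1) (fun r => v.1 r ζ.2)))).2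
    have h2 := mul_le_mul_of_nonneg_left (hf.norm_stepFlow_sub_le (u.measurable_path ζ.1)
      (v.measurable_path ζ.2) hab x y) L.coe_nonneg
    rw [NNReal.coe_mul, Real.coe_toNNReal _ (Real.exp_pos _).le, dist_eq_norm]
    linarith
  refine (integral_mono (hf.integrable_pay hφ u v hab x)
    ((hf.integrable_pay hφ u v hab y).add (integrable_const _)) h).trans_eq ?_
  rw [integral_add' (hf.integrable_pay hφ u v hab y) (integrable_const _)]
  simp [stepPay]

lemma IsDynamics.isBddLip_stepVal (hf : IsDynamics f C K) (hφ : IsBddLip φ M L) (hab : a ≤ b) :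
    IsBddLip (stepVal f a b φ) M (L * (Real.exp (K * (b - a))).toNNReal) :=
  ⟨abs_stepVal_le hφ.bdd, LipschitzWith.of_le_add_mul _ fun x y =>
    stepVal_le_stepVal_add hφ.bdd fun u v => hf.stepPay_le_stepPay_add hφ hab u v x y⟩

/-- A countable measurable cover by small cells, with the indices of the cells. -/
lemma exists_cell (d : ℕ) {ρ : ℝ} (hρ : 0 < ρ) :
    ∃ (cell : EuclideanSpace ℝ (Fin d) → ℕ) (y : ℕ → EuclideanSpace ℝ (Fin d)),
      Measurable cell ∧ ∀ x, dist x (y (cell x)) < ρ := by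
  classical
  have hex : ∀ x : EuclideanSpace ℝ (Fin d),
      ∃ n, dist x (TopologicalSpace.denseSeq _ n) < ρ := fun x => by
    obtain ⟨n, hn⟩ :=
      (TopologicalSpace.denseRange_denseSeq (EuclideanSpace ℝ (Fin d))).exists_dist_lt x hρ
    exact ⟨n, hn⟩
  exact ⟨fun x => Nat.find (hex x), TopologicalSpace.denseSeq _, measurable_find hex fun n =>
    measurableSet_lt (measurable_id.dist measurable_const) measurable_const,
    fun x => Nat.find_spec (hex x)⟩

lemma IsDynamics.exists_cell_stepPay (hf : IsDynamics f C K) (hφ : IsBddLip φ M L) (hab : a ≤ b)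
    {ε : ℝ} (hε : 0 < ε) :
    ∃ (cell : EuclideanSpace ℝ (Fin d) → ℕ) (y : ℕ → EuclideanSpace ℝ (Fin d)), Measurable cell ∧
      ∀ x, (∀ u v, |stepPay f a b φ x u v - stepPay f a b φ (y (cell x)) u v| ≤ ε) ∧
        |stepVal f a b φ x - stepVal f a b φ (y (cell x))| ≤ ε := by
  set L' := L * (Real.exp (K * (b - a))).toNNReal
  obtain ⟨cell, y, hc, hy⟩ := exists_cell d (ρ := ε / (L' + 1)) (by positivity)
  have hd : ∀ x, L' * dist x (y (cell x)) ≤ ε := fun x =>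
    (mul_le_mul (le_add_of_nonneg_right zero_le_one) (hy x).le dist_nonneg
      (by positivity)).trans_eq (mul_div_cancel₀ _ (by positivity))
  refine ⟨cell, y, hc, fun x => ⟨fun u v => abs_sub_le_iff.2 ⟨?_, ?_⟩, ?_⟩⟩
  · linarith [hd x, hf.stepPay_le_stepPay_add hφ hab u v x (y (cell x))]
  · have h1 := hf.stepPay_le_stepPay_add hφ hab u v (y (cell x)) x
    rw [dist_comm] at h1
    linarith [hd x]
  · exact ((hf.isBddLip_stepVal hφ hab).lip.dist_le_mul x (y (cell x))).trans (hd x)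

/-- A measurable selection of nearly optimal controls of the minimising player. -/
lemma IsDynamics.exists_selection_le (hf : IsDynamics f C K) (hφ : IsBddLip φ M L) (hab : a ≤ b)
    {ε : ℝ} (hε : 0 < ε) :
    ∃ (cell : EuclideanSpace ℝ (Fin d) → ℕ) (v : ℕ → RandCtrl V), Measurable cell ∧
      ∀ x (u : RandCtrl U), stepPay f a b φ x u (v (cell x)) ≤ stepVal f a b φ x + ε := by
  obtain ⟨cell, y, hc, h⟩ := hf.exists_cell_stepPay hφ hab (show 0 < ε / 3 by linarith)
  choose v hv using fun k => exists_forall_stepPay_le (f := f) (a := a) (b := b) hφ.bdd (y k)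
    (show 0 < ε / 3 by linarith)
  refine ⟨cell, v, hc, fun x u => ?_⟩
  linarith [(abs_le.1 ((h x).1 u (v (cell x)))).2, (abs_le.1 (h x).2).1, hv (cell x) u]

/-- A measurable selection of nearly optimal responses of the maximising player. -/
lemma IsDynamics.exists_selection_ge (hf : IsDynamics f C K) (hφ : IsBddLip φ M L) (hab : a ≤ b)
    {ε : ℝ} (hε : 0 < ε) (v : ℕ → RandCtrl V) :
    ∃ (cell : EuclideanSpace ℝ (Fin d) → ℕ) (u : ℕ → ℕ → RandCtrl U), Measurable cell ∧
      ∀ x k, stepVal f a b φ x - ε ≤ stepPay f a b φ x (u k (cell x)) (v k) := by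
  obtain ⟨cell, y, hc, h⟩ := hf.exists_cell_stepPay hφ hab (show 0 < ε / 3 by linarith)
  choose u hu using fun k l => exists_le_stepPay (f := f) (a := a) (b := b) hφ.bdd (y l) (v k)
    (show 0 < ε / 3 by linarith)
  refine ⟨cell, u, hc, fun x k => ?_⟩
  linarith [(abs_le.1 ((h x).1 (u k (cell x)) (v k))).1, (abs_le.1 (h x).2).2, hu k (cell x)]

lemma IsDynamics.abs_stepVal_sub_le (hf : IsDynamics f C K) (hφ : IsBddLip φ M L) (hab : a ≤ b)
    (x : EuclideanSpace ℝ (Fin d)) : |stepVal f a b φ x - φ x| ≤ L * (C * (b - a)) := by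
  have h : ∀ (u : RandCtrl U) (v : RandCtrl V),
      |stepPay f a b φ x u v - φ x| ≤ L * (C * (b - a)) := by
    intro u v
    have e : stepPay f a b φ x u v - φ x = ∫ ζ : I × I,
        (φ (stepFlow f a b x (fun r => u.1 r ζ.1) (fun r => v.1 r ζ.2)) - φ x) := by
      rw [integral_sub (hf.integrable_pay hφ u v hab x) (integrable_const _)]
      simp [stepPay]
    rw [e]
    have hb := norm_integral_le_of_norm_le_const (μ := (volume : Measure (I × I)))
      (C := L * (C * (b - a))) (f := fun ζ : I × I =>
        φ (stepFlow f a b x (fun r => u.1 r ζ.1) (fun r => v.1 r ζ.2)) - φ x)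
      (ae_of_all _ fun ζ => ?_)
    · simpa using hb
    exact (hφ.abs_sub_le _ _).trans (mul_le_mul_of_nonneg_left (hf.norm_stepFlow_sub_init_le
      (u.measurable_path _) (v.measurable_path _) hab x) L.coe_nonneg)
  rw [abs_sub_le_iff, sub_le_iff_le_add', sub_le_comm (a := φ x)]
  exact ⟨stepVal_le hφ.bdd (Classical.arbitrary _) fun u => by
      linarith [(abs_le.1 (h u (Classical.arbitrary _))).2],
    le_stepVal hφ.bdd fun v => ⟨Classical.arbitrary _, by
      linarith [(abs_le.1 (h (Classical.arbitrary _) v)).1]⟩⟩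

/-! ### Backward recursion along a partition -/

/-- The backward recursion with `m` remaining intervals. -/
def backwardVal (f : ℝ → EuclideanSpace ℝ (Fin d) → U → V → EuclideanSpace ℝ (Fin d))
    (g : EuclideanSpace ℝ (Fin d) → ℝ) {T : ℝ} (π : Partition T) :
    ℕ → EuclideanSpace ℝ (Fin d) → ℝ
  | 0 => g
  | m + 1 => stepVal f (π.t (π.n - (m + 1))) (π.t (π.n - m)) (backwardVal f g π m)

/-- The value at the grid point `t_j` defined by backward recursion from the terminal pay-off. -/
def gridVal (f : ℝ → EuclideanSpace ℝ (Fin d) → U → V → EuclideanSpace ℝ (Fin d))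
    (g : EuclideanSpace ℝ (Fin d) → ℝ) {T : ℝ} (π : Partition T) (j : ℕ) :
    EuclideanSpace ℝ (Fin d) → ℝ := backwardVal f g π (π.n - j)

variable {g : EuclideanSpace ℝ (Fin d) → ℝ} {T : ℝ} {π : Partition T}

lemma gridVal_last : gridVal f g π π.n = g := by simp [gridVal, backwardVal]

lemma gridVal_of_lt {j : ℕ} (hj : j < π.n) :
    gridVal f g π j = stepVal f (π.t j) (π.t (j + 1)) (gridVal f g π (j + 1)) := by
  unfold gridVal
  obtain ⟨m, hm⟩ : ∃ m, π.n - j = m + 1 := ⟨π.n - j - 1, by omega⟩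
  have h1 : π.n - (m + 1) = j := by omega
  have h2 : π.n - m = j + 1 := by omega
  have h3 : π.n - (j + 1) = m := by omega
  rw [hm, backwardVal, h1, h2, h3]

lemma IsDynamics.exists_isBddLip_gridVal (hf : IsDynamics f C K) (hg : IsBddLip g M L) {j : ℕ}
    (hj : j ≤ π.n) : ∃ L', IsBddLip (gridVal f g π j) M L' := by
  induction hj using Nat.decreasingInduction with
  | self => exact ⟨L, by rwa [gridVal_last]⟩
  | of_succ j hj ih =>
    obtain ⟨L', hL'⟩ := ih
    rw [gridVal_of_lt hj]
    exact ⟨_, hf.isBddLip_stepVal hL' (π.mono j hj).le⟩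

end OneStep

/-! ### The sample space -/

section SampleSpace

/-- Replace all coordinates with index at least `j` by a fixed value. -/
def trunc (j : ℕ) (ω : Omega) : Omega := fun i => if i < j then ω i else (0, 0)

lemma trunc_apply_of_lt {i j : ℕ} (h : i < j) (ω : Omega) : trunc j ω i = ω i := if_pos h

lemma trunc_update (j : ℕ) (ω : Omega) (ζ : I × I) :
    trunc j (Function.update ω j ζ) = trunc j ω := by
  funext i
  by_cases h : i < j
  · simp [trunc, h, h.ne]
  · simp [trunc, h]

lemma trunc_trunc {j k : ℕ} (h : j ≤ k) (ω : Omega) : trunc j (trunc k ω) = trunc j ω := by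
  funext i
  by_cases hi : i < j
  · simp [trunc, hi, hi.trans_le h]
  · simp [trunc, hi]

lemma Fsig_le (j : ℕ) : Fsig j ≤ (inferInstance : MeasurableSpace Omega) :=
  Measurable.comap_le (by fun_prop)

lemma measurable_trunc (j : ℕ) : Measurable[Fsig j] (trunc j) := by
  let e : (Fin j → I × I) → Omega := fun r i => if h : i < j then r ⟨i, h⟩ else (0, 0)
  have he : Measurable e := by
    refine measurable_pi_lambda _ fun i => ?_
    by_cases h : i < j
    · simpa [e, h] using measurable_pi_apply _
    · simp [e, h]
  have h : trunc j = e ∘ fun ω (i : Fin j) => ω (i : ℕ) := by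
    funext ω i
    by_cases h : i < j <;> simp [trunc, e, h]
  rw [h]
  exact he.comp (comap_measurable _)

lemma measurable_Fsig_iff {α : Type*} [MeasurableSpace α] [MeasurableSingletonClass α] {j : ℕ}
    {h : Omega → α} : Measurable[Fsig j] h ↔ Measurable h ∧ ∀ ω, h (trunc j ω) = h ω := by
  refine ⟨fun hh => ⟨hh.mono (Fsig_le j) le_rfl, fun ω => ?_⟩, fun hh => ?_⟩
  · obtain ⟨B, -, hB⟩ := hh (measurableSet_singleton (h ω))
    have h1 : ω ∈ h ⁻¹' {h ω} := rfl
    have h2 : trunc j ω ∈ h ⁻¹' {h ω} := by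
      rw [← hB, mem_preimage] at h1 ⊢
      convert h1 using 1
      funext i
      exact trunc_apply_of_lt i.2 ω
    exact h2
  · have : h = h ∘ trunc j := funext fun ω => (hh.2 ω).symm
    rw [this]
    exact hh.1.comp (measurable_trunc j)

lemma Fsig_mono {j k : ℕ} (h : j ≤ k) : Fsig j ≤ Fsig k := by
  intro A hA
  obtain ⟨B, hB, rfl⟩ := hA
  have hm : Measurable[Fsig k] (fun ω (i : Fin j) => ω (i : ℕ) : Omega → Fin j → I × I) :=
    measurable_Fsig_iff.2
      ⟨by fun_prop, fun ω => funext fun i => trunc_apply_of_lt (i.2.trans_le h) ω⟩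
  exact hm hB

lemma measurable_of_Fsig {α : Type*} [MeasurableSpace α] {j : ℕ} {h : Omega → α}
    (hh : Measurable[Fsig j] h) : Measurable h := hh.mono (Fsig_le j) le_rfl

lemma apply_update_of_Fsig {α : Type*} [MeasurableSpace α] [MeasurableSingletonClass α] {j : ℕ}
    {h : Omega → α} (hh : Measurable[Fsig j] h) (ω : Omega) (ζ : I × I) :
    h (Function.update ω j ζ) = h ω := by
  have h1 := (measurable_Fsig_iff.1 hh).2
  rw [← h1 (Function.update ω j ζ), trunc_update, h1]

lemma measurable_update_coord (j : ℕ) :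
    Measurable fun p : Omega × (I × I) => Function.update p.1 j p.2 := by
  refine measurable_pi_lambda _ fun i => ?_
  by_cases h : i = j
  · subst h; simpa using measurable_snd
  · simp only [Function.update_of_ne h]
    exact (measurable_pi_apply i).comp measurable_fst

/-- Integrating out the `j`-th coordinate, which is independent of `𝓕_j`. -/
lemma setIntegral_eq_setIntegral_update {P : Measure Omega} [IsProbabilityMeasure P]
    (hP : IsProductMeasure P) {j : ℕ} {Φ : Omega → ℝ} (hΦ : Measurable Φ) {M : ℝ}
    (hb : ∀ ω, |Φ ω| ≤ M) (htr : ∀ ω, Φ (trunc (j + 1) ω) = Φ ω) {A : Set Omega}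
    (hA : MeasurableSet[Fsig j] A) :
    ∫ ω in A, Φ ω ∂P = ∫ ω in A, (∫ ζ : I × I, Φ (Function.update ω j ζ)) ∂P := by
  let ρ : Omega → Fin j → I × I := fun ω i => ω i
  let e : (I × I) × (Fin j → I × I) → Omega := fun q i =>
    if h : i < j then q.2 ⟨i, h⟩ else if i = j then q.1 else (0, 0)
  have he : Measurable e := by
    refine measurable_pi_lambda _ fun i => ?_
    by_cases h : i < j
    · simp only [e, h, dif_pos]
      exact (measurable_pi_apply _).comp measurable_snd
    · by_cases h' : i = j
      · simpa [e, h'] using measurable_fst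
      · simp [e, h, h']
  have he1 : ∀ ω ζ, e (ζ, ρ ω) = trunc (j + 1) (Function.update ω j ζ) := by
    intro ω ζ
    funext i
    rcases lt_trichotomy i j with h | h | h
    · simp [e, ρ, trunc, h, h.trans (Nat.lt_succ_self j), h.ne]
    · subst h; simp [e, trunc]
    · simp [e, trunc, h.not_gt, h.ne', show ¬ i < j + 1 by omega]
  have hρ : MeasurePreserving ρ P (Measure.pi fun _ => volume) := ⟨by fun_prop, hP j⟩
  have hρ1 : MeasurePreserving (fun ω => (ω j, ρ ω)) P
      ((volume : Measure (I × I)).prod (Measure.pi fun _ : Fin j => volume)) := by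
    have h1 : MeasurePreserving (fun ω (i : Fin (j + 1)) => ω (i : ℕ)) P
      (Measure.pi fun _ => (volume : Measure (I × I))) := ⟨by fun_prop, hP (j + 1)⟩
    have h2 := (measurePreserving_piFinSuccAbove
      (fun _ : Fin (j + 1) => (volume : Measure (I × I))) (Fin.last j)).comp h1
    convert h2 using 1
    funext ω
    simp only [Function.comp, MeasurableEquiv.piFinSuccAbove_apply]
    refine Prod.ext (by simp [Fin.insertNthEquiv]) ?_
    funext i
    simp [Fin.insertNthEquiv, ρ, Fin.init]
  obtain ⟨B, hB, rfl⟩ := hA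
  have hF : Measurable fun q : (I × I) × (Fin j → I × I) => Φ (e q) := hΦ.comp he
  have hint : Integrable (fun q => Φ (e q))
      ((volume : Measure (I × I)).prod ((Measure.pi fun _ : Fin j => volume).restrict B)) :=
    Integrable.of_bound hF.aestronglyMeasurable M (ae_of_all _ fun q => by simpa using hb _)
  calc ∫ ω in ρ ⁻¹' B, Φ ω ∂P
      = ∫ ω in (fun ω => (ω j, ρ ω)) ⁻¹' (univ ×ˢ B), Φ (e (ω j, ρ ω)) ∂P := by
        have hs : (fun ω => (ω j, ρ ω)) ⁻¹' (univ ×ˢ B) = ρ ⁻¹' B := by ext; simp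
        rw [hs]
        refine integral_congr_ae (ae_of_all _ fun ω => ?_)
        simp only
        rw [he1, htr, Function.update_eq_self]
    _ = ∫ q in univ ×ˢ B, Φ (e q) ∂((volume : Measure (I × I)).prod
          (Measure.pi fun _ : Fin j => volume)) := by
        rw [← hρ1.map_eq, setIntegral_map (MeasurableSet.univ.prod hB)
          hF.aestronglyMeasurable hρ1.measurable.aemeasurable]
    _ = ∫ r in B, (∫ ζ : I × I, Φ (e (ζ, r))) ∂(Measure.pi fun _ : Fin j => volume) := by
        rw [← Measure.prod_restrict, Measure.restrict_univ, integral_prod_symm _ hint]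
    _ = ∫ ω in ρ ⁻¹' B, (∫ ζ : I × I, Φ (e (ζ, ρ ω))) ∂P := by
        rw [← hρ.map_eq, setIntegral_map hB _ hρ.measurable.aemeasurable]
        exact hF.stronglyMeasurable.integral_prod_left'.aestronglyMeasurable
    _ = _ := by
        refine integral_congr_ae (ae_of_all _ fun ω => ?_)
        refine integral_congr_ae (ae_of_all _ fun ζ => ?_)
        simp only
        rw [he1, htr]

end SampleSpace

/-! ### Partitions -/

section PartitionFacts

variable {T : ℝ} (π : Partition T)

lemma Partition.t_lt {i j : ℕ} (hij : i < j) (hj : j ≤ π.n) : π.t i < π.t j := by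
  induction j, hij using Nat.le_induction with
  | base => exact π.mono i (by omega)
  | succ k hk ih => exact (ih (by omega)).trans (π.mono k (by omega))

lemma Partition.t_le {i j : ℕ} (hij : i ≤ j) (hj : j ≤ π.n) : π.t i ≤ π.t j := by
  rcases hij.eq_or_lt with rfl | h
  · exact le_rfl
  · exact (π.t_lt h hj).le

lemma Partition.t_mem {j : ℕ} (hj : j ≤ π.n) : π.t j ∈ Icc 0 T :=
  ⟨π.map_zero.symm.le.trans (π.t_le (Nat.zero_le j) hj), (π.t_le hj le_rfl).trans π.map_last.le⟩

lemma Partition.t_le_last {j : ℕ} (hj : j ≤ π.n) : π.t j ≤ T := (π.t_mem hj).2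

lemma Partition.sub_le_mesh {j : ℕ} (hj : j < π.n) : π.t (j + 1) - π.t j ≤ π.mesh :=
  Finset.le_sup' (fun i => π.t (i + 1) - π.t i) (Finset.mem_range.2 hj)

lemma Partition.idx_eq {j : ℕ} (hj : j < π.n) {s : ℝ} (hs : s ∈ Ico (π.t j) (π.t (j + 1))) :
    π.idx s = j := by
  refine Nat.findGreatest_eq_iff.2 ⟨by omega, fun _ => hs.1, fun k hk hkn => ?_⟩
  exact not_le.2 (hs.2.trans_le (π.t_le hk (by omega)))

lemma Partition.idx_t {j : ℕ} (hj : j < π.n) : π.idx (π.t j) = j :=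
  π.idx_eq hj ⟨le_rfl, π.mono j hj⟩

lemma Partition.idx_lt (s : ℝ) : π.idx s < π.n :=
  (Nat.findGreatest_le _).trans_lt (Nat.sub_one_lt π.npos.ne')

lemma Partition.mem_Ico_idx {s : ℝ} (hs : s ∈ Ico 0 T) :
    s ∈ Ico (π.t (π.idx s)) (π.t (π.idx s + 1)) := by
  refine ⟨?_, ?_⟩
  · exact Nat.findGreatest_spec (P := fun i => π.t i ≤ s) (Nat.zero_le _)
      (by simpa [π.map_zero] using hs.1)
  · by_contra h
    rw [not_lt] at h
    rcases (Nat.succ_le_of_lt (π.idx_lt s)).eq_or_lt with h1 | h1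
    · rw [show π.idx s + 1 = π.n from h1, π.map_last] at h
      exact h.not_gt hs.2
    · have : π.idx s + 1 ≤ π.idx s :=
        Nat.le_findGreatest (P := fun i => π.t i ≤ s) (by omega) h
      omega

lemma Partition.measurable_idx : Measurable π.idx := by
  classical
  unfold Partition.idx
  exact measurable_findGreatest fun k _ => measurableSet_le measurable_const measurable_id

end PartitionFacts

/-! ### Admissible controls as countable mixtures of randomised controls -/

section Admissible

variable {A : Type} [MeasurableSpace A] {T : ℝ}

/-- Processes which on each interval of the partition are a countable `𝓕_j`-measurable mixture of
randomised controls with seed `pr (ω j)`. -/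
def IsMixture (pr : I × I → I) (π : Partition T) (u : ℝ → Omega → A) : Prop :=
  Measurable (Function.uncurry u) ∧ ∀ j < π.n, ∃ (κ : Omega → ℕ) (uc : ℕ → RandCtrl A),
    Measurable[Fsig j] κ ∧
      ∀ ω, ∀ s ∈ Ico (π.t j) (π.t (j + 1)), u s ω = (uc (κ ω)).1 s (pr (ω j))

/-- The description of admissible controls in terms of the σ-field generated by `pr (ω j)`. -/
def IsSeedAdapted (pr : I × I → I) (π : Partition T) (u : ℝ → Omega → A) : Prop :=
  Measurable (Function.uncurry u) ∧
    ∀ j < π.n, ∃ (Γ : ℕ → Set Omega) (w : ℕ → ℝ → Omega → A),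
      (∀ k, MeasurableSet[Fsig j] (Γ k)) ∧
      Pairwise (Function.onFun Disjoint Γ) ∧
      (⋃ k, Γ k) = univ ∧
      (∀ k s, Measurable[MeasurableSpace.comap (fun ω : Omega => pr (ω j)) inferInstance] (w k s)) ∧
      (∀ k, ∀ ω ∈ Γ k, ∀ s ∈ Ico (π.t j) (π.t (j + 1)), u s ω = w k s ω)

lemma isSeedAdapted_iff_isMixture [MeasurableSingletonClass A] [Nonempty A] {pr : I × I → I}
    (hd : ∀ h, pr (h, h) = h) {π : Partition T} {u : ℝ → Omega → A} :
    IsSeedAdapted pr π u ↔ IsMixture pr π u := by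
  refine and_congr_right fun hu => forall₂_congr fun j _ => ⟨?_, ?_⟩
  · rintro ⟨Γ, w, hΓ, hdis, hun, hw, huw⟩
    have hex : ∀ ω, ∃ k, ω ∈ Γ k := fun ω => mem_iUnion.1 (hun ▸ mem_univ ω)
    choose κ hκ using hex
    have hκ' : ∀ ω k, ω ∈ Γ k → κ ω = k := fun ω k hk => by
      by_contra hne
      exact disjoint_left.1 (hdis hne) (hκ ω) hk
    have hκm : Measurable[Fsig j] κ := by
      refine @measurable_to_countable' _ _ _ _ (Fsig j) _ fun k => ?_
      have : κ ⁻¹' {k} = Γ k := by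
        ext ω
        exact ⟨fun h => h ▸ hκ ω, fun h => hκ' ω k h⟩
      rw [this]
      exact hΓ k
    have hsec : ∀ ω : Omega, Measurable
        (Function.uncurry fun (s : ℝ) (h : I) => u s (Function.update ω j (h, h))) := fun ω => by
      have h1 : Measurable fun q : ℝ × I => Function.update ω j (q.2, q.2) :=
        (measurable_update_coord j).comp (measurable_const.prodMk (by fun_prop))
      exact hu.comp (measurable_fst.prodMk h1)
    have huc : ∀ k, ∃ uc : RandCtrl A, ∀ ω ∈ Γ k, ∀ s ∈ Ico (π.t j) (π.t (j + 1)),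
        u s ω = uc.1 s (pr (ω j)) := fun k => by
      rcases (Γ k).eq_empty_or_nonempty with h0 | ⟨ω₀, hω₀⟩
      · exact ⟨Classical.arbitrary _, by simp [h0]⟩
      · refine ⟨⟨_, hsec ω₀⟩, fun ω hω s hs => ?_⟩
        set ω₁ := Function.update ω₀ j (pr (ω j), pr (ω j)) with hω₁
        have h1 : ω₁ ∈ Γ k := by
          have := apply_update_of_Fsig hκm ω₀ (pr (ω j), pr (ω j))
          rw [← hκ' _ _ hω₀, ← this]
          exact hκ _
        show u s ω = u s ω₁
        rw [huw k ω hω s hs, huw k ω₁ h1 s hs]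
        obtain ⟨B, -, hB⟩ := hw k s (measurableSet_singleton (w k s ω))
        have h2 : ω ∈ w k s ⁻¹' {w k s ω} := rfl
        have h3 : ω₁ ∈ w k s ⁻¹' {w k s ω} := by
          rw [← hB, mem_preimage] at h2 ⊢
          simpa [hω₁, hd] using h2
        exact h3.symm
    choose uc huc using huc
    exact ⟨κ, uc, hκm, fun ω s hs => huc (κ ω) ω (hκ ω) s hs⟩
  · rintro ⟨κ, uc, hκ, h⟩
    refine ⟨fun k => κ ⁻¹' {k}, fun k s ω => (uc k).1 s (pr (ω j)), fun k => hκ trivial,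
      fun k l hkl => disjoint_left.2 fun ω h1 h2 => hkl (h1.symm.trans h2), by ext ω; simp,
      fun k s => ?_, ?_⟩
    · exact ((uc k).2.comp measurable_prodMk_left).comp (comap_measurable _)
    · rintro k ω rfl s hs
      exact h ω s hs

variable {π : Partition T}

lemma mem_admControl1_iff [MeasurableSingletonClass A] [Nonempty A] {u : ℝ → Omega → A} :
    u ∈ AdmControl1 A π ↔ IsMixture Prod.fst π u :=
  isSeedAdapted_iff_isMixture (pr := Prod.fst) fun _ => rfl

lemma mem_admControl2_iff [MeasurableSingletonClass A] [Nonempty A] {v : ℝ → Omega → A} :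
    v ∈ AdmControl2 A π ↔ IsMixture Prod.snd π v :=
  isSeedAdapted_iff_isMixture (pr := Prod.snd) fun _ => rfl

variable {pr : I × I → I} {u : ℝ → Omega → A}

lemma IsMixture.measurable_path (hu : IsMixture pr π u) (ω : Omega) : Measurable fun s => u s ω :=
  hu.1.comp measurable_prodMk_right

lemma isMixture_const [Nonempty A] (a : A) : IsMixture pr π (fun _ _ => a) :=
  ⟨measurable_const, fun _ _ => ⟨fun _ => 0, fun _ => ⟨fun _ _ => a, measurable_const⟩,
    measurable_const, fun _ _ _ => rfl⟩⟩

lemma IsMixture.trunc_eq (hu : IsMixture pr π u) {j k : ℕ} (hj : j < π.n) (hk : j < k) {s : ℝ}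
    (hs : s ∈ Ico (π.t j) (π.t (j + 1))) (ω : Omega) : u s (trunc k ω) = u s ω := by
  obtain ⟨κ, uc, hκ, h⟩ := hu.2 j hj
  have h1 := (measurable_Fsig_iff.1 hκ).2
  rw [h _ s hs, h _ s hs, trunc_apply_of_lt hk, ← h1 (trunc k ω), trunc_trunc hk.le, h1]

/-- Before `t_k`, a mixture depends on the first `k` coordinates only. -/
lemma IsMixture.trunc_eq_of_lt (hu : IsMixture pr π u) {k : ℕ} (hk : k ≤ π.n) {s : ℝ}
    (hs : s ∈ Ico 0 (π.t k)) (ω : Omega) : u s (trunc k ω) = u s ω := by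
  have h1 := π.mem_Ico_idx (s := s) ⟨hs.1, hs.2.trans_le (π.t_le_last hk)⟩
  refine hu.trunc_eq (π.idx_lt s) ?_ h1 ω
  by_contra h
  exact (hs.2.trans_le (π.t_le (not_lt.1 h) (π.idx_lt s).le)).not_ge h1.1

end Admissible

/-! ### The controlled state at grid points -/

section StateProcess

variable {d : ℕ} {U V : Type} [MetricSpace U] [CompactSpace U] [MetricSpace V] [CompactSpace V]
  [MeasurableSpace U] [BorelSpace U] [MeasurableSpace V] [BorelSpace V]
  {f : ℝ → EuclideanSpace ℝ (Fin d) → U → V → EuclideanSpace ℝ (Fin d)} {C : ℝ} {K : ℝ≥0}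
  {φ : EuclideanSpace ℝ (Fin d) → ℝ} {M : ℝ} {L : ℝ≥0} {T : ℝ} {π : Partition T}
  {x : EuclideanSpace ℝ (Fin d)} {u u' : ℝ → Omega → U} {v v' : ℝ → Omega → V} {i j : ℕ}

/-- The state at the grid point `t_j` of the trajectory started in `x` at the grid point `t_i`. -/
def stateAt (f : ℝ → EuclideanSpace ℝ (Fin d) → U → V → EuclideanSpace ℝ (Fin d)) {T : ℝ}
    (π : Partition T) (x : EuclideanSpace ℝ (Fin d)) (u : ℝ → Omega → U) (v : ℝ → Omega → V)
    (i j : ℕ) (ω : Omega) : EuclideanSpace ℝ (Fin d) :=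
  stepFlow f (π.t i) (π.t j) x (fun r => u r ω) (fun r => v r ω)

lemma stateAt_self (hf : IsDynamics f C K) (hu : IsMixture Prod.fst π u)
    (hv : IsMixture Prod.snd π v) (ω : Omega) : stateAt f π x u v i i ω = x :=
  hf.stepFlow_self (hu.measurable_path ω) (hv.measurable_path ω) _ _

lemma stateAt_succ (hf : IsDynamics f C K) (hu : IsMixture Prod.fst π u)
    (hv : IsMixture Prod.snd π v) (hij : i ≤ j) (hj : j < π.n) (ω : Omega) :
    stateAt f π x u v i (j + 1) ω = stepFlow f (π.t j) (π.t (j + 1)) (stateAt f π x u v i j ω)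
      (fun r => u r ω) (fun r => v r ω) :=
  (hf.stepFlow_trans (hu.measurable_path ω) (hv.measurable_path ω) (π.t_le hij hj.le)
    (π.mono j hj).le x).symm

lemma measurable_stateAt (hf : IsDynamics f C K) (hu : IsMixture Prod.fst π u)
    (hv : IsMixture Prod.snd π v) (hij : i ≤ j) (hj : j ≤ π.n) :
    Measurable[Fsig j] (stateAt f π x u v i j) := by
  refine measurable_Fsig_iff.2 ⟨hf.measurable_stepFlow hu.1 hv.1 (π.t_le hij hj) measurable_const,
    fun ω => hf.stepFlow_congr (hu.measurable_path _) (hv.measurable_path _) (hu.measurable_path _)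
      (hv.measurable_path _) (π.t_le hij hj) (ae_of_all _ fun r hr => ?_)
      (ae_of_all _ fun r hr => ?_) x⟩
  · exact hu.trunc_eq_of_lt hj ⟨(π.t_mem (hij.trans hj)).1.trans hr.1.le, hr.2⟩ ω
  · exact hv.trunc_eq_of_lt hj ⟨(π.t_mem (hij.trans hj)).1.trans hr.1.le, hr.2⟩ ω

lemma stateAt_congr (hf : IsDynamics f C K) (hu : IsMixture Prod.fst π u)
    (hv : IsMixture Prod.snd π v) (hu' : IsMixture Prod.fst π u') (hv' : IsMixture Prod.snd π v')
    (hij : i ≤ j) (hj : j ≤ π.n) {ω : Omega}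
    (hue : ∀ᵐ r, r ∈ Icc (π.t i) (π.t j) → u r ω = u' r ω)
    (hve : ∀ᵐ r, r ∈ Icc (π.t i) (π.t j) → v r ω = v' r ω) :
    stateAt f π x u v i j ω = stateAt f π x u' v' i j ω :=
  hf.stepFlow_congr (hu.measurable_path _) (hv.measurable_path _) (hu'.measurable_path _)
    (hv'.measurable_path _) (π.t_le hij hj) (hue.mono fun _ h hr => h (Ioo_subset_Icc_self hr))
    (hve.mono fun _ h hr => h (Ioo_subset_Icc_self hr)) x

lemma ae_ae_of_aeEqIcc {P : Measure Omega} [IsProbabilityMeasure P] {α : Type*} {a b : ℝ}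
    {w w' : ℝ → Omega → α} (h : aeEqIcc P a b w w') :
    ∀ᵐ ω ∂P, ∀ᵐ r, r ∈ Icc a b → w r ω = w' r ω := by
  have h1 : ∀ᵐ q ∂(P.prod (volume : Measure ℝ)), q.2 ∈ Icc a b → w q.2 q.1 = w' q.2 q.1 :=
    (Measure.measurePreserving_swap (μ := P) (ν := (volume : Measure ℝ))).quasiMeasurePreserving.ae
      h
  exact Measure.ae_ae_of_ae_prod h1

/-- Conditioning the pay-off at `t_{j+1}` on the information available at `t_j`. -/
lemma setIntegral_stateAt_succ {P : Measure Omega} [IsProbabilityMeasure P]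
    (hP : IsProductMeasure P) (hf : IsDynamics f C K) (hφ : IsBddLip φ M L)
    (hu : IsMixture Prod.fst π u) (hv : IsMixture Prod.snd π v) (hij : i ≤ j) (hj : j < π.n)
    {κ κ' : Omega → ℕ} {uc : ℕ → RandCtrl U} {vc : ℕ → RandCtrl V} (hκ : Measurable[Fsig j] κ)
    (hκ' : Measurable[Fsig j] κ')
    (huc : ∀ ω, ∀ s ∈ Ico (π.t j) (π.t (j + 1)), u s ω = (uc (κ ω)).1 s (ω j).1)
    (hvc : ∀ ω, ∀ s ∈ Ico (π.t j) (π.t (j + 1)), v s ω = (vc (κ' ω)).1 s (ω j).2) :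
    Integrable (fun ω => stepPay f (π.t j) (π.t (j + 1)) φ (stateAt f π x u v i j ω)
        (uc (κ ω)) (vc (κ' ω))) P ∧
      ∀ A, MeasurableSet[Fsig j] A → ∫ ω in A, φ (stateAt f π x u v i (j + 1) ω) ∂P =
        ∫ ω in A, stepPay f (π.t j) (π.t (j + 1)) φ (stateAt f π x u v i j ω)
          (uc (κ ω)) (vc (κ' ω)) ∂P := by
  have hX := measurable_stateAt (x := x) hf hu hv hij hj.le
  have hX' := measurable_Fsig_iff.1
    (measurable_stateAt (x := x) hf hu hv (hij.trans (Nat.le_succ j)) hj)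
  have hΦ : Measurable fun ω => φ (stateAt f π x u v i (j + 1) ω) :=
    hφ.lip.continuous.measurable.comp hX'.1
  have key : ∀ ω, stepPay f (π.t j) (π.t (j + 1)) φ (stateAt f π x u v i j ω) (uc (κ ω)) (vc (κ' ω))
      = ∫ ζ : I × I, φ (stateAt f π x u v i (j + 1) (Function.update ω j ζ)) := by
    intro ω
    refine integral_congr_ae (ae_of_all _ fun ζ => ?_)
    simp only
    rw [stateAt_succ hf hu hv hij hj, apply_update_of_Fsig hX]
    congr 1
    refine hf.stepFlow_congr ((uc _).measurable_path _) ((vc _).measurable_path _)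
      (hu.measurable_path _) (hv.measurable_path _) (π.mono j hj).le
      (ae_of_all _ fun r hr => ?_) (ae_of_all _ fun r hr => ?_) _
    · rw [huc _ _ (Ioo_subset_Ico_self hr), apply_update_of_Fsig hκ, Function.update_self]
    · rw [hvc _ _ (Ioo_subset_Ico_self hr), apply_update_of_Fsig hκ', Function.update_self]
  refine ⟨?_, fun A hA => ?_⟩
  · refine Integrable.of_bound ?_ M (ae_of_all _ fun ω => by simpa using abs_stepPay_le hφ.bdd _ _ _)
    simp_rw [key]
    exact ((hΦ.comp
      (measurable_update_coord j)).stronglyMeasurable.integral_prod_right').aestronglyMeasurable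
  · simp_rw [key]
    exact setIntegral_eq_setIntegral_update hP hΦ (fun ω => hφ.bdd _)
      (fun ω => congrArg φ (hX'.2 ω)) hA

end StateProcess

/-! ### Essential suprema and conditional expectations -/

section EssentialSup

variable {P : Measure Omega} [IsProbabilityMeasure P]

/-- A uniformly bounded family of random variables has an essential supremum. -/
lemma exists_isEssSupFam {ι : Sort*} [Nonempty ι] {ξ : ι → Omega → ℝ} {M : ℝ}
    (hm : ∀ i, AEMeasurable (ξ i) P) (hb : ∀ i, ∀ᵐ ω ∂P, |ξ i ω| ≤ M) :
    ∃ S, IsEssSupFam P ξ S := by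
  have hM : 0 ≤ M := by
    obtain ⟨ω, hω⟩ := (hb (Classical.arbitrary ι)).exists
    exact (abs_nonneg _).trans hω
  choose ξ' hξ' using fun i => hm i
  let η : ι → Omega → ℝ := fun i ω => max (-M) (min (ξ' i ω) M)
  have hη : ∀ i, ξ i =ᵐ[P] η i := fun i => by
    filter_upwards [hb i, (hξ' i).2] with ω h1 h2
    rw [h2] at h1
    rw [h2]
    simp only [η]
    rw [min_eq_left (abs_le.1 h1).2, max_eq_right (abs_le.1 h1).1]
  have hηm : ∀ i, Measurable (η i) := fun i =>
    measurable_const.max ((hξ' i).1.min measurable_const)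
  have hηl : ∀ i ω, -M ≤ η i ω := fun i ω => le_max_left _ _
  have hηu : ∀ i ω, η i ω ≤ M := fun i ω => max_le (by linarith) (min_le_right _ _)
  let Z : (ℕ → ι) → Omega → ℝ := fun s ω => ⨆ n, η (s n) ω
  have hbd : ∀ (s : ℕ → ι) ω, BddAbove (range fun n => η (s n) ω) := fun s ω =>
    ⟨M, by rintro _ ⟨n, rfl⟩; exact hηu _ _⟩
  have hZle : ∀ (s : ℕ → ι) n ω, η (s n) ω ≤ Z s ω := fun s n ω => le_ciSup (hbd s ω) n
  have hZu : ∀ s ω, Z s ω ≤ M := fun s ω => ciSup_le fun n => hηu _ _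
  have hZi : ∀ s : ℕ → ι, Integrable (Z s) P := fun s =>
    Integrable.of_bound (Measurable.iSup fun n => hηm (s n)).aestronglyMeasurable M
      (ae_of_all _ fun ω => abs_le.2 ⟨(hηl (s 0) ω).trans (hZle s 0 ω), hZu s ω⟩)
  have hIu : ∀ s, ∫ ω, Z s ω ∂P ≤ M := fun s => by
    simpa using integral_mono (hZi s) (integrable_const M) (hZu s)
  have hbdd : BddAbove (range fun s => ∫ ω, Z s ω ∂P) :=
    ⟨M, by rintro _ ⟨s, rfl⟩; exact hIu s⟩
  set c := ⨆ s, ∫ ω, Z s ω ∂P with hc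
  have hex : ∀ k : ℕ, ∃ s, c - 1 / ((k : ℝ) + 1) < ∫ ω, Z s ω ∂P := fun k =>
    exists_lt_of_lt_ciSup (sub_lt_self _ (by positivity))
  choose s hs using hex
  let s' : ℕ → ι := fun n => s n.unpair.1 n.unpair.2
  have hs' : ∫ ω, Z s' ω ∂P = c := by
    refine le_antisymm (le_ciSup hbdd s') (le_of_forall_pos_le_add fun ε hε => ?_)
    obtain ⟨k, hk⟩ := exists_nat_one_div_lt hε
    have h1 : ∫ ω, Z (s k) ω ∂P ≤ ∫ ω, Z s' ω ∂P := by
      refine integral_mono (hZi _) (hZi _) fun ω => ciSup_le fun n => ?_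
      have := hZle s' (Nat.pair k n) ω
      simpa [s'] using this
    linarith [hs k]
  refine ⟨Z s', fun i => ?_, fun W hW => ?_⟩
  · let s'' : ℕ → ι := fun n => Nat.casesOn n i s'
    have h1 : Z s' ≤ Z s'' := fun ω => ciSup_le fun n => hZle s'' (n + 1) ω
    have h2 : ∫ ω, (Z s'' ω - Z s' ω) ∂P = 0 := by
      refine le_antisymm ?_ (integral_nonneg fun ω => sub_nonneg.2 (h1 ω))
      rw [integral_sub (hZi _) (hZi _), hs']
      linarith [le_ciSup hbdd s'']
    have h3 := (integral_eq_zero_iff_of_nonneg (fun ω => sub_nonneg.2 (h1 ω))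
      ((hZi s'').sub (hZi s'))).1 h2
    filter_upwards [h3, hη i] with ω h4 h5
    rw [h5]
    have h6 := hZle s'' 0 ω
    simp only [Pi.zero_apply] at h4
    change η i ω ≤ Z s'' ω at h6
    linarith
  · have h1 : ∀ᵐ ω ∂P, ∀ n, η (s' n) ω ≤ W ω := by
      rw [ae_all_iff]
      intro n
      filter_upwards [hW (s' n), hη (s' n)] with ω h1 h2
      rwa [← h2]
    filter_upwards [h1] with ω h
    exact ciSup_le h

lemma condExp_le_of_forall_setIntegral_le {j : ℕ} {ξ : Omega → ℝ} (hξ : Integrable ξ P) {c : ℝ}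
    (h : ∀ A, MeasurableSet[Fsig j] A → ∫ ω in A, ξ ω ∂P ≤ c * P.real A) :
    P[ξ | Fsig j] ≤ᵐ[P] fun _ => c := by
  have hle := Fsig_le j
  refine ae_le_of_ae_le_trim (hm := hle) ?_
  refine ae_le_of_forall_setIntegral_le
    (integrable_condExp.trim hle stronglyMeasurable_condExp) (integrable_const c) fun A hA _ => ?_
  rw [← setIntegral_trim hle stronglyMeasurable_condExp hA, setIntegral_condExp hle hξ hA,
    setIntegral_const, smul_eq_mul, mul_comm, measureReal_def, trim_measurableSet_eq hle hA]
  exact h A hA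

lemma le_condExp_of_forall_le_setIntegral {j : ℕ} {ξ : Omega → ℝ} (hξ : Integrable ξ P) {c : ℝ}
    (h : ∀ A, MeasurableSet[Fsig j] A → c * P.real A ≤ ∫ ω in A, ξ ω ∂P) :
    (fun _ => c) ≤ᵐ[P] P[ξ | Fsig j] := by
  have h1 : P[-ξ | Fsig j] ≤ᵐ[P] fun _ => -c :=
    condExp_le_of_forall_setIntegral_le hξ.neg fun A hA => by
      have := h A hA
      simp only [Pi.neg_apply, integral_neg]
      linarith
  filter_upwards [h1, condExp_neg ξ (Fsig j)] with ω h2 h3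
  rw [h3] at h2
  simpa using h2

end EssentialSup

/-! ### Couples of strategies -/

section Strategies

set_option linter.unusedSectionVars false

variable {A B : Type} [MeasurableSpace A] [MeasurableSpace B] {T : ℝ} {π : Partition T}
  {P : Measure Omega} [IsProbabilityMeasure P]

lemma aeStEq_const_iff {α : Type*} {a b : ℝ} {w w' : ℝ → Omega → α} :
    aeStEq P a (fun _ => b) w w' ↔ aeEqIcc P a b w w' :=
  Filter.eventually_congr (ae_of_all _ fun _ => and_imp.symm)

lemma isStoppingIdx_const {m : ℕ} (hm : m < π.n) : IsStoppingIdx π fun _ => m :=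
  ⟨fun _ => hm, fun _ => @MeasurableSet.const _ (Fsig _) _⟩

lemma aeEqIcc.mono {α : Type*} {a b b' : ℝ} {w w' : ℝ → Omega → α} (h : aeEqIcc P a b w w')
    (hb : b' ≤ b) : aeEqIcc P a b' w w' :=
  Eventually.mono h fun _ h hq => h ⟨hq.1, hq.2.trans hb⟩

lemma aeEqIcc_self {α : Type*} (a : ℝ) (w w' : ℝ → Omega → α) : aeEqIcc P a a w w' := by
  have h : ∀ᵐ s : ℝ, s ≠ a := by simp [ae_iff]
  filter_upwards [Measure.quasiMeasurePreserving_fst.ae h] with q hq hqa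
  exact absurd (le_antisymm hqa.2 hqa.1) hq

lemma IsNAD1.aeEqIcc {t : ℝ} {α : (ℝ → Omega → B) → ℝ → Omega → A} (hα : IsNAD1 A B P π t α)
    {m : ℕ} (hm : m < π.n) {v v' : ℝ → Omega → B} (hv : v ∈ AdmControl2 B π)
    (hv' : v' ∈ AdmControl2 B π) (h : aeEqIcc P t (π.t m) v v') :
    aeEqIcc P t (π.t (m + 1)) (α v) (α v') :=
  aeStEq_const_iff.1 (hα.2 _ (isStoppingIdx_const hm) v v' hv hv' (aeStEq_const_iff.2 h))

lemma IsNAD2.aeEqIcc {t : ℝ} {β : (ℝ → Omega → A) → ℝ → Omega → B} (hβ : IsNAD2 A B P π t β)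
    {m : ℕ} (hm : m < π.n) {u u' : ℝ → Omega → A} (hu : u ∈ AdmControl1 A π)
    (hu' : u' ∈ AdmControl1 A π) (h : aeEqIcc P t (π.t m) u u') :
    aeEqIcc P t (π.t (m + 1)) (β u) (β u') :=
  aeStEq_const_iff.1 (hβ.2 _ (isStoppingIdx_const hm) u u' hu hu' (aeStEq_const_iff.2 h))

variable [MeasurableSingletonClass A] [Nonempty A] [Nonempty B]

lemma isFixPair_fixPair {i : ℕ} (hi : i < π.n) {α : (ℝ → Omega → B) → ℝ → Omega → A}
    {β : (ℝ → Omega → A) → ℝ → Omega → B} (hα : IsNAD1 A B P π (π.t i) α)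
    (hβ : IsNAD2 A B P π (π.t i) β) :
    IsFixPair P π (π.t i) T α β (fixPair P π (π.t i) T α β).1 (fixPair P π (π.t i) T α β).2 := by
  suffices h : ∃ q : (ℝ → Omega → A) × (ℝ → Omega → B), IsFixPair P π (π.t i) T α β q.1 q.2 from
    Classical.epsilon_spec h
  let w : ℕ → ℝ → Omega → A := fun m => (fun u => α (β u))^[m] fun _ _ => Classical.arbitrary A
  have hw : ∀ m, w (m + 1) = α (β (w m)) := fun m => Function.iterate_succ_apply' _ _ _
  have hadm : ∀ m, w m ∈ AdmControl1 A π := fun m => by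
    induction m with
    | zero => exact mem_admControl1_iff.2 (isMixture_const _)
    | succ m ih => rw [hw]; exact hα.1 _ (hβ.1 _ ih)
  have hagree : ∀ m, i + m ≤ π.n → aeEqIcc P (π.t i) (π.t (i + m)) (w m) (w (m + 1)) := by
    intro m
    induction m with
    | zero => exact fun _ => aeEqIcc_self _ _ _
    | succ m ih =>
      intro hm
      have h1 := hβ.aeEqIcc (m := i + m) (by omega) (hadm m) (hadm (m + 1)) (ih (by omega))
      have h2 := hα.aeEqIcc (m := i + m) (by omega) (hβ.1 _ (hadm m)) (hβ.1 _ (hadm (m + 1)))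
        (h1.mono (π.mono _ (by omega)).le)
      rw [← hw, ← hw] at h2
      exact h2
  have h1 := hagree (π.n - i) (by omega)
  rw [show i + (π.n - i) = π.n by omega, π.map_last, hw] at h1
  exact ⟨(w (π.n - i), β (w (π.n - i))), hadm _, hβ.1 _ (hadm _),
    Eventually.mono h1 fun _ h hq => (h hq).symm,
    ae_of_all _ fun _ _ => rfl⟩

lemma isNAD1_const {t : ℝ} {u : ℝ → Omega → A} (hu : u ∈ AdmControl1 A π) :
    IsNAD1 A B P π t fun _ => u :=
  ⟨fun _ _ => hu, fun _ _ _ _ _ _ _ => ae_of_all _ fun _ _ _ => rfl⟩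

end Strategies

/-! ### Feedback strategies of the second player -/

section Feedback

set_option linter.unusedSectionVars false

variable {d : ℕ} {U V : Type} [MetricSpace U] [CompactSpace U] [MetricSpace V] [CompactSpace V]
  [MeasurableSpace U] [BorelSpace U] [MeasurableSpace V] [BorelSpace V]
  {f : ℝ → EuclideanSpace ℝ (Fin d) → U → V → EuclideanSpace ℝ (Fin d)} {C : ℝ} {K : ℝ≥0}
  {T : ℝ} {π : Partition T}
  {x : EuclideanSpace ℝ (Fin d)} {u u' : ℝ → Omega → U} {i j : ℕ}
  {cell : ℕ → EuclideanSpace ℝ (Fin d) → ℕ} {vs : ℕ → ℕ → RandCtrl V}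

/-- The state at grid points when the second player uses the randomised controls `vs j k` on the
`j`-th interval whenever the state at `t_j` is in the `k`-th cell. -/
def feedbackState (f : ℝ → EuclideanSpace ℝ (Fin d) → U → V → EuclideanSpace ℝ (Fin d)) {T : ℝ}
    (π : Partition T) (x : EuclideanSpace ℝ (Fin d)) (i : ℕ)
    (cell : ℕ → EuclideanSpace ℝ (Fin d) → ℕ) (vs : ℕ → ℕ → RandCtrl V) (u : ℝ → Omega → U) :
    ℕ → Omega → EuclideanSpace ℝ (Fin d)
  | 0 => fun _ => x
  | j + 1 => fun ω => if j < i then x else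
      stepFlow f (π.t j) (π.t (j + 1)) (feedbackState f π x i cell vs u j ω) (fun r => u r ω)
        fun r => (vs j (cell j (feedbackState f π x i cell vs u j ω))).1 r (ω j).2

/-- The feedback strategy belonging to `feedbackState`. -/
def feedback (f : ℝ → EuclideanSpace ℝ (Fin d) → U → V → EuclideanSpace ℝ (Fin d)) {T : ℝ}
    (π : Partition T) (x : EuclideanSpace ℝ (Fin d)) (i : ℕ)
    (cell : ℕ → EuclideanSpace ℝ (Fin d) → ℕ) (vs : ℕ → ℕ → RandCtrl V) (u : ℝ → Omega → U)
    (s : ℝ) (ω : Omega) : V :=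
  (vs (π.idx s) (cell (π.idx s) (feedbackState f π x i cell vs u (π.idx s) ω))).1 s
    (ω (π.idx s)).2

lemma feedbackState_of_le (hij : j ≤ i) (ω : Omega) :
    feedbackState f π x i cell vs u j ω = x := by
  cases j with
  | zero => rfl
  | succ j => exact if_pos hij

lemma feedbackState_succ (hij : i ≤ j) (ω : Omega) :
    feedbackState f π x i cell vs u (j + 1) ω = stepFlow f (π.t j) (π.t (j + 1))
      (feedbackState f π x i cell vs u j ω) (fun r => u r ω)
        fun r => (vs j (cell j (feedbackState f π x i cell vs u j ω))).1 r (ω j).2 :=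
  if_neg hij.not_gt

lemma measurable_randCtrl_seed (w : ℕ → RandCtrl V) {κ : Omega → ℕ} (hκ : Measurable κ) (j : ℕ) :
    Measurable (Function.uncurry fun (r : ℝ) (ω : Omega) => (w (κ ω)).1 r (ω j).2) := by
  have h1 : Measurable fun q : ℕ × ℝ × I => (w q.1).1 q.2.1 q.2.2 :=
    measurable_from_prod_countable_right fun k => (w k).2
  have h2 : Measurable fun q : ℝ × Omega => (κ q.2, q.1, (q.2 j).2) :=
    (hκ.comp measurable_snd).prodMk (measurable_fst.prodMk
      (measurable_snd.comp ((measurable_pi_apply j).comp measurable_snd)))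
  exact h1.comp h2

lemma measurable_feedbackState (hf : IsDynamics f C K) (hcell : ∀ j, Measurable (cell j))
    (hu : IsMixture Prod.fst π u) (hj : j ≤ π.n) :
    Measurable[Fsig j] (feedbackState f π x i cell vs u j) := by
  induction j with
  | zero => exact measurable_Fsig_iff.2 ⟨measurable_const, fun _ => rfl⟩
  | succ j ih =>
    have hX := ih (by omega)
    have hX' := measurable_Fsig_iff.1 (hX.mono (Fsig_mono (Nat.le_succ j)) le_rfl)
    by_cases hi : j < i
    · have : feedbackState f π x i cell vs u (j + 1) = fun _ => x := funext fun ω => if_pos hi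
      rw [this]
      exact measurable_Fsig_iff.2 ⟨measurable_const, fun _ => rfl⟩
    · have : feedbackState f π x i cell vs u (j + 1) = fun ω =>
          stepFlow f (π.t j) (π.t (j + 1)) (feedbackState f π x i cell vs u j ω) (fun r => u r ω)
          fun r => (vs j (cell j (feedbackState f π x i cell vs u j ω))).1 r (ω j).2 :=
        funext fun ω => feedbackState_succ (not_lt.1 hi) ω
      rw [this]
      have hv := measurable_randCtrl_seed (vs j) ((hcell j).comp hX'.1) j
      refine measurable_Fsig_iff.2 ⟨hf.measurable_stepFlow hu.1 hv (π.mono j hj).le hX'.1,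
        fun ω => ?_⟩
      rw [hX'.2, trunc_apply_of_lt (Nat.lt_succ_self j)]
      exact hf.stepFlow_congr (hu.measurable_path _) (RandCtrl.measurable_path _ _)
        (hu.measurable_path _) (RandCtrl.measurable_path _ _) (π.mono j hj).le
        (ae_of_all _ fun r hr => hu.trunc_eq_of_lt hj ⟨(π.t_mem (by omega)).1.trans hr.1.le, hr.2⟩ ω)
        (ae_of_all _ fun r _ => rfl) _

lemma isMixture_feedback (hf : IsDynamics f C K) (hcell : ∀ j, Measurable (cell j))
    (hu : IsMixture Prod.fst π u) : IsMixture Prod.snd π (feedback f π x i cell vs u) := by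
  refine ⟨?_, fun j hj => ⟨_, vs j, (hcell j).comp
    (measurable_feedbackState (x := x) (i := i) (vs := vs) hf hcell hu hj.le), fun ω s hs => ?_⟩⟩
  · have h1 : Measurable fun q : ℕ × ℝ × Omega => if q.1 < π.n then
        (vs q.1 (cell q.1 (feedbackState f π x i cell vs u q.1 q.2.2))).1 q.2.1 (q.2.2 q.1).2
        else (vs 0 0).1 q.2.1 0 := by
      refine measurable_from_prod_countable_right fun j => ?_
      by_cases hj : j < π.n
      · simp only [hj, if_true]
        exact measurable_randCtrl_seed (vs j) ((hcell j).comp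
          (measurable_of_Fsig (measurable_feedbackState hf hcell hu hj.le))) j
      · simp only [hj, if_false]
        exact ((vs 0 0).measurable_path 0).comp measurable_fst
    have h2 : Measurable fun q : ℝ × Omega => (π.idx q.1, q.1, q.2) :=
      (π.measurable_idx.comp measurable_fst).prodMk measurable_id
    convert h1.comp h2 using 1
    funext q
    simp [feedback, Function.uncurry, π.idx_lt]
  · simp only [feedback, π.idx_eq hj hs, Function.comp]

lemma stateAt_feedback (hf : IsDynamics f C K) (hcell : ∀ j, Measurable (cell j))
    (hu : IsMixture Prod.fst π u) (hij : i ≤ j) (hj : j ≤ π.n) (ω : Omega) :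
    stateAt f π x u (feedback f π x i cell vs u) i j ω = feedbackState f π x i cell vs u j ω := by
  have hv := isMixture_feedback (x := x) (i := i) (vs := vs) hf hcell hu
  induction j, hij using Nat.le_induction with
  | base => rw [stateAt_self hf hu hv, feedbackState_of_le le_rfl]
  | succ j hij ih =>
    rw [stateAt_succ hf hu hv hij hj, ih (by omega), feedbackState_succ hij]
    refine hf.stepFlow_congr (hu.measurable_path _) (hv.measurable_path _)
      (hu.measurable_path _) (RandCtrl.measurable_path _ _) (π.mono j hj).le
      (ae_of_all _ fun r _ => rfl) (ae_of_all _ fun r hr => ?_) _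
    simp only [feedback, π.idx_eq hj (Ioo_subset_Ico_self hr)]

/-- Feedback strategies are nonanticipative with delay. -/
lemma isNAD2_feedback {P : Measure Omega} [IsProbabilityMeasure P] [Nonempty U] [Nonempty V]
    (hf : IsDynamics f C K) (hcell : ∀ j, Measurable (cell j)) (hi : i < π.n) :
    IsNAD2 U V P π (π.t i) (feedback f π x i cell vs) := by
  refine ⟨fun u hu => mem_admControl2_iff.2
    (isMixture_feedback hf hcell (mem_admControl1_iff.1 hu)), ?_⟩
  intro τ hτ u u' hu hu' h
  rw [mem_admControl1_iff] at hu hu'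
  have h1 : ∀ᵐ ω ∂P, ∀ᵐ r, π.t i ≤ r → r ≤ π.t (τ ω) → u r ω = u' r ω := by
    have := (Measure.measurePreserving_swap (μ := P)
      (ν := (volume : Measure ℝ))).quasiMeasurePreserving.ae h
    exact Measure.ae_ae_of_ae_prod this
  have h2 : ∀ᵐ r : ℝ, r ∉ range π.t := (countable_range π.t).ae_notMem _
  have h3 := (Measure.quasiMeasurePreserving_snd (μ := (volume : Measure ℝ)) (ν := P)).ae h1
  have h4 := (Measure.quasiMeasurePreserving_fst (μ := (volume : Measure ℝ)) (ν := P)).ae h2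
  filter_upwards [h3, h4] with ⟨s, ω⟩ hω hs hs1 hs2
  simp only at hω hs hs1 hs2 ⊢
  have hτn := hτ.1 ω
  have hX : ∀ j ≤ τ ω,
      feedbackState f π x i cell vs u j ω = feedbackState f π x i cell vs u' j ω := by
    intro j
    induction j with
    | zero => exact fun _ => rfl
    | succ j ih =>
      intro hj
      by_cases hji : j < i
      · rw [feedbackState_of_le hji, feedbackState_of_le hji]
      · rw [feedbackState_succ (not_lt.1 hji), feedbackState_succ (not_lt.1 hji), ih (by omega)]
        refine hf.stepFlow_congr (hu.measurable_path _) (RandCtrl.measurable_path _ _)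
          (hu'.measurable_path _) (RandCtrl.measurable_path _ _) (π.mono j (by omega)).le
          ?_ (ae_of_all _ fun r _ => rfl) _
        filter_upwards [hω] with r hr hrj
        exact hr ((π.t_le (by omega) (by omega)).trans hrj.1.le)
          (hrj.2.le.trans (π.t_le hj hτn.le))
  have hs3 : s < π.t (τ ω + 1) := lt_of_le_of_ne hs2 fun h => hs ⟨_, h.symm⟩
  have hs4 := π.mem_Ico_idx (s := s) ⟨(π.t_mem hi.le).1.trans hs1, hs3.trans_le (π.t_le_last hτn)⟩
  have hidx : π.idx s ≤ τ ω := by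
    by_contra hc
    exact (hs3.trans_le (π.t_le (not_le.1 hc) (π.idx_lt s).le)).not_ge hs4.1
  simp only [feedback, hX _ hidx]

end Feedback

/-! ### The upper value at grid points is given by backward recursion -/

section Identification

set_option linter.unusedSectionVars false

variable {d : ℕ} {U V : Type} [MetricSpace U] [CompactSpace U] [MetricSpace V] [CompactSpace V]
  [MeasurableSpace U] [BorelSpace U] [MeasurableSpace V] [BorelSpace V] [Nonempty U] [Nonempty V]
  {f : ℝ → EuclideanSpace ℝ (Fin d) → U → V → EuclideanSpace ℝ (Fin d)} {C : ℝ} {K : ℝ≥0}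
  {g : EuclideanSpace ℝ (Fin d) → ℝ} {M : ℝ} {L : ℝ≥0} {T : ℝ} {π : Partition T}
  {i : ℕ} {P : Measure Omega} [IsProbabilityMeasure P]

lemma IsDynamics.integrable_stateAt {φ : EuclideanSpace ℝ (Fin d) → ℝ} (hf : IsDynamics f C K)
    (hφ : IsBddLip φ M L) {u : ℝ → Omega → U} {v : ℝ → Omega → V} (hu : IsMixture Prod.fst π u)
    (hv : IsMixture Prod.snd π v) (x : EuclideanSpace ℝ (Fin d)) {j : ℕ} (hij : i ≤ j)
    (hj : j ≤ π.n) : Integrable (fun ω => φ (stateAt f π x u v i j ω)) P :=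
  hφ.integrable_comp (measurable_of_Fsig (measurable_stateAt hf hu hv hij hj))

/-- Against a suitable feedback strategy, the first player gets at most the value plus `ε`. -/
lemma exists_feedback_le (hP : IsProductMeasure P) (hf : IsDynamics f C K) (hg : IsBddLip g M L)
    (hi : i < π.n) (x : EuclideanSpace ℝ (Fin d)) {ε : ℝ} (hε : 0 < ε) :
    ∃ (cell : ℕ → EuclideanSpace ℝ (Fin d) → ℕ) (vs : ℕ → ℕ → RandCtrl V),
      (∀ j, Measurable (cell j)) ∧ ∀ u, IsMixture Prod.fst π u →
        ∀ A, MeasurableSet[Fsig i] A →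
          ∫ ω in A, g (stateAt f π x u (feedback f π x i cell vs u) i π.n ω) ∂P
            ≤ (gridVal f g π i x + ε) * P.real A := by
  have hn : (0 : ℝ) < π.n := by exact_mod_cast π.npos
  have hsel : ∀ j, ∃ (cell : EuclideanSpace ℝ (Fin d) → ℕ) (v : ℕ → RandCtrl V), Measurable cell ∧
      (j < π.n → ∀ x (u : RandCtrl U), stepPay f (π.t j) (π.t (j + 1)) (gridVal f g π (j + 1)) x u
        (v (cell x)) ≤ gridVal f g π j x + ε / π.n) := by
    intro j
    by_cases hj : j < π.n
    · obtain ⟨L', hL'⟩ := hf.exists_isBddLip_gridVal (π := π) hg (j := j + 1) hj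
      obtain ⟨cell, v, hc, h⟩ := hf.exists_selection_le hL' (π.mono j hj).le (div_pos hε hn)
      exact ⟨cell, v, hc, fun _ => by rwa [gridVal_of_lt hj]⟩
    · exact ⟨fun _ => 0, fun _ => Classical.arbitrary _, measurable_const, fun h => absurd h hj⟩
  choose cell vs hcell hsel using hsel
  refine ⟨cell, vs, hcell, fun u hu A hA => ?_⟩
  have hv := isMixture_feedback (x := x) (i := i) (vs := vs) hf hcell hu
  have key : ∀ j, i ≤ j → j ≤ π.n →
      ∫ ω in A, gridVal f g π j (stateAt f π x u (feedback f π x i cell vs u) i j ω) ∂P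
        ≤ (gridVal f g π i x + (j - i) * (ε / π.n)) * P.real A := by
    intro j hij
    induction j, hij using Nat.le_induction with
    | base =>
      intro _
      simp only [stateAt_self hf hu hv, setIntegral_const, smul_eq_mul, sub_self, zero_mul, add_zero]
      rw [mul_comm]
    | succ j hij ih =>
      intro hj
      obtain ⟨κ, uc, hκ, huc⟩ := hu.2 j hj
      obtain ⟨L', hL'⟩ := hf.exists_isBddLip_gridVal (π := π) hg (j := j + 1) hj
      obtain ⟨L₀, hL₀⟩ := hf.exists_isBddLip_gridVal (π := π) hg (j := j) (by omega)
      have hX := measurable_feedbackState (x := x) (i := i) (vs := vs) hf hcell hu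
        (show j ≤ π.n by omega)
      obtain ⟨h1, h2⟩ := setIntegral_stateAt_succ (x := x) hP hf hL' hu hv hij hj hκ
        ((hcell j).comp hX) huc (vc := vs j) fun ω s hs => by
          simp only [feedback, π.idx_eq hj hs, Function.comp]
      rw [h2 A (Fsig_mono hij A hA)]
      have hint := hf.integrable_stateAt (P := P) hL₀ hu hv x hij (show j ≤ π.n by omega)
      have h3 : ∫ ω in A, stepPay f (π.t j) (π.t (j + 1)) (gridVal f g π (j + 1))
            (stateAt f π x u (feedback f π x i cell vs u) i j ω) (uc (κ ω))
            (vs j ((cell j ∘ feedbackState f π x i cell vs u j) ω)) ∂P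
          ≤ ∫ ω in A, (gridVal f g π j (stateAt f π x u (feedback f π x i cell vs u) i j ω)
            + ε / π.n) ∂P := by
        refine setIntegral_mono h1.integrableOn (hint.add (integrable_const _)).integrableOn
          fun ω => ?_
        have := hsel j hj (stateAt f π x u (feedback f π x i cell vs u) i j ω) (uc (κ ω))
        rwa [stateAt_feedback hf hcell hu hij (by omega)] at this ⊢
      refine h3.trans ?_
      rw [integral_add hint.integrableOn (integrable_const _).integrableOn, setIntegral_const,
        smul_eq_mul]
      have := ih (by omega)
      push_cast
      linarith
  have h := key π.n hi.le le_rfl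
  rw [gridVal_last] at h
  refine h.trans (mul_le_mul_of_nonneg_right ?_ measureReal_nonneg)
  have h1 : ((π.n : ℝ) - i) * (ε / π.n) ≤ π.n * (ε / π.n) :=
    mul_le_mul_of_nonneg_right (by linarith [(Nat.cast_nonneg i : (0 : ℝ) ≤ i)])
      (div_pos hε hn).le
  rw [mul_div_cancel₀ _ hn.ne'] at h1
  linarith

/-- Modifying a control on one interval by a mixture of randomised controls. -/
lemma IsMixture.modify {u : ℝ → Omega → U} (hu : IsMixture Prod.fst π u) {j : ℕ} (hj : j < π.n)
    {κ : Omega → ℕ} (hκ : Measurable[Fsig j] κ) (uc : ℕ → RandCtrl U) :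
    ∃ u', IsMixture Prod.fst π u' ∧
      (∀ ω, ∀ s ∈ Ico (π.t j) (π.t (j + 1)), u' s ω = (uc (κ ω)).1 s (ω j).1) ∧
      ∀ ω, ∀ s < π.t j, u' s ω = u s ω := by
  classical
  refine ⟨fun s ω => if s ∈ Ico (π.t j) (π.t (j + 1)) then (uc (κ ω)).1 s (ω j).1 else u s ω,
    ⟨?_, fun l hl => ?_⟩, fun ω s hs => if_pos hs, fun ω s hs => if_neg fun h => hs.not_ge h.1⟩
  · have h1 : Measurable fun q : ℕ × ℝ × I => (uc q.1).1 q.2.1 q.2.2 :=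
      measurable_from_prod_countable_right fun k => (uc k).2
    have h2 : Measurable fun q : ℝ × Omega => (κ q.2, q.1, (q.2 j).1) :=
      ((measurable_of_Fsig hκ).comp measurable_snd).prodMk (measurable_fst.prodMk
        (measurable_fst.comp ((measurable_pi_apply j).comp measurable_snd)))
    exact Measurable.ite (measurable_fst measurableSet_Ico) (h1.comp h2) hu.1
  · by_cases hlj : l = j
    · subst hlj
      exact ⟨κ, uc, hκ, fun ω s hs => if_pos hs⟩
    · obtain ⟨κ', uc', hκ', h⟩ := hu.2 l hl
      refine ⟨κ', uc', hκ', fun ω s hs => ?_⟩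
      rw [← h ω s hs]
      refine if_neg fun hs' => hlj ?_
      rw [← π.idx_eq hl hs, π.idx_eq hj hs']

/-- Against any strategy of the second player, the first player can get the value minus `ε`. -/
lemma exists_control_ge (hP : IsProductMeasure P) (hf : IsDynamics f C K) (hg : IsBddLip g M L)
    (hi : i < π.n) (x : EuclideanSpace ℝ (Fin d)) {ε : ℝ} (hε : 0 < ε)
    {β : (ℝ → Omega → U) → ℝ → Omega → V} (hβ : IsNAD2 U V P π (π.t i) β) :
    ∃ u, IsMixture Prod.fst π u ∧ ∀ A, MeasurableSet[Fsig i] A →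
      (gridVal f g π i x - ε) * P.real A ≤ ∫ ω in A, g (stateAt f π x u (β u) i π.n ω) ∂P := by
  have hn : (0 : ℝ) < π.n := by exact_mod_cast π.npos
  have hadm : ∀ {u}, IsMixture Prod.fst π u → IsMixture Prod.snd π (β u) := fun hu =>
    mem_admControl2_iff.1 (hβ.1 _ (mem_admControl1_iff.2 hu))
  have key : ∀ j, i ≤ j → j ≤ π.n → ∃ u, IsMixture Prod.fst π u ∧ ∀ A, MeasurableSet[Fsig i] A →
      (gridVal f g π i x - (j - i) * (ε / π.n)) * P.real A
        ≤ ∫ ω in A, gridVal f g π j (stateAt f π x u (β u) i j ω) ∂P := by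
    intro j hij
    induction j, hij using Nat.le_induction with
    | base =>
      intro _
      have hu : IsMixture Prod.fst π fun _ _ => Classical.arbitrary U := isMixture_const _
      refine ⟨_, hu, fun A hA => ?_⟩
      simp only [stateAt_self hf hu (hadm hu), setIntegral_const, smul_eq_mul, sub_self, zero_mul,
        sub_zero]
      rw [mul_comm]
    | succ j hij ih =>
      intro hj
      obtain ⟨u, hu, ih⟩ := ih (by omega)
      obtain ⟨κ, vc, hκ, hvc⟩ := (hadm hu).2 j hj
      obtain ⟨L', hL'⟩ := hf.exists_isBddLip_gridVal (π := π) hg (j := j + 1) hj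
      obtain ⟨L₀, hL₀⟩ := hf.exists_isBddLip_gridVal (π := π) hg (j := j) (by omega)
      obtain ⟨cell, us, hc, hsel⟩ := hf.exists_selection_ge hL' (π.mono j hj).le (div_pos hε hn) vc
      have hX := measurable_stateAt (x := x) hf hu (hadm hu) hij (show j ≤ π.n by omega)
      have hκ' : Measurable[Fsig j] fun ω => Nat.pair (κ ω) (cell (stateAt f π x u (β u) i j ω)) :=
        (measurable_of_countable fun q : ℕ × ℕ => Nat.pair q.1 q.2).comp (hκ.prodMk (hc.comp hX))
      obtain ⟨u', hu', huj, hult⟩ := hu.modify hj hκ' fun k => us k.unpair.1 k.unpair.2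
      refine ⟨u', hu', fun A hA => ?_⟩
      have hne : ∀ᵐ r : ℝ, r ≠ π.t j := by simp [ae_iff]
      have hae : aeEqIcc P (π.t i) (π.t j) u u' := by
        filter_upwards [Measure.quasiMeasurePreserving_fst.ae hne] with q hq hqI
        exact (hult _ _ (lt_of_le_of_ne hqI.2 hq)).symm
      have hβae := ae_ae_of_aeEqIcc (hβ.aeEqIcc (by omega) (mem_admControl1_iff.2 hu)
        (mem_admControl1_iff.2 hu') hae)
      have e1 : ∀ ω, stateAt f π x u' (β u) i j ω = stateAt f π x u (β u) i j ω := fun ω =>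
        stateAt_congr hf hu' (hadm hu) hu (hadm hu) hij (by omega)
          (hne.mono fun r hr hrI => hult _ _ (lt_of_le_of_ne hrI.2 hr)) (ae_of_all _ fun _ _ => rfl)
      have e2 : ∫ ω in A, gridVal f g π (j + 1) (stateAt f π x u' (β u') i (j + 1) ω) ∂P
          = ∫ ω in A, gridVal f g π (j + 1) (stateAt f π x u' (β u) i (j + 1) ω) ∂P := by
        refine setIntegral_congr_ae (Fsig_le i A hA) ?_
        filter_upwards [hβae] with ω hω _
        rw [stateAt_congr hf hu' (hadm hu) hu' (hadm hu') (by omega) hj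
          (ae_of_all _ fun _ _ => rfl) hω]
      obtain ⟨h1, h2⟩ := setIntegral_stateAt_succ (x := x) hP hf hL' hu' (hadm hu) hij hj hκ' hκ
        (uc := fun k : ℕ => us k.unpair.1 k.unpair.2) huj hvc
      rw [e2, h2 A (Fsig_mono hij A hA)]
      have hint := hf.integrable_stateAt (P := P) hL₀ hu (hadm hu) x hij (show j ≤ π.n by omega)
      have h3 : ∫ ω in A, (gridVal f g π j (stateAt f π x u (β u) i j ω) - ε / π.n) ∂P
          ≤ ∫ ω in A, stepPay f (π.t j) (π.t (j + 1)) (gridVal f g π (j + 1))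
            (stateAt f π x u' (β u) i j ω)
            ((fun k : ℕ => us k.unpair.1 k.unpair.2)
              (Nat.pair (κ ω) (cell (stateAt f π x u (β u) i j ω)))) (vc (κ ω)) ∂P := by
        refine setIntegral_mono (hint.sub (integrable_const _)).integrableOn h1.integrableOn
          fun ω => ?_
        simp only [Nat.unpair_pair, e1]
        rw [gridVal_of_lt hj]
        exact hsel _ _
      refine le_trans ?_ h3
      rw [integral_sub hint.integrableOn (integrable_const _).integrableOn, setIntegral_const,
        smul_eq_mul]
      have := ih A hA
      push_cast
      linarith
  obtain ⟨u, hu, h⟩ := key π.n hi.le le_rfl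
  refine ⟨u, hu, fun A hA => ?_⟩
  have h := h A hA
  rw [gridVal_last] at h
  refine le_trans (mul_le_mul_of_nonneg_right ?_ measureReal_nonneg) h
  have h1 : ((π.n : ℝ) - i) * (ε / π.n) ≤ π.n * (ε / π.n) :=
    mul_le_mul_of_nonneg_right (by linarith [(Nat.cast_nonneg i : (0 : ℝ) ≤ i)])
      (div_pos hε hn).le
  rw [mul_div_cancel₀ _ hn.ne'] at h1
  linarith

end Identification

/-! ### Identification of the upper value at grid points -/

section UpperValue

set_option linter.unusedSectionVars false

variable {d : ℕ} {U V : Type} [MetricSpace U] [CompactSpace U] [MetricSpace V] [CompactSpace V]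
  [MeasurableSpace U] [BorelSpace U] [MeasurableSpace V] [BorelSpace V] [Nonempty U] [Nonempty V]
  {f : ℝ → EuclideanSpace ℝ (Fin d) → U → V → EuclideanSpace ℝ (Fin d)} {C : ℝ} {K : ℝ≥0}
  {g : EuclideanSpace ℝ (Fin d) → ℝ} {M : ℝ} {L : ℝ≥0} {T : ℝ} {π : Partition T}
  {i : ℕ} {P : Measure Omega} [IsProbabilityMeasure P]
  {α : (ℝ → Omega → V) → ℝ → Omega → U} {β : (ℝ → Omega → U) → ℝ → Omega → V}

lemma payoff_eq (hf : IsDynamics f C K) (hi : i < π.n) (hα : IsNAD1 U V P π (π.t i) α)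
    (hβ : IsNAD2 U V P π (π.t i) β) (x : EuclideanSpace ℝ (Fin d)) :
    payoff f g P π (π.t i) x α β = fun ω => g (stateAt f π x (fixPair P π (π.t i) T α β).1
      (fixPair P π (π.t i) T α β).2 i π.n ω) := by
  obtain ⟨hu, hv, -, -⟩ := isFixPair_fixPair hi hα hβ
  funext ω
  simp only [payoff, solStrat, stateAt]
  rw [hf.sol_eq ((mem_admControl1_iff.1 hu).measurable_path ω)
    ((mem_admControl2_iff.1 hv).measurable_path ω) ⟨π.t_le_last hi.le, le_rfl⟩, π.map_last]

/-- The pay-off when the second player uses the strategy `β`. -/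
lemma payoff_ae_eq_response (hf : IsDynamics f C K) (hi : i < π.n)
    (hα : IsNAD1 U V P π (π.t i) α) (hβ : IsNAD2 U V P π (π.t i) β)
    (x : EuclideanSpace ℝ (Fin d)) :
    payoff f g P π (π.t i) x α β =ᵐ[P] fun ω => g (stateAt f π x
      (fixPair P π (π.t i) T α β).1 (β (fixPair P π (π.t i) T α β).1) i π.n ω) := by
  rw [payoff_eq hf hi hα hβ]
  obtain ⟨hu, hv, -, h⟩ := isFixPair_fixPair hi hα hβ
  have hu' := mem_admControl1_iff.1 hu
  filter_upwards [ae_ae_of_aeEqIcc h] with ω hω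
  rw [stateAt_congr hf hu' (mem_admControl2_iff.1 (hβ.1 _ hu)) hu' (mem_admControl2_iff.1 hv)
    hi.le le_rfl (ae_of_all _ fun _ _ => rfl) (by rwa [π.map_last])]

/-- The pay-off when the first player uses a control which does not react to the opponent. -/
lemma payoff_ae_eq_open_loop (hf : IsDynamics f C K) (hi : i < π.n) {u : ℝ → Omega → U}
    (hu : IsMixture Prod.fst π u) (hβ : IsNAD2 U V P π (π.t i) β)
    (x : EuclideanSpace ℝ (Fin d)) :
    payoff f g P π (π.t i) x (fun _ => u) β =ᵐ[P]
      fun ω => g (stateAt f π x u (β u) i π.n ω) := by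
  have hα := isNAD1_const (P := P) (t := π.t i) (B := V) (mem_admControl1_iff.2 hu)
  refine (payoff_ae_eq_response hf hi hα hβ x).trans ?_
  obtain ⟨hu', -, h, -⟩ := isFixPair_fixPair hi hα hβ
  have hn := π.npos
  have h2 := hβ.aeEqIcc (m := π.n - 1) (by omega) (mem_admControl1_iff.2 hu) hu'
    (h.mono (π.t_le_last (by omega)))
  rw [Nat.sub_add_cancel hn] at h2
  filter_upwards [ae_ae_of_aeEqIcc h, ae_ae_of_aeEqIcc h2] with ω hω hω2
  rw [stateAt_congr hf hu (mem_admControl2_iff.1 (hβ.1 _ (mem_admControl1_iff.2 hu)))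
    (mem_admControl1_iff.1 hu') (mem_admControl2_iff.1 (hβ.1 _ hu'))
    hi.le le_rfl (by rwa [π.map_last]) hω2]

lemma integrable_payoff (hf : IsDynamics f C K) (hg : IsBddLip g M L) (hi : i < π.n)
    (hα : IsNAD1 U V P π (π.t i) α) (hβ : IsNAD2 U V P π (π.t i) β)
    (x : EuclideanSpace ℝ (Fin d)) : Integrable (payoff f g P π (π.t i) x α β) P := by
  rw [payoff_eq hf hi hα hβ]
  obtain ⟨hu, hv, -, -⟩ := isFixPair_fixPair hi hα hβ
  exact hf.integrable_stateAt hg (mem_admControl1_iff.1 hu) (mem_admControl2_iff.1 hv) x hi.le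
    le_rfl

lemma exists_strategy_condExp_le (hP : IsProductMeasure P) (hf : IsDynamics f C K)
    (hg : IsBddLip g M L) (hi : i < π.n) (x : EuclideanSpace ℝ (Fin d)) {ε : ℝ} (hε : 0 < ε) :
    ∃ β, IsNAD2 U V P π (π.t i) β ∧ ∀ α, IsNAD1 U V P π (π.t i) α →
      P[payoff f g P π (π.t i) x α β | Fsig (π.idx (π.t i))]
        ≤ᵐ[P] fun _ => gridVal f g π i x + ε := by
  obtain ⟨cell, vs, hcell, h⟩ := exists_feedback_le hP hf hg hi x hε
  have hβ := isNAD2_feedback (P := P) (x := x) (vs := vs) hf hcell hi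
  refine ⟨_, hβ, fun α hα => ?_⟩
  rw [π.idx_t hi]
  refine condExp_le_of_forall_setIntegral_le (integrable_payoff hf hg hi hα hβ x) fun A hA => ?_
  rw [setIntegral_congr_ae (Fsig_le i A hA)
    ((payoff_ae_eq_response hf hi hα hβ x).mono fun ω hω _ => hω)]
  exact h _ (mem_admControl1_iff.1 (isFixPair_fixPair hi hα hβ).1) A hA

lemma exists_strategy_le_condExp (hP : IsProductMeasure P) (hf : IsDynamics f C K)
    (hg : IsBddLip g M L) (hi : i < π.n) (x : EuclideanSpace ℝ (Fin d)) {ε : ℝ} (hε : 0 < ε)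
    (hβ : IsNAD2 U V P π (π.t i) β) :
    ∃ α, IsNAD1 U V P π (π.t i) α ∧ (fun _ => gridVal f g π i x - ε) ≤ᵐ[P]
      P[payoff f g P π (π.t i) x α β | Fsig (π.idx (π.t i))] := by
  obtain ⟨u, hu, h⟩ := exists_control_ge hP hf hg hi x hε hβ
  have hα := isNAD1_const (P := P) (t := π.t i) (B := V) (mem_admControl1_iff.2 hu)
  refine ⟨_, hα, ?_⟩
  rw [π.idx_t hi]
  refine le_condExp_of_forall_le_setIntegral (integrable_payoff hf hg hi hα hβ x) fun A hA => ?_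
  rw [setIntegral_congr_ae (Fsig_le i A hA)
    ((payoff_ae_eq_open_loop hf hi hu hβ x).mono fun ω hω _ => hω)]
  exact h A hA

lemma ae_le_of_forall_pos {X Y : Omega → ℝ} (h : ∀ ε > 0, ∀ᵐ ω ∂P, X ω ≤ Y ω + ε) :
    X ≤ᵐ[P] Y := by
  have h1 : ∀ᵐ ω ∂P, ∀ k : ℕ, X ω ≤ Y ω + 1 / ((k : ℝ) + 1) :=
    ae_all_iff.2 fun k => h _ (by positivity)
  filter_upwards [h1] with ω hω
  refine le_of_forall_pos_le_add fun ε hε => ?_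
  obtain ⟨k, hk⟩ := exists_nat_one_div_lt hε
  exact (hω k).trans (by linarith)

/-- At grid points the upper value is given by the backward recursion. -/
theorem upperValD_eq_gridVal (hP : IsProductMeasure P) (hf : IsDynamics f C K)
    (hg : IsBddLip g M L) (hi : i < π.n) (x : EuclideanSpace ℝ (Fin d)) :
    upperValD U V f g P π (π.t i) x = gridVal f g π i x := by
  set w := gridVal f g π i x
  have hα₀ := isNAD1_const (P := P) (t := π.t i) (B := V) (π := π)
    (mem_admControl1_iff.2 (isMixture_const (Classical.arbitrary U)))
  have : Nonempty {α // IsNAD1 U V P π (π.t i) α} := ⟨⟨_, hα₀⟩⟩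
  have hsup : ∀ β : {β // IsNAD2 U V P π (π.t i) β}, ∃ S, IsEssSupFam P
      (fun α : {α // IsNAD1 U V P π (π.t i) α} =>
        P[payoff f g P π (π.t i) x α.1 β.1 | Fsig (π.idx (π.t i))]) S := fun β =>
    exists_isEssSupFam (M := M)
      (fun α => (stronglyMeasurable_condExp.mono (Fsig_le _)).measurable.aemeasurable)
      fun α => ae_bdd_abs_condExp_of_ae_bdd_abs (ae_of_all _ fun ω => hg.bdd _)
  have hlow : ∀ β : {β // IsNAD2 U V P π (π.t i) β}, ∀ S, IsEssSupFam P
      (fun α : {α // IsNAD1 U V P π (π.t i) α} =>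
        P[payoff f g P π (π.t i) x α.1 β.1 | Fsig (π.idx (π.t i))]) S → (fun _ => w) ≤ᵐ[P] S := by
    intro β S hS
    refine ae_le_of_forall_pos fun ε hε => ?_
    obtain ⟨α, hα, h⟩ := exists_strategy_le_condExp hP hf hg hi x hε β.2
    filter_upwards [h, hS.1 ⟨α, hα⟩] with ω h1 h2
    linarith
  have hup : ∀ ε > 0, ∃ β : {β // IsNAD2 U V P π (π.t i) β}, ∀ S, IsEssSupFam P
      (fun α : {α // IsNAD1 U V P π (π.t i) α} =>
        P[payoff f g P π (π.t i) x α.1 β.1 | Fsig (π.idx (π.t i))]) S →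
          S ≤ᵐ[P] fun _ => w + ε := by
    intro ε hε
    obtain ⟨β, hβ, h⟩ := exists_strategy_condExp_le hP hf hg hi x hε
    exact ⟨⟨β, hβ⟩, fun S hS => hS.2 _ fun α => h α.1 α.2⟩
  have huniq : ∀ S, IsUpperVal U V f g P π (π.t i) x S → S =ᵐ[P] fun _ => w := by
    rintro S ⟨J, hJ, hS⟩
    refine EventuallyLE.antisymm (ae_le_of_forall_pos fun ε hε => ?_)
      (hS.2 _ fun β => hlow β _ (hJ β))
    obtain ⟨β, h⟩ := hup ε hε
    exact (hS.1 β).trans (h _ (hJ β))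
  have hex : IsUpperVal U V f g P π (π.t i) x fun _ => w := by
    choose J hJ using hsup
    refine ⟨J, hJ, fun β => hlow β _ (hJ β), fun W hW => ae_le_of_forall_pos fun ε hε => ?_⟩
    obtain ⟨β, h⟩ := hup ε hε
    exact (hW β).trans (h _ (hJ β))
  have h := integral_congr_ae (huniq _ (Classical.epsilon_spec
    (p := IsUpperVal U V f g P π (π.t i) x) ⟨_, hex⟩))
  unfold upperValD upperVal
  rw [h]
  simp

end UpperValue

/-! ### Optimal mixed actions in the Hamiltonian -/

section Minimax

set_option linter.unusedSectionVars false

variable {U V : Type} [MetricSpace U] [CompactSpace U] [MetricSpace V] [CompactSpace V]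
  [MeasurableSpace U] [BorelSpace U] [MeasurableSpace V] [BorelSpace V] [Nonempty U] [Nonempty V]
  {G : U → V → ℝ} {B : ℝ}

/-- The value `sup_μ inf_ν` of the mixed extension of the game with pay-off `G`. -/
def mixVal (G : U → V → ℝ) : ℝ :=
  ⨆ μ : ProbabilityMeasure U, ⨅ ν : ProbabilityMeasure V,
    ∫ u, ∫ v, G u v ∂(ν : Measure V) ∂(μ : Measure U)

lemma abs_integral_le_of_bdd {X : Type*} [MeasurableSpace X] {μ : Measure X}
    [IsProbabilityMeasure μ] {h : X → ℝ} (hb : ∀ x, |h x| ≤ B) : |∫ x, h x ∂μ| ≤ B := by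
  have := norm_integral_le_of_norm_le_const (μ := μ) (f := h) (C := B)
    (ae_of_all _ fun x => by simpa using hb x)
  simpa using this

lemma integrable_of_continuous_of_bdd {X : Type*} [TopologicalSpace X] [MeasurableSpace X]
    [OpensMeasurableSpace X] {μ : Measure X} [IsFiniteMeasure μ] {h : X → ℝ} (hc : Continuous h)
    (hb : ∀ x, |h x| ≤ B) : Integrable h μ :=
  Integrable.of_bound hc.measurable.aestronglyMeasurable B (ae_of_all _ hb)

lemma bddBelow_range_mix (hb : ∀ u v, |G u v| ≤ B) (μ : ProbabilityMeasure U) :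
    BddBelow (range fun ν : ProbabilityMeasure V =>
      ∫ u, ∫ v, G u v ∂(ν : Measure V) ∂(μ : Measure U)) :=
  ⟨-B, by
    rintro _ ⟨ν, rfl⟩
    exact (abs_le.1 (abs_integral_le_of_bdd fun u => abs_integral_le_of_bdd fun v => hb u v)).1⟩

lemma bddAbove_range_mix (hb : ∀ u v, |G u v| ≤ B) :
    BddAbove (range fun μ : ProbabilityMeasure U => ⨅ ν : ProbabilityMeasure V,
      ∫ u, ∫ v, G u v ∂(ν : Measure V) ∂(μ : Measure U)) :=
  ⟨B, by
    rintro _ ⟨μ, rfl⟩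
    exact (ciInf_le (bddBelow_range_mix hb μ) (diracProba (Classical.arbitrary V))).trans
      (abs_le.1 (abs_integral_le_of_bdd fun u => abs_integral_le_of_bdd fun v => hb u v)).2⟩

/-- A nearly optimal mixed action of the maximising player. -/
lemma exists_mixVal_sub_le (hb : ∀ u v, |G u v| ≤ B)
    {θ : ℝ} (hθ : 0 < θ) :
    ∃ μ : ProbabilityMeasure U, ∀ v, mixVal G - θ ≤ ∫ u, G u v ∂(μ : Measure U) := by
  have : Nonempty (ProbabilityMeasure U) :=
    ⟨diracProba (Classical.arbitrary U)⟩
  obtain ⟨μ, hμ⟩ := exists_lt_of_lt_ciSup (sub_lt_self (mixVal G) hθ)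
  refine ⟨μ, fun v => hμ.le.trans ((ciInf_le (bddBelow_range_mix hb μ)
    (diracProba v)).trans_eq ?_)⟩
  simp [diracProba]

/-- A finite net of actions, uniformly in the opponent's action. -/
lemma exists_finset_net (hG : Continuous (Function.uncurry G)) {ε : ℝ} (hε : 0 < ε) :
    ∃ s : Finset V, ∀ v, ∃ w ∈ s, ∀ u, |G u v - G u w| < ε := by
  have h1 := Continuous.tendstoUniformly (fun (v : V) (u : U) => G u v)
    (hG.comp continuous_swap)
  have h2 : ∀ w : V, {v | ∀ u, |G u v - G u w| < ε} ∈ 𝓝 w := fun w => by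
    filter_upwards [Metric.tendstoUniformly_iff.1 (h1 w) ε hε] with v hv u
    have := hv u
    rwa [dist_comm, Real.dist_eq] at this
  obtain ⟨s, hs⟩ := CompactSpace.elim_nhds_subcover _ h2
  refine ⟨s, fun v => ?_⟩
  have : v ∈ (⊤ : Set V) := trivial
  rw [← hs] at this
  simpa using this

/-- A nearly optimal mixed action of the minimising player, by separation of convex sets. -/
lemma exists_le_mixVal_add (hG : Continuous (Function.uncurry G)) (hb : ∀ u v, |G u v| ≤ B)
    {θ : ℝ} (hθ : 0 < θ) :
    ∃ ν : ProbabilityMeasure V, ∀ u, ∫ v, G u v ∂(ν : Measure V) ≤ mixVal G + θ := by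
  classical
  have hGu : ∀ u, Continuous (G u) := fun u => hG.comp (Continuous.prodMk_right u)
  have hGv : ∀ v, Continuous fun u => G u v := fun v => hG.comp (Continuous.prodMk_left v)
  set c := mixVal G + θ
  obtain ⟨s, hs⟩ := exists_finset_net hG (half_pos hθ)
  let S : Set (s → ℝ) := {k | ∀ w, c < k w}
  let R : Set (s → ℝ) := range fun (μ : ProbabilityMeasure U) (w : s) =>
    ∫ u, G u w ∂(μ : Measure U)
  have hSo : IsOpen S := by
    have : S = ⋂ w, {k | c < k w} := by ext; simp [S]
    rw [this]
    exact isOpen_iInter_of_finite fun w => isOpen_lt continuous_const (continuous_apply w)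
  have hSc : Convex ℝ S := by
    have : S = Set.pi univ fun _ => Ioi c := by ext; simp [S]
    rw [this]
    exact convex_pi fun _ _ => convex_Ioi c
  have hRc : Convex ℝ R := by
    rintro _ ⟨μ, rfl⟩ _ ⟨μ', rfl⟩ a b ha hb' hab
    refine ⟨⟨ENNReal.ofReal a • (μ : Measure U) + ENNReal.ofReal b • (μ' : Measure U), ⟨?_⟩⟩, ?_⟩
    · simp [← ENNReal.ofReal_add ha hb', hab]
    · funext w
      have hi : ∀ μ : ProbabilityMeasure U, Integrable (fun u => G u w) (μ : Measure U) := fun μ =>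
        integrable_of_continuous_of_bdd (hGv w) fun u => hb u w
      simp only [ProbabilityMeasure.coe_mk, Pi.add_apply, Pi.smul_apply, smul_eq_mul]
      rw [integral_add_measure ((hi μ).smul_measure ENNReal.ofReal_ne_top)
        ((hi μ').smul_measure ENNReal.ofReal_ne_top), integral_smul_measure, integral_smul_measure]
      simp [ENNReal.toReal_ofReal, ha, hb']
  have hdisj : Disjoint S R := by
    rw [Set.disjoint_left]
    rintro _ hk ⟨μ, rfl⟩
    have h1 : c - θ / 2 ≤ mixVal G := by
      refine le_trans ?_ (le_ciSup (bddAbove_range_mix hb) μ)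
      have : Nonempty (ProbabilityMeasure V) :=
        ⟨diracProba (Classical.arbitrary V)⟩
      refine le_ciInf fun ν => ?_
      have hsw : ∫ u, ∫ v, G u v ∂(ν : Measure V) ∂(μ : Measure U)
          = ∫ v, ∫ u, G u v ∂(μ : Measure U) ∂(ν : Measure V) :=
        integral_integral_swap (integrable_of_continuous_of_bdd hG fun q => hb q.1 q.2)
      rw [hsw]
      have hpt : ∀ v, c - θ / 2 ≤ ∫ u, G u v ∂(μ : Measure U) := fun v => by
        obtain ⟨w, hw, h⟩ := hs v
        have h2 : ∫ u, (G u w - θ / 2) ∂(μ : Measure U) ≤ ∫ u, G u v ∂(μ : Measure U) :=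
          integral_mono ((integrable_of_continuous_of_bdd (hGv w) fun u => hb u w).sub
            (integrable_const _)) (integrable_of_continuous_of_bdd (hGv v) fun u => hb u v)
            fun u => by linarith [(abs_lt.1 (h u)).1]
        rw [integral_sub (integrable_of_continuous_of_bdd (hGv w) fun u => hb u w)
          (integrable_const _)] at h2
        have h3 : c < ∫ u, G u w ∂(μ : Measure U) := hk ⟨w, hw⟩
        simp only [integral_const, probReal_univ, smul_eq_mul, one_mul] at h2
        linarith
      have hint : Integrable (fun v => ∫ u, G u v ∂(μ : Measure U)) (ν : Measure V) :=
        (integrable_of_continuous_of_bdd (μ := (μ : Measure U).prod (ν : Measure V)) hG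
          fun q => hb q.1 q.2).integral_prod_right
      have h4 := integral_mono (integrable_const (c - θ / 2)) hint hpt
      simpa using h4
    linarith
  obtain ⟨l, t, hl, hr⟩ := geometric_hahn_banach_open hSc hSo hRc hdisj
  let lam : s → ℝ := fun w => -l (Pi.single w 1)
  have hlk : ∀ k : s → ℝ, l k = -∑ w, lam w * k w := fun k => by
    conv_lhs => rw [← Finset.univ_sum_single k, map_sum]
    rw [← Finset.sum_neg_distrib]
    refine Finset.sum_congr rfl fun w _ => ?_
    have : Pi.single w (k w) = k w • (Pi.single w 1 : s → ℝ) := by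
      rw [← Pi.single_smul, smul_eq_mul, mul_one]
    rw [this, map_smul, smul_eq_mul]
    simp only [lam]
    ring
  have hlam : ∀ w, 0 ≤ lam w := fun w => by
    by_contra hneg
    rw [not_le] at hneg
    have hk : ∀ r : ℝ, 0 ≤ r → (fun w' => c + 1 + Pi.single (M := fun _ => ℝ) w r w') ∈ S :=
      fun r hr0 w' => by
        have : 0 ≤ Pi.single (M := fun _ => ℝ) w r w' := by
          by_cases h : w' = w
          · subst h; simpa using hr0
          · simp [h]
        linarith
    have h1 : ∀ r : ℝ, 0 ≤ r → -(∑ w', lam w' * (c + 1)) - lam w * r < t := fun r hr0 => by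
      have := hl _ (hk r hr0)
      rw [hlk] at this
      simp only [mul_add, Finset.sum_add_distrib, Pi.single_apply, mul_ite, mul_zero,
        Finset.sum_ite_eq', Finset.mem_univ, if_true] at this ⊢
      linarith
    set D := -(∑ w', lam w' * (c + 1))
    have h2 := h1 (max 0 ((t - D) / (-lam w))) (le_max_left _ _)
    have h3 : (t - D) ≤ -lam w * max 0 ((t - D) / (-lam w)) := by
      have := mul_le_mul_of_nonneg_left (le_max_right 0 ((t - D) / (-lam w)))
        (show 0 ≤ -lam w by linarith)
      rwa [mul_div_cancel₀ _ (by linarith : -lam w ≠ 0)] at this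
    linarith
  set Λ := ∑ w, lam w with hΛ
  have ht : -(c * Λ) ≤ t := by
    refine le_of_forall_pos_le_add fun ε hε => ?_
    have hΛ0 : 0 ≤ Λ := Finset.sum_nonneg fun w _ => hlam w
    have h1 := hl (fun _ => c + ε / (Λ + 1)) fun w => by
      have : 0 < ε / (Λ + 1) := by positivity
      linarith
    rw [hlk, ← Finset.sum_mul] at h1
    have h2 : Λ * (ε / (Λ + 1)) ≤ ε := by
      rw [mul_div_assoc', div_le_iff₀ (by positivity)]
      nlinarith
    nlinarith
  have hpay : ∀ u, ∑ w, lam w * G u w ≤ c * Λ := fun u => by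
    have h1 := hr _ ⟨diracProba u, rfl⟩
    rw [hlk] at h1
    simp only [diracProba, ProbabilityMeasure.coe_mk, integral_dirac] at h1
    linarith
  have hΛpos : 0 < Λ := by
    refine lt_of_le_of_ne (Finset.sum_nonneg fun w _ => hlam w) fun h0 => ?_
    have hz : ∀ w, lam w = 0 := fun w =>
      (Finset.sum_eq_zero_iff_of_nonneg fun w _ => hlam w).1 h0.symm w (Finset.mem_univ w)
    have h1 := hl (fun _ => c + 1) fun _ => by simp
    have h2 := hr _ ⟨diracProba (Classical.arbitrary U), rfl⟩
    rw [hlk] at h1 h2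
    simp only [hz, zero_mul, Finset.sum_const_zero, neg_zero] at h1 h2
    linarith
  let ν : Measure V := ∑ w : s, ENNReal.ofReal (lam w / Λ) • Measure.dirac (w : V)
  have hν : IsProbabilityMeasure ν := ⟨by
    have h0 : ∀ w ∈ (Finset.univ : Finset s), 0 ≤ lam w / Λ := fun w _ =>
      div_nonneg (hlam w) hΛpos.le
    simp only [ν, Measure.coe_finsetSum, Finset.sum_apply, Measure.smul_apply, measure_univ,
      smul_eq_mul, mul_one]
    rw [← ENNReal.ofReal_sum_of_nonneg h0, ← Finset.sum_div, div_self hΛpos.ne',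
      ENNReal.ofReal_one]⟩
  refine ⟨⟨ν, hν⟩, fun u => ?_⟩
  have e : ∫ v, G u v ∂ν = (∑ w, lam w * G u w) / Λ := by
    simp only [ν]
    rw [integral_finsetSum_measure fun w _ => (integrable_of_continuous_of_bdd (hGu u)
      (hb u)).smul_measure ENNReal.ofReal_ne_top, Finset.sum_div]
    refine Finset.sum_congr rfl fun w _ => ?_
    rw [integral_smul_measure, integral_dirac, ENNReal.toReal_ofReal (div_nonneg (hlam w) hΛpos.le),
      smul_eq_mul]
    ring
  simp only [ProbabilityMeasure.coe_mk]
  rw [e, div_le_iff₀ hΛpos]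
  exact hpay u

/-- A mixed action is the law of a randomised action depending on a uniform seed. -/
lemma exists_randCtrl_integral_eq (ν : ProbabilityMeasure V) : ∃ χ : I → V, Measurable χ ∧
    ∀ h : V → ℝ, Continuous h → ∫ ζ : I, h (χ ζ) = ∫ v, h v ∂(ν : Measure V) := by
  obtain ⟨χ, hχ, e⟩ := Measure.exists_measurable_map_eq (ν : Measure V)
  refine ⟨χ, hχ, fun h hh => ?_⟩
  rw [← e, integral_map hχ.aemeasurable hh.measurable.aestronglyMeasurable]

end Minimax

/-! ### First-order expansion along trajectories -/

section Expansion

set_option linter.unusedSectionVars false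

variable {d : ℕ} {U V : Type} [MetricSpace U] [CompactSpace U] [MetricSpace V] [CompactSpace V]
  [MeasurableSpace U] [BorelSpace U] [MeasurableSpace V] [BorelSpace V]
  {f : ℝ → EuclideanSpace ℝ (Fin d) → U → V → EuclideanSpace ℝ (Fin d)} {C : ℝ} {K : ℝ≥0}
  {φ : ℝ → EuclideanSpace ℝ (Fin d) → ℝ} {D : ℝ × EuclideanSpace ℝ (Fin d) →L[ℝ] ℝ}
  {t₀ : ℝ} {x₀ : EuclideanSpace ℝ (Fin d)}

/-- Continuity of the dynamics at a point, uniformly in the controls. -/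
lemma IsDynamics.exists_norm_sub_lt (hf : IsDynamics f C K) (t₀ : ℝ)
    (x₀ : EuclideanSpace ℝ (Fin d)) {η : ℝ} (hη : 0 < η) : ∃ δ > 0, ∀ r y, |r - t₀| < δ →
      ‖y - x₀‖ < δ → ∀ u v, ‖f r y u v - f t₀ x₀ u v‖ < η := by
  have h := Continuous.tendstoUniformly
    (fun (q : ℝ × EuclideanSpace ℝ (Fin d)) (w : U × V) => f q.1 q.2 w.1 w.2)
    (hf.cont.comp (by fun_prop :
      Continuous fun p : (ℝ × EuclideanSpace ℝ (Fin d)) × U × V => (p.1.1, p.1.2, p.2.1, p.2.2)))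
  obtain ⟨δ, hδ, h⟩ := Metric.eventually_nhds_iff.1
    (Metric.tendstoUniformly_iff.1 (h (t₀, x₀)) η hη)
  refine ⟨δ, hδ, fun r y hr hy u v => ?_⟩
  have := h (y := (r, y)) (by
    rw [Prod.dist_eq, max_lt_iff, Real.dist_eq, dist_eq_norm]; exact ⟨hr, hy⟩) (u, v)
  rwa [dist_comm, dist_eq_norm] at this

lemma IsDynamics.nonneg [Nonempty U] [Nonempty V] (hf : IsDynamics f C K) : 0 ≤ C :=
  (norm_nonneg _).trans (hf.bdd 0 0 (Classical.arbitrary U) (Classical.arbitrary V))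

lemma _root_.ContinuousLinearMap.apply_prod_real {E : Type*} [NormedAddCommGroup E]
    [NormedSpace ℝ E] (D : ℝ × E →L[ℝ] ℝ) (r : ℝ) (y : E) :
    D (r, y) = r * D (1, 0) + D.comp (ContinuousLinearMap.inr ℝ ℝ E) y := by
  have : ((r, y) : ℝ × E) = r • (1, 0) + (0, y) := by simp
  rw [this, map_add, map_smul]
  simp

/-- The increment of a differentiable function along a short trajectory. -/
lemma IsDynamics.exists_expansion [Nonempty U] [Nonempty V] (hf : IsDynamics f C K)
    (hφ : HasStrictFDerivAt (fun q : ℝ × EuclideanSpace ℝ (Fin d) => φ q.1 q.2) D (t₀, x₀))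
    {η : ℝ} (hη : 0 < η) : ∃ δ > 0, ∀ a b x, a ≤ b → |a - t₀| < δ → |b - t₀| < δ → ‖x - x₀‖ < δ →
      ∀ (u : ℝ → U) (v : ℝ → V), Measurable u → Measurable v →
        |φ b (stepFlow f a b x u v) - φ a x - ∫ r in a..b, D (1, f t₀ x₀ (u r) (v r))|
          ≤ η * (b - a) := by
  have hC := hf.nonneg
  set ℓ := D.comp (ContinuousLinearMap.inr ℝ ℝ (EuclideanSpace ℝ (Fin d))) with hℓ
  have h1 := hφ.isLittleO.def (show 0 < η / (2 * (1 + C)) by positivity)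
  obtain ⟨δ₁, hδ₁, h1⟩ := Metric.eventually_nhds_iff.1 h1
  obtain ⟨δ₂, hδ₂, h2⟩ := hf.exists_norm_sub_lt t₀ x₀ (show 0 < η / (2 * (‖ℓ‖ + 1)) by positivity)
  set δ := min δ₁ δ₂ / (1 + 2 * C) with hδ
  have hδ0 : 0 < δ := by positivity
  have hδm : (1 + 2 * C) * δ = min δ₁ δ₂ := by rw [hδ]; field_simp
  have hδle : δ ≤ min δ₁ δ₂ := by nlinarith
  refine ⟨δ, hδ0, fun a b x hab ha hb hx u v hu hv => ?_⟩
  set X : ℝ → EuclideanSpace ℝ (Fin d) := fun s => stepFlow f a s x u v with hX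
  have hsol := hf.isCaraSol hu hv a b x
  have hba : b - a < 2 * δ := by
    have := abs_lt.1 ha
    have := abs_lt.1 hb
    linarith
  have hXr : ∀ r ∈ Icc a b, ‖X r - x‖ ≤ C * (b - a) := fun r hr =>
    (hf.norm_stepFlow_sub_init_le hu hv hr.1 x).trans
      (mul_le_mul_of_nonneg_left (by linarith [hr.2]) hC)
  have hX0 : ∀ r ∈ Icc a b, ‖X r - x₀‖ < min δ₁ δ₂ := fun r hr => by
    have e : X r - x₀ = (X r - x) + (x - x₀) := by abel
    have := norm_add_le (X r - x) (x - x₀)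
    rw [← e] at this
    have := hXr r hr
    have : C * (b - a) ≤ C * (2 * δ) := mul_le_mul_of_nonneg_left hba.le hC
    linarith
  have hr0 : ∀ r ∈ Icc a b, |r - t₀| < min δ₁ δ₂ := fun r hr =>
    lt_of_lt_of_le (abs_lt.2 ⟨by linarith [(abs_lt.1 ha).1, hr.1],
      by linarith [(abs_lt.1 hb).2, hr.2]⟩) hδle
  have hbm : b ∈ Icc a b := ⟨hab, le_rfl⟩
  have e1 : |φ b (X b) - φ a x - D (b - a, X b - x)| ≤ η / 2 * (b - a) := by
    have := h1 (y := ((b, X b), (a, x))) (by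
      simp only [dist_eq_norm, Prod.mk_sub_mk, Prod.norm_mk, max_lt_iff, Real.norm_eq_abs]
      exact ⟨⟨(hr0 b hbm).trans_le (min_le_left _ _), (hX0 b hbm).trans_le (min_le_left _ _)⟩,
        (hr0 a ⟨le_rfl, hab⟩).trans_le (min_le_left _ _),
        hx.trans_le (hδle.trans (min_le_left _ _))⟩)
    refine this.trans ?_
    have hn : ‖((b, X b) : ℝ × EuclideanSpace ℝ (Fin d)) - (a, x)‖ ≤ (1 + C) * (b - a) := by
      simp only [Prod.mk_sub_mk, Prod.norm_mk, Real.norm_eq_abs, abs_of_nonneg (sub_nonneg.2 hab)]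
      refine max_le ?_ ((hXr b hbm).trans ?_) <;> nlinarith
    calc _ ≤ η / (2 * (1 + C)) * ((1 + C) * (b - a)) :=
          mul_le_mul_of_nonneg_left hn (by positivity)
      _ = _ := by field_simp
  have i1 : IntervalIntegrable (fun r => f r (X r) (u r) (v r)) volume a b :=
    (hf.isCaraField hu hv).intervalIntegrable_of_continuousOn hsol.1 hbm
  have i2 : IntervalIntegrable (fun r => f t₀ x₀ (u r) (v r)) volume a b := by
    refine (intervalIntegrable_const (c := C)).mono_fun' ?_ (ae_of_all _ fun r => hf.bdd _ _ _ _)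
    exact (hf.cont.measurable.comp (measurable_const.prodMk (measurable_const.prodMk
      (hu.prodMk hv)))).aestronglyMeasurable
  have i1' : IntervalIntegrable (fun r => ℓ (f r (X r) (u r) (v r))) volume a b :=
    ⟨ℓ.integrable_comp i1.1, ℓ.integrable_comp i1.2⟩
  have i2' : IntervalIntegrable (fun r => ℓ (f t₀ x₀ (u r) (v r))) volume a b :=
    ⟨ℓ.integrable_comp i2.1, ℓ.integrable_comp i2.2⟩
  have e2 : D (b - a, X b - x) - ∫ r in a..b, D (1, f t₀ x₀ (u r) (v r))
      = ∫ r in a..b, (ℓ (f r (X r) (u r) (v r)) - ℓ (f t₀ x₀ (u r) (v r))) := by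
    have : X b - x = ∫ r in a..b, f r (X r) (u r) (v r) := by
      rw [hX]; exact sub_eq_of_eq_add' (hsol.2 b hbm)
    rw [D.apply_prod_real, this, ← hℓ, ← ContinuousLinearMap.intervalIntegral_comp_comm _ i1,
      intervalIntegral.integral_sub i1' i2']
    have : ∫ r in a..b, D (1, f t₀ x₀ (u r) (v r))
        = (b - a) * D (1, 0) + ∫ r in a..b, ℓ (f t₀ x₀ (u r) (v r)) := by
      have : ∀ r, D (1, f t₀ x₀ (u r) (v r)) = D (1, 0) + ℓ (f t₀ x₀ (u r) (v r)) := fun r => by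
        rw [D.apply_prod_real, one_mul]
      rw [intervalIntegral.integral_congr fun r _ => this r,
        intervalIntegral.integral_add intervalIntegrable_const i2']
      simp
    rw [this]
    ring
  have e3 : |∫ r in a..b, (ℓ (f r (X r) (u r) (v r)) - ℓ (f t₀ x₀ (u r) (v r)))|
      ≤ η / 2 * (b - a) := by
    have := intervalIntegral.norm_integral_le_of_norm_le_const (a := a) (b := b) (C := η / 2)
      (f := fun r => ℓ (f r (X r) (u r) (v r)) - ℓ (f t₀ x₀ (u r) (v r))) fun r hr => by
        rw [uIoc_of_le hab] at hr
        have hr' : r ∈ Icc a b := ⟨hr.1.le, hr.2⟩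
        rw [← map_sub]
        refine (ℓ.le_opNorm _).trans ?_
        have := (h2 r (X r) ((hr0 r hr').trans_le (min_le_right _ _))
          ((hX0 r hr').trans_le (min_le_right _ _)) (u r) (v r)).le
        calc _ ≤ ‖ℓ‖ * (η / (2 * (‖ℓ‖ + 1))) := mul_le_mul_of_nonneg_left this (norm_nonneg _)
          _ ≤ (‖ℓ‖ + 1) * (η / (2 * (‖ℓ‖ + 1))) := by gcongr; linarith
          _ = η / 2 := by field_simp
    rwa [Real.norm_eq_abs, abs_of_nonneg (sub_nonneg.2 hab)] at this
  rw [← e2] at e3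
  rw [abs_le] at e1 e3 ⊢
  constructor <;> linarith [e1.1, e1.2, e3.1, e3.2]

end Expansion

/-! ### Expansion of the one-step values -/

section StepExpansion

set_option linter.unusedSectionVars false

lemma integral_seed_swap {Z : Type*} [MeasurableSpace Z] {μ : Measure Z} [IsProbabilityMeasure μ]
    {h : ℝ → Z → ℝ} {B a b : ℝ} (hm : Measurable (Function.uncurry h)) (hb : ∀ r ζ, |h r ζ| ≤ B)
    (hab : a ≤ b) : Integrable (fun ζ => ∫ r in a..b, h r ζ) μ ∧
      ∫ ζ, (∫ r in a..b, h r ζ) ∂μ = ∫ r in a..b, ∫ ζ, h r ζ ∂μ ∧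
      IntervalIntegrable (fun r => ∫ ζ, h r ζ ∂μ) volume a b := by
  have hi : Integrable (Function.uncurry h) ((volume.restrict (Ioc a b)).prod μ) :=
    Integrable.of_bound hm.aestronglyMeasurable B (ae_of_all _ fun q => hb q.1 q.2)
  simp_rw [intervalIntegral.integral_of_le hab]
  refine ⟨hi.integral_prod_right, (integral_integral_swap hi).symm, ?_⟩
  rw [intervalIntegrable_iff_integrableOn_Ioc_of_le hab]
  exact hi.integral_prod_left

variable {d : ℕ} {U V : Type} [MetricSpace U] [CompactSpace U] [MetricSpace V] [CompactSpace V]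
  [MeasurableSpace U] [BorelSpace U] [MeasurableSpace V] [BorelSpace V] [Nonempty U] [Nonempty V]
  {f : ℝ → EuclideanSpace ℝ (Fin d) → U → V → EuclideanSpace ℝ (Fin d)} {C : ℝ} {K : ℝ≥0}
  {φ : ℝ → EuclideanSpace ℝ (Fin d) → ℝ} {D : ℝ × EuclideanSpace ℝ (Fin d) →L[ℝ] ℝ}
  {t₀ : ℝ} {x₀ : EuclideanSpace ℝ (Fin d)}

/-- The instantaneous pay-off of the test function with derivative `D`. -/
def rate (f : ℝ → EuclideanSpace ℝ (Fin d) → U → V → EuclideanSpace ℝ (Fin d)) (t₀ : ℝ)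
    (x₀ : EuclideanSpace ℝ (Fin d)) (D : ℝ × EuclideanSpace ℝ (Fin d) →L[ℝ] ℝ) (u : U) (v : V) : ℝ :=
  D (1, f t₀ x₀ u v)

lemma IsDynamics.continuous_rate (hf : IsDynamics f C K) (t₀ : ℝ)
    (x₀ : EuclideanSpace ℝ (Fin d)) (D : ℝ × EuclideanSpace ℝ (Fin d) →L[ℝ] ℝ) :
    Continuous (Function.uncurry (rate f t₀ x₀ D)) :=
  D.continuous.comp (continuous_const.prodMk (hf.cont.comp (by fun_prop :
    Continuous fun p : U × V => (t₀, x₀, p.1, p.2))))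

lemma IsDynamics.abs_rate_le (hf : IsDynamics f C K) (t₀ : ℝ)
    (x₀ : EuclideanSpace ℝ (Fin d)) (D : ℝ × EuclideanSpace ℝ (Fin d) →L[ℝ] ℝ) (u : U) (v : V) :
    |rate f t₀ x₀ D u v| ≤ ‖D‖ * max 1 C := by
  refine (D.le_opNorm _).trans (mul_le_mul_of_nonneg_left ?_ (norm_nonneg _))
  rw [Prod.norm_mk, norm_one]
  exact max_le_max le_rfl (hf.bdd _ _ _ _)

lemma IsDynamics.measurable_rate_seed (hf : IsDynamics f C K) (t₀ : ℝ)
    (x₀ : EuclideanSpace ℝ (Fin d)) (D : ℝ × EuclideanSpace ℝ (Fin d) →L[ℝ] ℝ) (u : RandCtrl U)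
    (v : RandCtrl V) : Measurable (Function.uncurry fun (r : ℝ) (ζ : I × I) =>
      rate f t₀ x₀ D (u.1 r ζ.1) (v.1 r ζ.2)) := by
  have h1 : Measurable fun q : ℝ × I × I => (q.1, q.2.1) := by fun_prop
  have h2 : Measurable fun q : ℝ × I × I => (q.1, q.2.2) := by fun_prop
  exact (hf.continuous_rate t₀ x₀ D).measurable.comp ((u.2.comp h1).prodMk (v.2.comp h2))

/-- The expected increment of the test function against a given mean rate. -/
lemma IsDynamics.exists_step_expansion (hf : IsDynamics f C K)
    (hφ : HasStrictFDerivAt (fun q : ℝ × EuclideanSpace ℝ (Fin d) => φ q.1 q.2) D (t₀, x₀))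
    {η : ℝ} (hη : 0 < η) : ∃ δ > 0, ∀ a b x, a ≤ b → |a - t₀| < δ → |b - t₀| < δ → ‖x - x₀‖ < δ →
      ∀ (w : EuclideanSpace ℝ (Fin d) → ℝ) (M : ℝ) (L : ℝ≥0) (m c : ℝ), IsBddLip w M L →
      ∀ (u : RandCtrl U) (v : RandCtrl V),
      ((∀ y ∈ Metric.closedBall x (C * (b - a)), w y ≤ φ b y + m) →
        (∀ r, ∫ ζ : I × I, rate f t₀ x₀ D (u.1 r ζ.1) (v.1 r ζ.2) ≤ c) →
        stepPay f a b w x u v ≤ φ a x + m + (b - a) * (c + η)) ∧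
      ((∀ y ∈ Metric.closedBall x (C * (b - a)), φ b y + m ≤ w y) →
        (∀ r, c ≤ ∫ ζ : I × I, rate f t₀ x₀ D (u.1 r ζ.1) (v.1 r ζ.2)) →
        φ a x + m + (b - a) * (c - η) ≤ stepPay f a b w x u v) := by
  obtain ⟨δ, hδ, h⟩ := hf.exists_expansion hφ hη
  refine ⟨δ, hδ, fun a b x hab ha hb hx w M L m c hw u v => ?_⟩
  have hexp := fun ζ : I × I => abs_le.1 (h a b x hab ha hb hx (fun r => u.1 r ζ.1)
    (fun r => v.1 r ζ.2) (u.measurable_path _) (v.measurable_path _))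
  have hmem : ∀ ζ : I × I, stepFlow f a b x (fun r => u.1 r ζ.1) (fun r => v.1 r ζ.2)
      ∈ Metric.closedBall x (C * (b - a)) := fun ζ => by
    rw [mem_closedBall_iff_norm]
    exact hf.norm_stepFlow_sub_init_le (u.measurable_path _) (v.measurable_path _) hab x
  have hint := hf.integrable_pay hw u v hab x
  obtain ⟨j1, j2, j3⟩ := integral_seed_swap (μ := (volume : Measure (I × I)))
    (hf.measurable_rate_seed t₀ x₀ D u v) (fun r ζ => hf.abs_rate_le t₀ x₀ D _ _) hab
  have hconst : ∀ k : ℝ, ∫ ζ : I × I, (k + ∫ r in a..b, rate f t₀ x₀ D (u.1 r ζ.1) (v.1 r ζ.2))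
      = k + ∫ r in a..b, ∫ ζ : I × I, rate f t₀ x₀ D (u.1 r ζ.1) (v.1 r ζ.2) := fun k => by
    rw [integral_add (integrable_const _) j1, j2]
    simp
  constructor
  · intro hle hc
    have h1 : stepPay f a b w x u v ≤ ∫ ζ : I × I, ((φ a x + m + η * (b - a))
        + ∫ r in a..b, rate f t₀ x₀ D (u.1 r ζ.1) (v.1 r ζ.2)) :=
      integral_mono hint ((integrable_const _).add j1) fun ζ => by
        have := hle _ (hmem ζ)
        have := (hexp ζ).2
        simp only [rate] at this ⊢
        linarith
    have h2 := intervalIntegral.integral_mono_on hab j3 intervalIntegrable_const fun r _ => hc r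
    rw [intervalIntegral.integral_const, smul_eq_mul] at h2
    rw [hconst] at h1
    linarith
  · intro hle hc
    have h1 : ∫ ζ : I × I, ((φ a x + m - η * (b - a))
        + ∫ r in a..b, rate f t₀ x₀ D (u.1 r ζ.1) (v.1 r ζ.2)) ≤ stepPay f a b w x u v :=
      integral_mono ((integrable_const _).add j1) hint fun ζ => by
        have := hle _ (hmem ζ)
        have := (hexp ζ).1
        simp only [rate] at this ⊢
        linarith
    have h2 := intervalIntegral.integral_mono_on hab intervalIntegrable_const j3 fun r _ => hc r
    rw [intervalIntegral.integral_const, smul_eq_mul] at h2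
    rw [hconst] at h1
    linarith

/-- A seed-dependent, time-independent control. -/
def constCtrl {A : Type} [MeasurableSpace A] {χ : I → A} (hχ : Measurable χ) : RandCtrl A :=
  ⟨fun _ h => χ h, hχ.comp measurable_snd⟩

lemma IsDynamics.integrable_rate_seed (hf : IsDynamics f C K) (t₀ : ℝ)
    (x₀ : EuclideanSpace ℝ (Fin d)) (D : ℝ × EuclideanSpace ℝ (Fin d) →L[ℝ] ℝ) (u : RandCtrl U)
    (v : RandCtrl V) (r : ℝ) : Integrable (fun ζ : I × I =>
      rate f t₀ x₀ D (u.1 r ζ.1) (v.1 r ζ.2)) ((volume : Measure I).prod volume) :=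
  Integrable.of_bound ((hf.measurable_rate_seed t₀ x₀ D u v).comp
    measurable_prodMk_left).aestronglyMeasurable _ (ae_of_all _ fun _ => hf.abs_rate_le t₀ x₀ D _ _)

/-- The second player's near-optimal mixed action bounds the one-step value from above. -/
lemma IsDynamics.exists_stepVal_le (hf : IsDynamics f C K)
    (hφ : HasStrictFDerivAt (fun q : ℝ × EuclideanSpace ℝ (Fin d) => φ q.1 q.2) D (t₀, x₀))
    {η : ℝ} (hη : 0 < η) : ∃ δ > 0, ∀ a b x, a ≤ b → |a - t₀| < δ → |b - t₀| < δ → ‖x - x₀‖ < δ →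
      ∀ (w : EuclideanSpace ℝ (Fin d) → ℝ) (M : ℝ) (L : ℝ≥0) (m : ℝ), IsBddLip w M L →
      (∀ y ∈ Metric.closedBall x (C * (b - a)), w y ≤ φ b y + m) →
        stepVal f a b w x ≤ φ a x + m + (b - a) * (mixVal (rate f t₀ x₀ D) + η) := by
  obtain ⟨δ, hδ, h⟩ := hf.exists_step_expansion hφ (half_pos hη)
  obtain ⟨ν, hν⟩ := exists_le_mixVal_add (hf.continuous_rate t₀ x₀ D) (hf.abs_rate_le t₀ x₀ D)
    (half_pos hη)
  obtain ⟨χ, hχ, e⟩ := exists_randCtrl_integral_eq ν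
  refine ⟨δ, hδ, fun a b x hab ha hb hx w M L m hw hle => ?_⟩
  refine stepVal_le hw.bdd (constCtrl hχ) fun u =>
    ((h a b x hab ha hb hx w M L m (mixVal (rate f t₀ x₀ D) + η / 2) hw u (constCtrl hχ)).1 hle
      fun r => ?_).trans_eq (by ring)
  have hi := hf.integrable_rate_seed t₀ x₀ D u (constCtrl hχ) r
  rw [Measure.volume_eq_prod, integral_prod _ hi]
  have h1 := integral_mono hi.integral_prod_left
    (integrable_const (mixVal (rate f t₀ x₀ D) + η / 2)) fun ζ => by
      exact (e _ ((hf.continuous_rate t₀ x₀ D).comp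
        (Continuous.prodMk_right (u.1 r ζ)))).trans_le (hν (u.1 r ζ))
  simpa using h1

/-- The first player's near-optimal mixed action bounds the one-step value from below. -/
lemma IsDynamics.exists_le_stepVal (hf : IsDynamics f C K)
    (hφ : HasStrictFDerivAt (fun q : ℝ × EuclideanSpace ℝ (Fin d) => φ q.1 q.2) D (t₀, x₀))
    {η : ℝ} (hη : 0 < η) : ∃ δ > 0, ∀ a b x, a ≤ b → |a - t₀| < δ → |b - t₀| < δ → ‖x - x₀‖ < δ →
      ∀ (w : EuclideanSpace ℝ (Fin d) → ℝ) (M : ℝ) (L : ℝ≥0) (m : ℝ), IsBddLip w M L →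
      (∀ y ∈ Metric.closedBall x (C * (b - a)), φ b y + m ≤ w y) →
        φ a x + m + (b - a) * (mixVal (rate f t₀ x₀ D) - η) ≤ stepVal f a b w x := by
  obtain ⟨δ, hδ, h⟩ := hf.exists_step_expansion hφ (half_pos hη)
  obtain ⟨μ, hμ⟩ := exists_mixVal_sub_le (hf.abs_rate_le t₀ x₀ D) (half_pos hη)
  obtain ⟨χ, hχ, e⟩ := exists_randCtrl_integral_eq μ
  refine ⟨δ, hδ, fun a b x hab ha hb hx w M L m hw hle => ?_⟩
  refine le_stepVal hw.bdd fun v => ⟨constCtrl hχ, le_trans (Eq.le (by ring))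
    ((h a b x hab ha hb hx w M L m (mixVal (rate f t₀ x₀ D) - η / 2) hw (constCtrl hχ) v).2 hle
      fun r => ?_)⟩
  have hi := hf.integrable_rate_seed t₀ x₀ D (constCtrl hχ) v r
  rw [Measure.volume_eq_prod, integral_prod_symm _ hi]
  have h1 := integral_mono (integrable_const (mixVal (rate f t₀ x₀ D) - η / 2))
    hi.integral_prod_right fun ζ => by
      exact (hμ (v.1 r ζ)).trans_eq (e _ ((hf.continuous_rate t₀ x₀ D).comp
        (Continuous.prodMk_left (v.1 r ζ)))).symm
  simpa using h1

end StepExpansion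

/-! ### The Hamiltonian as the value of the mixed extension -/

section HamiltonianValue

set_option linter.unusedSectionVars false

variable {d : ℕ} {U V : Type} [MetricSpace U] [CompactSpace U] [MetricSpace V] [CompactSpace V]
  [MeasurableSpace U] [BorelSpace U] [MeasurableSpace V] [BorelSpace V] [Nonempty U] [Nonempty V]
  {f : ℝ → EuclideanSpace ℝ (Fin d) → U → V → EuclideanSpace ℝ (Fin d)} {C : ℝ} {K : ℝ≥0}
  {φ : ℝ → EuclideanSpace ℝ (Fin d) → ℝ} {D : ℝ × EuclideanSpace ℝ (Fin d) →L[ℝ] ℝ}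
  {t₀ : ℝ} {x₀ : EuclideanSpace ℝ (Fin d)}

lemma IsDynamics.inner_ftilde (hf : IsDynamics f C K)
    (hD : HasFDerivAt (fun q : ℝ × EuclideanSpace ℝ (Fin d) => φ q.1 q.2) D (t₀, x₀))
    (μ : ProbabilityMeasure U) (ν : ProbabilityMeasure V) :
    ⟪ftilde U V f t₀ x₀ μ ν, gradient (fun y => φ t₀ y) x₀⟫
      = (∫ u, ∫ v, rate f t₀ x₀ D u v ∂(ν : Measure V) ∂(μ : Measure U)) - D (1, 0) := by
  have hy : HasFDerivAt (fun y => φ t₀ y)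
      (D.comp (ContinuousLinearMap.inr ℝ ℝ (EuclideanSpace ℝ (Fin d)))) x₀ :=
    hD.comp x₀ (hasFDerivAt_prodMk_right t₀ x₀)
  set ℓ := D.comp (ContinuousLinearMap.inr ℝ ℝ (EuclideanSpace ℝ (Fin d))) with hℓ
  have hc : Continuous fun p : U × V => f t₀ x₀ p.1 p.2 := hf.cont.comp (by fun_prop :
    Continuous fun p : U × V => (t₀, x₀, p.1, p.2))
  have hi : Integrable (fun p : U × V => f t₀ x₀ p.1 p.2) ((μ : Measure U).prod (ν : Measure V)) :=
    Integrable.of_bound hc.measurable.aestronglyMeasurable C (ae_of_all _ fun p => hf.bdd _ _ _ _)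
  have hi2 : ∀ u, Integrable (fun v => f t₀ x₀ u v) (ν : Measure V) := fun u =>
    Integrable.of_bound (hc.comp (Continuous.prodMk_right u)).measurable.aestronglyMeasurable C
      (ae_of_all _ fun p => hf.bdd _ _ _ _)
  have e : ∀ u, ∫ v, rate f t₀ x₀ D u v ∂(ν : Measure V)
      = D (1, 0) + ℓ (∫ v, f t₀ x₀ u v ∂(ν : Measure V)) := fun u => by
    simp only [rate]
    have : ∀ v, D (1, f t₀ x₀ u v) = D (1, 0) + ℓ (f t₀ x₀ u v) := fun v => by
      rw [D.apply_prod_real, one_mul]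
    simp_rw [this]
    rw [integral_add (integrable_const _) (ℓ.integrable_comp (hi2 u)),
      ContinuousLinearMap.integral_comp_comm _ (hi2 u)]
    simp
  simp_rw [e]
  rw [integral_add (integrable_const _) (ℓ.integrable_comp hi.integral_prod_left),
    ContinuousLinearMap.integral_comp_comm _ hi.integral_prod_left, real_inner_comm,
    inner_gradient_left, hy.fderiv]
  simp [ftilde]

lemma IsDynamics.mixVal_rate (hf : IsDynamics f C K)
    (hD : HasFDerivAt (fun q : ℝ × EuclideanSpace ℝ (Fin d) => φ q.1 q.2) D (t₀, x₀)) :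
    mixVal (rate f t₀ x₀ D)
      = deriv (fun s => φ s x₀) t₀ + ham U V f t₀ x₀ (gradient (fun y => φ t₀ y) x₀) := by
  have hd : deriv (fun s => φ s x₀) t₀ = D (1, 0) :=
    (HasFDerivAt.comp_hasDerivAt (f := fun s => (s, x₀)) t₀ hD
      ((hasDerivAt_id t₀).prodMk (hasDerivAt_const t₀ x₀))).deriv
  have : Nonempty (ProbabilityMeasure U) := ⟨diracProba (Classical.arbitrary U)⟩
  have : Nonempty (ProbabilityMeasure V) := ⟨diracProba (Classical.arbitrary V)⟩
  have hb := hf.abs_rate_le t₀ x₀ D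
  have : ham U V f t₀ x₀ (gradient (fun y => φ t₀ y) x₀) = mixVal (rate f t₀ x₀ D) - D (1, 0) := by
    simp_rw [ham, hf.inner_ftilde hD, ← ciInf_sub (bddBelow_range_mix hb _)]
    rw [← ciSup_sub (bddAbove_range_mix hb)]
    rfl
  rw [this, hd]
  ring

end HamiltonianValue

/-! ### Comparison on backward cones -/

section Cone

variable {E : Type*} [NormedAddCommGroup E] {T C θ : ℝ}

/-- A one-step decrease condition propagates backwards along the grid inside a cone. -/
lemma Partition.cone_comparison {π : Partition T} {w φ : ℝ → E → ℝ} {i k : ℕ} (hik : i ≤ k)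
    {x₀ : E} {M : ℝ}
    (hstep : ∀ j, i ≤ j → j < k → ∀ x ∈ Metric.closedBall x₀ (C * (π.t j - π.t i)), ∀ m,
      (∀ y ∈ Metric.closedBall x (C * (π.t (j + 1) - π.t j)),
        w (π.t (j + 1)) y ≤ φ (π.t (j + 1)) y + m) →
      w (π.t j) x ≤ φ (π.t j) x + m - θ * (π.t (j + 1) - π.t j))
    (hk : ∀ y ∈ Metric.closedBall x₀ (C * (π.t k - π.t i)), w (π.t k) y ≤ φ (π.t k) y + M) :
    w (π.t i) x₀ ≤ φ (π.t i) x₀ + M - θ * (π.t k - π.t i) := by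
  have key : ∀ x ∈ Metric.closedBall x₀ (C * (π.t i - π.t i)),
      w (π.t i) x ≤ φ (π.t i) x + M - θ * (π.t k - π.t i) := by
    refine Nat.decreasingInduction' (P := fun j => ∀ x ∈ Metric.closedBall x₀
      (C * (π.t j - π.t i)), w (π.t j) x ≤ φ (π.t j) x + M - θ * (π.t k - π.t j)) ?_ hik ?_
    · intro j hjk hij ih x hx
      refine (hstep j hij hjk x hx (M - θ * (π.t k - π.t (j + 1))) fun y hy => ?_).trans_eq
        (by ring)
      refine (ih y ?_).trans_eq (by ring)
      rw [Metric.mem_closedBall] at *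
      linarith [dist_triangle y x x₀]
    · intro x hx
      simpa using hk x hx
  exact key x₀ (by simp)

/-- A limit of functions which decrease strictly relative to a test function, one step of the
partition at a time, cannot touch the test function from below. -/
lemma not_isLocalMaxOn_of_step [ProperSpace E] {prt : ℕ → Partition T}
    (hmesh : Tendsto (fun n => (prt n).mesh) atTop (𝓝 0)) {w : ℕ → ℝ → E → ℝ} {W φ : ℝ → E → ℝ}
    (hW : ContinuousOn (fun q : ℝ × E => W q.1 q.2) (Icc (0 : ℝ) T ×ˢ univ))
    (hφ : Continuous fun q : ℝ × E => φ q.1 q.2)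
    (hconv : ∀ K : Set (ℝ × E), IsCompact K → K ⊆ Icc (0 : ℝ) T ×ˢ univ →
      TendstoUniformlyOn (fun n q => w n q.1 q.2) (fun q => W q.1 q.2) atTop K)
    {t₀ : ℝ} {x₀ : E} (ht₀ : t₀ ∈ Ico 0 T) (hC : 0 ≤ C) (hθ : 0 < θ) {δ : ℝ} (hδ : 0 < δ)
    (hstep : ∀ n j, j + 1 < (prt n).n → |(prt n).t j - t₀| < δ → |(prt n).t (j + 1) - t₀| < δ →
      ∀ x, ‖x - x₀‖ < δ → ∀ m,
      (∀ y ∈ Metric.closedBall x (C * ((prt n).t (j + 1) - (prt n).t j)),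
        w n ((prt n).t (j + 1)) y ≤ φ ((prt n).t (j + 1)) y + m) →
      w n ((prt n).t j) x
        ≤ φ ((prt n).t j) x + m - θ * ((prt n).t (j + 1) - (prt n).t j)) :
    ¬ IsLocalMaxOn (fun q : ℝ × E => W q.1 q.2 - φ q.1 q.2) (Icc (0 : ℝ) T ×ˢ univ) (t₀, x₀) := by
  intro hmax
  have hS : (t₀, x₀) ∈ Icc (0 : ℝ) T ×ˢ (univ : Set E) := ⟨⟨ht₀.1, ht₀.2.le⟩, trivial⟩
  obtain ⟨ρ, hρ, hmax⟩ := Metric.mem_nhdsWithin_iff.1 hmax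
  set m₀ := W t₀ x₀ - φ t₀ x₀ with hm₀
  set κ := min ρ δ with hκ
  have hκ0 : 0 < κ := lt_min hρ hδ
  set h := min (κ / (4 * (C + 1))) ((T - t₀) / 3) with hh
  have hT : 0 < T - t₀ := sub_pos.2 ht₀.2
  have hh0 : 0 < h := lt_min (by positivity) (by positivity)
  have hh1 : 4 * (C + 1) * h ≤ κ := by
    have := min_le_left (κ / (4 * (C + 1))) ((T - t₀) / 3)
    rw [← hh, le_div_iff₀ (by positivity)] at this
    linarith
  have hh2 : 3 * h ≤ T - t₀ := by
    have := min_le_right (κ / (4 * (C + 1))) ((T - t₀) / 3)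
    rw [← hh] at this
    linarith
  have hCh : 0 ≤ C * h := by positivity
  set ε := θ * h / 8 with hε
  have hε0 : 0 < ε := by positivity
  obtain ⟨τ, hτ, hcts⟩ := Metric.continuousWithinAt_iff.1
    ((hW.sub hφ.continuousOn) (t₀, x₀) hS) ε hε0
  have hK : IsCompact (Icc (0 : ℝ) T ×ˢ Metric.closedBall x₀ (κ / 2)) :=
    isCompact_Icc.prod (isCompact_closedBall _ _)
  obtain ⟨n, hn1, hn2⟩ := ((Metric.tendstoUniformlyOn_iff.1
    (hconv _ hK (prod_mono le_rfl (subset_univ _))) ε hε0).and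
    (hmesh.eventually (gt_mem_nhds (lt_min (half_pos hh0) hτ)))).exists
  set π := prt n
  have hmesh1 := hn2.trans_le (min_le_left _ _)
  have hmesh2 := hn2.trans_le (min_le_right _ _)
  set i := π.idx t₀
  set k := π.idx (t₀ + h)
  have hi := π.mem_Ico_idx ht₀
  have hk := π.mem_Ico_idx (s := t₀ + h) ⟨by linarith [ht₀.1], by linarith⟩
  have hin : i < π.n := π.idx_lt _
  have hkn : k < π.n := π.idx_lt _
  have hi3 := π.sub_le_mesh hin
  have hk3 := π.sub_le_mesh hkn
  have hi1 : π.t i ≤ t₀ := hi.1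
  have hi2 : t₀ < π.t (i + 1) := hi.2
  have hk1 : π.t k ≤ t₀ + h := hk.1
  have hk2 : t₀ + h < π.t (k + 1) := hk.2
  have hik : i ≤ k := by
    by_contra hlt
    have := π.t_le (i := k + 1) (j := i) (by omega) hin.le
    linarith
  have hnear : ∀ j, i ≤ j → j ≤ k → |π.t j - t₀| < κ := fun j hij hjk => by
    have h1 := π.t_le hij (hjk.trans hkn.le)
    have h2 := π.t_le hjk hkn.le
    rw [abs_lt]
    constructor <;> nlinarith
  have hball : C * (π.t k - π.t i) ≤ κ / 2 := by
    have : C * (π.t k - π.t i) ≤ C * (2 * h) := mul_le_mul_of_nonneg_left (by linarith) hC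
    linarith
  have hcone := π.cone_comparison (C := C) (θ := θ) (w := w n) (φ := φ) (x₀ := x₀) (M := m₀ + ε) hik
    (fun j hij hjk x hx m hm => by
      refine hstep n j (show j + 1 < π.n by omega) ((hnear j hij hjk.le).trans_le (min_le_right _ _))
        ((hnear (j + 1) (by omega) hjk).trans_le (min_le_right _ _)) x ?_ m hm
      have h2 := π.t_le hjk.le hkn.le
      have : C * (π.t j - π.t i) ≤ C * (π.t k - π.t i) :=
        mul_le_mul_of_nonneg_left (by linarith) hC
      rw [mem_closedBall_iff_norm] at hx
      exact lt_of_lt_of_le (by linarith) (min_le_right ρ δ))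
    (fun y hy => by
      have hy' : dist y x₀ ≤ κ / 2 := Metric.closedBall_subset_closedBall hball hy
      have h1 := hn1 (π.t k, y) ⟨π.t_mem hkn.le, hy'⟩
      have h2 : W (π.t k) y - φ (π.t k) y ≤ m₀ := @hmax (π.t k, y) ⟨by
        rw [Metric.mem_ball, Prod.dist_eq, max_lt_iff, Real.dist_eq]
        refine ⟨(hnear k hik le_rfl).trans_le (min_le_left _ _), lt_of_le_of_lt hy' ?_⟩
        exact lt_of_lt_of_le (by linarith) (min_le_left ρ δ), π.t_mem hkn.le, trivial⟩
      rw [Real.dist_eq, abs_lt] at h1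
      linarith [h1.1])
  have h1 := hn1 (π.t i, x₀) ⟨π.t_mem hin.le, Metric.mem_closedBall_self (half_pos hκ0).le⟩
  have h2 : dist (W (π.t i) x₀ - φ (π.t i) x₀) m₀ < ε :=
    hcts (x := (π.t i, x₀)) ⟨π.t_mem hin.le, trivial⟩ (by
    rw [Prod.dist_eq, dist_self, max_lt_iff, Real.dist_eq, abs_lt]
    exact ⟨⟨by linarith, by linarith⟩, hτ⟩)
  rw [Real.dist_eq, abs_lt] at h1 h2
  have h3 : θ * (h / 2) ≤ θ * (π.t k - π.t i) := mul_le_mul_of_nonneg_left (by linarith) hθ.le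
  linarith [h1.2, h2.1]

end Cone

/-! ### Time-clipped dynamics and the terminal condition -/

section Clipping

set_option linter.unusedSectionVars false

variable {d : ℕ} {U V : Type} [MetricSpace U] [CompactSpace U] [MetricSpace V] [CompactSpace V]
  [MeasurableSpace U] [BorelSpace U] [MeasurableSpace V] [BorelSpace V] [Nonempty U] [Nonempty V]
  {f f' : ℝ → EuclideanSpace ℝ (Fin d) → U → V → EuclideanSpace ℝ (Fin d)} {C : ℝ} {K : ℝ≥0}
  {g : EuclideanSpace ℝ (Fin d) → ℝ} {M : ℝ} {L : ℝ≥0} {T : ℝ} {P : Measure Omega}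

lemma sol_congr (h : ∀ r ∈ Icc 0 T, f r = f' r) {t : ℝ} (ht : 0 ≤ t)
    (x : EuclideanSpace ℝ (Fin d)) (u : ℝ → U) (v : ℝ → V) : sol f T t x u v = sol f' T t x u v := by
  have : IsSol f T t x u v = IsSol f' T t x u v := by
    funext X
    refine propext (and_congr_right fun _ => forall₂_congr fun s hs => ?_)
    rw [intervalIntegral.integral_congr (g := fun r => f' r (X r) (u r) (v r)) fun r hr => ?_]
    rw [uIcc_of_le hs.1] at hr
    simp only [h r ⟨ht.trans hr.1, hr.2.trans hs.2⟩]
  rw [sol, this, sol]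

lemma upperValD_congr (h : ∀ r ∈ Icc 0 T, f r = f' r) (π : Partition T) {t : ℝ} (ht : 0 ≤ t)
    (x : EuclideanSpace ℝ (Fin d)) : upperValD U V f g P π t x = upperValD U V f' g P π t x := by
  have : payoff f g P π t x = payoff f' g P π t x := by
    funext α β ω
    simp only [payoff, solStrat, sol_congr h ht]
  have h2 : IsUpperVal U V f g P π t x = IsUpperVal U V f' g P π t x := by
    funext S
    simp only [IsUpperVal, this]
  simp only [upperValD, upperVal, h2]

lemma ham_congr {t : ℝ} (h : f t = f' t) (x p : EuclideanSpace ℝ (Fin d)) :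
    ham U V f t x p = ham U V f' t x p := by
  simp only [ham, ftilde, h]

/-- Dynamics given on `[0,T]` extend to dynamics on `ℝ`. -/
lemma exists_isDynamics (hT : 0 ≤ T) (hbdd : ∀ t x u v, ‖f t x u v‖ ≤ C)
    (hcont : ContinuousOn
      (fun q : ℝ × EuclideanSpace ℝ (Fin d) × U × V => f q.1 q.2.1 q.2.2.1 q.2.2.2)
      (Icc (0 : ℝ) T ×ˢ univ))
    (hlip : ∀ t u v, LipschitzWith K fun x => f t x u v) :
    ∃ f' : ℝ → EuclideanSpace ℝ (Fin d) → U → V → EuclideanSpace ℝ (Fin d),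
      IsDynamics f' C K ∧ ∀ r ∈ Icc 0 T, f r = f' r := by
  refine ⟨fun t => f (projIcc 0 T hT t), ⟨?_, fun _ => hbdd _, fun _ => hlip _⟩, fun r hr => ?_⟩
  · exact hcont.comp_continuous (f := fun q : ℝ × EuclideanSpace ℝ (Fin d) × U × V =>
      ((projIcc 0 T hT q.1 : ℝ), q.2)) ((continuous_subtype_val.comp
        (continuous_projIcc.comp continuous_fst)).prodMk continuous_snd)
      fun q => ⟨(projIcc 0 T hT q.1).2, trivial⟩
  · simp only [projIcc_of_mem hT hr]

lemma IsDynamics.terminal_eq [IsProbabilityMeasure P] (hP : IsProductMeasure P)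
    (hf : IsDynamics f C K) (hg : IsBddLip g M L) {prt : ℕ → Partition T} (hT : 0 ≤ T)
    (hmesh : Tendsto (fun n => (prt n).mesh) atTop (𝓝 0))
    {W : ℝ → EuclideanSpace ℝ (Fin d) → ℝ}
    (hW : ContinuousOn (fun q : ℝ × EuclideanSpace ℝ (Fin d) => W q.1 q.2)
      (Icc (0 : ℝ) T ×ˢ univ))
    (hconv : ∀ K : Set (ℝ × EuclideanSpace ℝ (Fin d)),
      IsCompact K → K ⊆ Icc (0 : ℝ) T ×ˢ univ →
      TendstoUniformlyOn (fun n q => upperValD U V f g P (prt n) q.1 q.2)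
        (fun q => W q.1 q.2) atTop K) (x : EuclideanSpace ℝ (Fin d)) : W T x = g x := by
  have hC := hf.nonneg
  refine eq_of_forall_dist_le fun ε hε => ?_
  rw [Real.dist_eq]
  have hS : (T, x) ∈ Icc (0 : ℝ) T ×ˢ (univ : Set (EuclideanSpace ℝ (Fin d))) :=
    ⟨⟨hT, le_rfl⟩, trivial⟩
  have hε3 : 0 < ε / 3 := by positivity
  obtain ⟨τ, hτ, hcts⟩ := Metric.continuousWithinAt_iff.1 (hW (T, x) hS) (ε / 3) hε3
  have hK : IsCompact (Icc (0 : ℝ) T ×ˢ ({x} : Set (EuclideanSpace ℝ (Fin d)))) :=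
    isCompact_Icc.prod isCompact_singleton
  have hκ : 0 < ε / 3 / (L * C + 1) := by positivity
  obtain ⟨n, hn1, hn2⟩ := ((Metric.tendstoUniformlyOn_iff.1
    (hconv _ hK (prod_mono le_rfl (subset_univ _))) (ε / 3) hε3).and
    (hmesh.eventually (gt_mem_nhds (lt_min hτ hκ)))).exists
  set π := prt n
  obtain ⟨j, hj⟩ : ∃ j, π.n = j + 1 := ⟨π.n - 1, by have := π.npos; omega⟩
  have hjn : j < π.n := by omega
  have hlast : π.t (j + 1) = T := by rw [← hj, π.map_last]
  have hle := π.sub_le_mesh hjn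
  have hlt := π.mono j hjn
  rw [hlast] at hle hlt
  have h1 : dist (W (π.t j) x) (upperValD U V f g P π (π.t j) x) < ε / 3 :=
    hn1 (π.t j, x) ⟨π.t_mem hjn.le, rfl⟩
  have h2 : dist (W (π.t j) x) (W T x) < ε / 3 := hcts (x := (π.t j, x))
    ⟨π.t_mem hjn.le, trivial⟩ (by
      rw [Prod.dist_eq, dist_self, max_lt_iff, Real.dist_eq, abs_lt]
      have := hn2.trans_le (min_le_left _ _)
      exact ⟨⟨by linarith, by linarith⟩, hτ⟩)
  have hg' : gridVal f g π (j + 1) = g := by rw [← hj, gridVal_last]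
  rw [upperValD_eq_gridVal hP hf hg hjn, gridVal_of_lt hjn, hlast, hg'] at h1
  have h3 := hf.abs_stepVal_sub_le hg hlt.le x
  have h4 : L * (C * (T - π.t j)) ≤ ε / 3 := by
    have := hn2.trans_le (min_le_right _ _)
    rw [lt_div_iff₀ (by positivity)] at this
    have hLC : (0 : ℝ) ≤ L * C := by positivity
    nlinarith
  rw [Real.dist_eq] at h1 h2
  rw [abs_lt] at h1 h2
  rw [abs_le] at h3 ⊢
  constructor <;> linarith [h1.1, h1.2, h2.1, h2.2, h3.1, h3.2]

end Clipping

/-! ### The sub- and supersolution properties -/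

section Viscosity

set_option linter.unusedSectionVars false

variable {d : ℕ} {U V : Type} [MetricSpace U] [CompactSpace U] [MetricSpace V] [CompactSpace V]
  [MeasurableSpace U] [BorelSpace U] [MeasurableSpace V] [BorelSpace V] [Nonempty U] [Nonempty V]
  {f : ℝ → EuclideanSpace ℝ (Fin d) → U → V → EuclideanSpace ℝ (Fin d)} {C : ℝ} {K : ℝ≥0}
  {g : EuclideanSpace ℝ (Fin d) → ℝ} {M : ℝ} {L : ℝ≥0} {T : ℝ} {P : Measure Omega}
  [IsProbabilityMeasure P] {prt : ℕ → Partition T} {W φ : ℝ → EuclideanSpace ℝ (Fin d) → ℝ}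
  {t₀ : ℝ} {x₀ : EuclideanSpace ℝ (Fin d)}

lemma IsDynamics.subsol_ineq (hP : IsProductMeasure P) (hf : IsDynamics f C K)
    (hg : IsBddLip g M L) (hmesh : Tendsto (fun n => (prt n).mesh) atTop (𝓝 0))
    (hW : ContinuousOn (fun q : ℝ × EuclideanSpace ℝ (Fin d) => W q.1 q.2)
      (Icc (0 : ℝ) T ×ˢ univ))
    (hconv : ∀ K : Set (ℝ × EuclideanSpace ℝ (Fin d)),
      IsCompact K → K ⊆ Icc (0 : ℝ) T ×ˢ univ →
      TendstoUniformlyOn (fun n q => upperValD U V f g P (prt n) q.1 q.2)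
        (fun q => W q.1 q.2) atTop K)
    (hφ : ContDiff ℝ 1 (fun q : ℝ × EuclideanSpace ℝ (Fin d) => φ q.1 q.2)) (ht₀ : t₀ ∈ Ico 0 T)
    (hmax : IsLocalMaxOn (fun q : ℝ × EuclideanSpace ℝ (Fin d) => W q.1 q.2 - φ q.1 q.2)
      (Icc (0 : ℝ) T ×ˢ univ) (t₀, x₀)) :
    0 ≤ deriv (fun s => φ s x₀) t₀ + ham U V f t₀ x₀ (gradient (fun y => φ t₀ y) x₀) := by
  have hD := hφ.contDiffAt.hasStrictFDerivAt (x := (t₀, x₀)) one_ne_zero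
  rw [← hf.mixVal_rate hD.hasFDerivAt]
  by_contra! hneg
  obtain ⟨δ, hδ, hstep⟩ := hf.exists_stepVal_le hD (half_pos (neg_pos.2 hneg))
  refine not_isLocalMaxOn_of_step hmesh hW hφ.continuous hconv ht₀ hf.nonneg
    (half_pos (neg_pos.2 hneg)) hδ (fun n j hj ha hb x hx m hle => ?_) hmax
  have hj' : j < (prt n).n := by omega
  obtain ⟨L', hL'⟩ := hf.exists_isBddLip_gridVal hg hj.le
  rw [upperValD_eq_gridVal hP hf hg hj', gridVal_of_lt hj']
  refine (hstep _ _ x ((prt n).mono j hj').le ha hb hx _ M L' m hL' fun y hy => ?_).trans_eq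
    (by ring)
  rw [← upperValD_eq_gridVal hP hf hg hj]
  exact hle y hy

lemma IsDynamics.supersol_ineq (hP : IsProductMeasure P) (hf : IsDynamics f C K)
    (hg : IsBddLip g M L) (hmesh : Tendsto (fun n => (prt n).mesh) atTop (𝓝 0))
    (hW : ContinuousOn (fun q : ℝ × EuclideanSpace ℝ (Fin d) => W q.1 q.2)
      (Icc (0 : ℝ) T ×ˢ univ))
    (hconv : ∀ K : Set (ℝ × EuclideanSpace ℝ (Fin d)),
      IsCompact K → K ⊆ Icc (0 : ℝ) T ×ˢ univ →
      TendstoUniformlyOn (fun n q => upperValD U V f g P (prt n) q.1 q.2)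
        (fun q => W q.1 q.2) atTop K)
    (hφ : ContDiff ℝ 1 (fun q : ℝ × EuclideanSpace ℝ (Fin d) => φ q.1 q.2)) (ht₀ : t₀ ∈ Ico 0 T)
    (hmin : IsLocalMinOn (fun q : ℝ × EuclideanSpace ℝ (Fin d) => W q.1 q.2 - φ q.1 q.2)
      (Icc (0 : ℝ) T ×ˢ univ) (t₀, x₀)) :
    deriv (fun s => φ s x₀) t₀ + ham U V f t₀ x₀ (gradient (fun y => φ t₀ y) x₀) ≤ 0 := by
  have hD := hφ.contDiffAt.hasStrictFDerivAt (x := (t₀, x₀)) one_ne_zero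
  rw [← hf.mixVal_rate hD.hasFDerivAt]
  by_contra! hpos
  obtain ⟨δ, hδ, hstep⟩ := hf.exists_le_stepVal hD (half_pos hpos)
  refine not_isLocalMaxOn_of_step (x₀ := x₀) (W := fun t x => -W t x) (φ := fun t x => -φ t x)
    (w := fun n t x => -upperValD U V f g P (prt n) t x) hmesh hW.neg hφ.continuous.neg
    (fun K hK hKT => ?_) ht₀ hf.nonneg (half_pos hpos) hδ
    (fun n j hj ha hb x hx m hle => ?_) ?_
  · simpa only [Metric.tendstoUniformlyOn_iff, dist_neg_neg] using hconv K hK hKT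
  · have hj' : j < (prt n).n := by omega
    obtain ⟨L', hL'⟩ := hf.exists_isBddLip_gridVal hg hj.le
    have := hstep _ _ x ((prt n).mono j hj').le ha hb hx _ M L' (-m) hL' fun y hy => by
      rw [← upperValD_eq_gridVal hP hf hg hj]
      linarith [hle y hy]
    rw [upperValD_eq_gridVal hP hf hg hj', gridVal_of_lt hj']
    linarith
  · have e : (fun q : ℝ × EuclideanSpace ℝ (Fin d) => -W q.1 q.2 - -φ q.1 q.2)
        = fun q => -(W q.1 q.2 - φ q.1 q.2) := by
      funext q
      ring
    rw [e]
    exact hmin.neg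

end Viscosity

/-- **Proposition 4.2.** If the upper value functions `U^{Π_n}` along a sequence
of partitions with vanishing mesh converge uniformly on compacts to a bounded continuous function
`U`, then `U` is a viscosity solution (both sub- and supersolution) of the
Hamilton–Jacobi–Isaacs equation `∂_t W + sup_{μ ∈ ΔU} inf_{ν ∈ ΔV} f̃(t,x,μ,ν)·∇W = 0`,
`W(T,·) = g`. -/
theorem statement_15
    {d : ℕ} {U V : Type} [MetricSpace U] [CompactSpace U] [MetricSpace V] [CompactSpace V]
    [MeasurableSpace U] [BorelSpace U] [MeasurableSpace V] [BorelSpace V]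
    [Nonempty U] [Nonempty V]
    (T : ℝ) (hT : 0 < T)
    (f : ℝ → EuclideanSpace ℝ (Fin d) → U → V → EuclideanSpace ℝ (Fin d))
    (hf_bdd : ∃ C : ℝ, ∀ t x u v, ‖f t x u v‖ ≤ C)
    (hf_cont : ContinuousOn
      (fun q : ℝ × EuclideanSpace ℝ (Fin d) × U × V => f q.1 q.2.1 q.2.2.1 q.2.2.2)
      (Icc (0 : ℝ) T ×ˢ univ))
    (hf_lip : ∃ K : ℝ≥0, ∀ t u v, LipschitzWith K fun x => f t x u v)
    (g : EuclideanSpace ℝ (Fin d) → ℝ)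
    (hg_bdd : ∃ C : ℝ, ∀ x, |g x| ≤ C)
    (hg_lip : ∃ K : ℝ≥0, LipschitzWith K g)
    (P : Measure Omega) [IsProbabilityMeasure P] (hP : IsProductMeasure P)
    (prt : ℕ → Partition T)
    (hmesh : Tendsto (fun n => (prt n).mesh) atTop (𝓝 0))
    (W : ℝ → EuclideanSpace ℝ (Fin d) → ℝ)
    (hWbdd : ∃ M : ℝ, ∀ t ∈ Icc (0 : ℝ) T, ∀ x, |W t x| ≤ M)
    (hWcont : ContinuousOn (fun q : ℝ × EuclideanSpace ℝ (Fin d) => W q.1 q.2)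
      (Icc (0 : ℝ) T ×ˢ univ))
    (hconv : ∀ K : Set (ℝ × EuclideanSpace ℝ (Fin d)),
      IsCompact K → K ⊆ Icc (0 : ℝ) T ×ˢ univ →
      TendstoUniformlyOn (fun n q => upperValD U V f g P (prt n) q.1 q.2)
        (fun q => W q.1 q.2) atTop K) :
    IsViscSubsol U V f g T W ∧ IsViscSupersol U V f g T W := by
  obtain ⟨C, hC⟩ := hf_bdd
  obtain ⟨K, hK⟩ := hf_lip
  obtain ⟨M, hM⟩ := hg_bdd
  obtain ⟨L, hL⟩ := hg_lip
  obtain ⟨f', hf, hff'⟩ := exists_isDynamics hT.le hC hf_cont hK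
  have hg : IsBddLip g M L := ⟨hM, hL⟩
  have hconv' : ∀ K : Set (ℝ × EuclideanSpace ℝ (Fin d)),
      IsCompact K → K ⊆ Icc (0 : ℝ) T ×ˢ univ →
      TendstoUniformlyOn (fun n q => upperValD U V f' g P (prt n) q.1 q.2)
        (fun q => W q.1 q.2) atTop K := fun K hK hKT =>
    (hconv K hK hKT).congr (Eventually.of_forall fun n q hq =>
      upperValD_congr hff' (prt n) (hKT hq).1.1 q.2)
  have hterm := hf.terminal_eq hP hg hT.le hmesh hWcont hconv'
  refine ⟨⟨fun x => (hterm x).le, fun φ hφ t x ht hmax => ?_⟩,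
    ⟨fun x => (hterm x).ge, fun φ hφ t x ht hmin => ?_⟩⟩
  · rw [ham_congr (hff' t (Ico_subset_Icc_self ht))]
    exact hf.subsol_ineq hP hg hmesh hWcont hconv' hφ ht hmax
  · rw [ham_congr (hff' t (Ico_subset_Icc_self ht))]
    exact hf.supersol_ineq hP hg hmesh hWcont hconv' hφ ht hmin

end DGameFormal
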